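/- Let H be a bipartite graph and G = H_T obtained by attaching, at each vertex of a subset T ⊆ V(H), a graph that is a union of complete graphs sharing that common vertex. Then reg(S/I(G)^{(r)}) ≤ 2r + reg(S/I(G)) − 2 for all r ≥ 1. -/

import Mathlib

open MvPolynomial

noncomputable section

namespace EdgeIdealReg

open scoped Classical

/-- The edge ideal of a simple graph, in the polynomial ring with variables the vertices. -/
def edgeIdeal (K : Type) [Field K] {V : Type} (G : SimpleGraph V) :
    Ideal (MvPolynomial V K) :=
  Ideal.span { p | ∃ u v : V, G.Adj u v ∧ p = X u * X v }

/-- The edge ideal of the induced subgraph on a set `s` of vertices, viewed inside the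
polynomial ring of the ambient graph (extra variables do not change the regularity). -/
def edgeIdealOn (K : Type) [Field K] {V : Type} (G : SimpleGraph V) (s : Set V) :
    Ideal (MvPolynomial V K) :=
  Ideal.span { p | ∃ u v : V, G.Adj u v ∧ u ∈ s ∧ v ∈ s ∧ p = X u * X v }

/-- The `r`-th symbolic power of an ideal: the intersection over all minimal primes `p` of `I`
of the contraction of `I^r` localized at `p`; concretely,
`f ∈ I^{(r)}` iff for every minimal prime `p` of `I` there is `s ∉ p` with `s * f ∈ I ^ r`. -/
def symbolicPower {R : Type} [CommRing R] (I : Ideal R) (r : ℕ) : Ideal R where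
  carrier := { f | ∀ p ∈ I.minimalPrimes, ∃ s, s ∉ p ∧ s * f ∈ I ^ r }
  zero_mem' := by
    intro p hp
    exact ⟨1, (Ideal.ne_top_iff_one p).mp hp.1.1.ne_top, by simp⟩
  add_mem' := by
    intro a b ha hb p hp
    obtain ⟨s, hs, hsa⟩ := ha p hp
    obtain ⟨t, ht, htb⟩ := hb p hp
    refine ⟨s * t, fun h => ?_, ?_⟩
    · rcases hp.1.1.mem_or_mem h with h' | h'
      · exact hs h'
      · exact ht h'
    · have : s * t * (a + b) = t * (s * a) + s * (t * b) := by ring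
      rw [this]
      exact Ideal.add_mem _ (Ideal.mul_mem_left _ _ hsa) (Ideal.mul_mem_left _ _ htb)
  smul_mem' := by
    intro c f hf p hp
    obtain ⟨s, hs, hsf⟩ := hf p hp
    refine ⟨s, hs, ?_⟩
    have : s * (c • f) = c * (s * f) := by
      simp only [smul_eq_mul]; ring
    rw [this]
    exact Ideal.mul_mem_left _ _ hsf

/-- Symbolic power with an integer exponent, with the convention `I^{(k)} = S` for `k ≤ 0`. -/
def symbolicPowerZ {R : Type} [CommRing R] (I : Ideal R) (k : ℤ) : Ideal R :=
  if k ≤ 0 then ⊤ else symbolicPower I k.toNat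

/-- A graded free resolution of `S/I` over the polynomial ring `S = K[x_v]`:
`⋯ → F_{i+1} → F_i → ⋯ → F_0 = S → S/I → 0`, where `F_i` is a graded free module with
basis elements of degrees `deg i k`, the differentials are given by matrices of homogeneous
polynomials of the appropriate degrees, the image of `F_1 → F_0 = S` is `I`, and the
complex is exact in positive homological degrees. -/
structure GradedFreeResolution {K : Type} [Field K] {σ : Type}
    (I : Ideal (MvPolynomial σ K)) where
  rank : ℕ → ℕ
  deg : (i : ℕ) → Fin (rank i) → ℕ
  rank_zero : rank 0 = 1
  deg_zero : ∀ k, deg 0 k = 0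
  mat : (i : ℕ) → Matrix (Fin (rank i)) (Fin (rank (i + 1))) (MvPolynomial σ K)
  homog : ∀ i k j, mat i k j = 0 ∨
    ∃ e, deg (i + 1) j = deg i k + e ∧ (mat i k j).IsHomogeneous e
  range_zero : ∀ f : MvPolynomial σ K,
    f ∈ I ↔ (fun _ => f) ∈ LinearMap.range (Matrix.mulVecLin (mat 0))
  isExact : ∀ i, LinearMap.ker (Matrix.mulVecLin (mat i)) =
    LinearMap.range (Matrix.mulVecLin (mat (i + 1)))

/-- The Castelnuovo–Mumford regularity of the quotient `S/I` for a homogeneous ideal `I` of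
the polynomial ring: the least `d` such that some graded free resolution of `S/I` has all its
`i`-th syzygies generated in degrees `≤ d + i` (the minimal free resolution realizes the
infimum).  By convention `reg (S/S) = ⊥ = -∞`. -/

def regQuot {K : Type} [Field K] {σ : Type} (I : Ideal (MvPolynomial σ K)) : WithBot ℤ :=
  if I = ⊤ then ⊥
  else ((sInf { d : ℤ | ∃ F : GradedFreeResolution I,
      ∀ i (k : Fin (F.rank i)), (F.deg i k : ℤ) ≤ d + i } : ℤ) : WithBot ℤ)

/-- A set of edges of `G` that forms a matching: pairwise disjoint edges. -/
def IsMatchingSet {V : Type} (G : SimpleGraph V) (M : Finset (Sym2 V)) : Prop :=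
  (M : Set (Sym2 V)) ⊆ G.edgeSet ∧
    (M : Set (Sym2 V)).Pairwise fun e f => ∀ v, v ∈ e → v ∉ f

/-- An induced matching: a matching such that no two of its edges are joined by an edge
of `G`, i.e. it is the edge set of an induced subgraph. -/
def IsInducedMatchingSet {V : Type} (G : SimpleGraph V) (M : Finset (Sym2 V)) : Prop :=
  IsMatchingSet G M ∧
    (M : Set (Sym2 V)).Pairwise fun e f => ∀ u v, u ∈ e → v ∈ f → ¬G.Adj u v

/-- The matching number `mat(G)`. -/
def matchingNumber {V : Type} (G : SimpleGraph V) : ℕ :=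
  sSup { n | ∃ M, IsMatchingSet G M ∧ M.card = n }

/-- The induced matching number `ν(G)`. -/
def inducedMatchingNumber {V : Type} (G : SimpleGraph V) : ℕ :=
  sSup { n | ∃ M, IsInducedMatchingSet G M ∧ M.card = n }

/-- `G` has an induced cycle of length `n`. -/
def HasInducedCycle {V : Type} (G : SimpleGraph V) (n : ℕ) : Prop :=
  ∃ f : ZMod n → V, Function.Injective f ∧
    ∀ i j : ZMod n, G.Adj (f i) (f j) ↔ (j = i + 1 ∨ i = j + 1)

/-- A graph is chordal if every induced cycle has length `3`. -/
def Chordal {V : Type} (G : SimpleGraph V) : Prop :=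
  ∀ n, 4 ≤ n → ¬HasInducedCycle G n

/-- A graph is weakly chordal if every induced cycle in `G` and in `Gᶜ` has length at most 4. -/
def WeaklyChordal {V : Type} (G : SimpleGraph V) : Prop :=
  (∀ n, 5 ≤ n → ¬HasInducedCycle G n) ∧ ∀ n, 5 ≤ n → ¬HasInducedCycle Gᶜ n

/-- The co-chordal cover number `cochord(G)`: the least `n` such that `n` co-chordal
subgraphs of `G` cover all the edges of `G`. -/
def cochordNumber {V : Type} (G : SimpleGraph V) : ℕ :=
  sInf { n | ∃ H : Fin n → SimpleGraph V,
    (∀ i, H i ≤ G ∧ Chordal (H i)ᶜ) ∧ ∀ e ∈ G.edgeSet, ∃ i, e ∈ (H i).edgeSet }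

/-- A graph is unicyclic if it contains exactly one cycle. -/
def Unicyclic {V : Type} (G : SimpleGraph V) : Prop :=
  ∃ (v : V) (c : G.Walk v v), c.IsCycle ∧
    ∀ (w : V) (c' : G.Walk w w), c'.IsCycle → { e | e ∈ c'.edges } = { e | e ∈ c.edges }

/-- Data exhibiting `G` as the graph `H_T` obtained from the induced subgraph on `Hset`
by attaching, at each vertex of `T ⊆ Hset`, a union of complete graphs having that vertex as
their only common vertex: a family of cliques `C i` of `G`, each meeting `Hset` exactly in
its attachment vertex `a i ∈ T`, two distinct cliques meeting in at most the common
attachment vertex, together covering all vertices outside `Hset`, and all edges of `G`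
lying either inside `Hset` or inside one of the cliques. -/
structure CliqueAttachment {V : Type} (G : SimpleGraph V) (Hset T : Set V) where
  ι : Type
  C : ι → Finset V
  a : ι → V
  a_mem_T : ∀ i, a i ∈ T
  T_sub : T ⊆ Hset
  inter_H : ∀ i, (C i : Set V) ∩ Hset = {a i}
  a_mem_C : ∀ i, a i ∈ C i
  clique : ∀ i, G.IsClique (C i)
  pairwise_inter : ∀ i j, i ≠ j → (C i : Set V) ∩ (C j : Set V) ⊆ ({a i} : Set V)
  cover : Hset ∪ (⋃ i, (C i : Set V)) = Set.univ
  edges_sub : ∀ u v, G.Adj u v → (u ∈ Hset ∧ v ∈ Hset) ∨ ∃ i, u ∈ C i ∧ v ∈ C i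

end EdgeIdealReg

noncomputable section
namespace KZ
open MvPolynomial Finsupp
variable {V : Type*} [LinearOrder V] {K : Type*} [Field K]
variable {M : Type*} [AddCommGroup M] [Module (MvPolynomial V K) M]
variable {N : Type*} [AddCommGroup N] [Module (MvPolynomial V K) N]

/-- The Koszul sign. -/
def sg (τ : Finset V) (v : V) : ℤ := (-1) ^ (τ.filter (· < v)).card

lemma sg_mul_self (τ : Finset V) (v : V) : sg τ v * sg τ v = 1 := by
  unfold sg; rw [← pow_add, ← two_mul, pow_mul]; simp

lemma sg_insert {τ : Finset V} {x : V} (hx : x ∉ τ) (v : V) :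
    sg (insert x τ) v = if x < v then - sg τ v else sg τ v := by
  unfold sg
  rw [Finset.filter_insert]
  split_ifs with h
  · rw [Finset.card_insert_of_notMem (by simp [hx]), pow_succ]; ring
  · rfl

lemma sg_key {σ : Finset V} {x v : V} (hx : x ∉ σ) (hv : v ∉ σ) (hxv : x ≠ v) :
    sg (insert v σ) x * sg (insert x σ) v = - (sg σ x * sg σ v) := by
  rw [sg_insert hx, sg_insert hv]
  rcases lt_or_gt_of_ne hxv with h | h
  · simp [h, h.not_gt]
  · simp [h, h.not_gt]

variable (K) in
/-- Koszul boundary. -/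
def bd : (Finset V →₀ M) →ₗ[MvPolynomial V K] (Finset V →₀ M) :=
  Finsupp.lsum ℕ (fun τ => ∑ v ∈ τ, sg τ v • (X v : MvPolynomial V K) •
    (Finsupp.lsingle (τ.erase v) : M →ₗ[MvPolynomial V K] (Finset V →₀ M)))

variable (K) in
/-- Exterior multiplication. -/
def ex (x : V) : (Finset V →₀ M) →ₗ[MvPolynomial V K] (Finset V →₀ M) :=
  Finsupp.lsum ℕ (fun τ => if x ∈ τ then 0 else sg τ x •
    (Finsupp.lsingle (insert x τ) : M →ₗ[MvPolynomial V K] (Finset V →₀ M)))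

lemma bd_single (τ : Finset V) (f : M) : bd K (single τ f) =
    ∑ v ∈ τ, sg τ v • (X v : MvPolynomial V K) • single (τ.erase v) f := by
  simp [bd, LinearMap.sum_apply]

lemma ex_single_mem {τ : Finset V} {x : V} (h : x ∈ τ) (f : M) :
    ex K x (single τ f) = 0 := by
  simp [ex, h]

lemma ex_single {τ : Finset V} {x : V} (h : x ∉ τ) (f : M) :
    ex K x (single τ f) = sg τ x • single (insert x τ) f := by
  simp [ex, h]

lemma chain_ext {A : Type*} [AddCommGroup A] {φ ψ : (Finset V →₀ M) →+ A}
    (h : ∀ τ f, φ (single τ f) = ψ (single τ f)) (z : Finset V →₀ M) : φ z = ψ z := by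
  rw [Finsupp.addHom_ext h]

lemma chain_zero {A : Type*} [AddCommGroup A] {φ : (Finset V →₀ M) →+ A}
    (h : ∀ τ f, φ (single τ f) = 0) (z : Finset V →₀ M) : φ z = 0 := by
  rw [chain_ext (ψ := 0) (by simpa using h)]; rfl

lemma leibniz (x : V) (z : Finset V →₀ M) :
    bd K (ex K x z) + ex K x (bd K z) = (X x : MvPolynomial V K) • z := by
  have := chain_ext (φ := ((bd K) ∘ₗ (ex K x) + (ex K x) ∘ₗ
    (bd K) : (Finset V →₀ M) →ₗ[MvPolynomial V K] (Finset V →₀ M)).toAddMonoidHom)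
    (ψ := ((X x : MvPolynomial V K) • (LinearMap.id : (Finset V →₀ M) →ₗ[MvPolynomial V K] (Finset V →₀ M))).toAddMonoidHom)
    ?_ z
  · simpa using this
  intro τ f
  simp only [LinearMap.toAddMonoidHom_coe, LinearMap.add_apply, LinearMap.comp_apply,
    LinearMap.smul_apply, LinearMap.id_apply]
  by_cases hx : x ∈ τ
  · rw [ex_single_mem hx, map_zero, zero_add, bd_single, map_sum, Finset.sum_eq_single x]
    · rw [map_zsmul, map_smul, ex_single (by simp), Finset.insert_erase hx, smul_comm (X x : MvPolynomial V K) (sg _ x),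
        smul_smul]
      have : sg τ x = sg (τ.erase x) x := by
        conv_lhs => rw [← Finset.insert_erase hx]
        rw [sg_insert (by simp)]; simp
      rw [this, sg_mul_self, one_smul]
    · intro v hv hvx
      rw [map_zsmul, map_smul, ex_single_mem (by simp [hx, hvx.symm])]; simp
    · intro h; exact absurd hx h
  · rw [ex_single hx, map_zsmul, bd_single, bd_single, Finset.sum_insert hx, map_sum, smul_add,
      Finset.erase_insert hx, sg_insert hx, if_neg (lt_irrefl x), smul_smul, sg_mul_self, one_smul,
      add_assoc, Finset.smul_sum, ← Finset.sum_add_distrib]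
    rw [Finset.sum_eq_zero, add_zero]
    intro v hv
    have hvx : x ≠ v := fun h => hx (h ▸ hv)
    rw [map_zsmul, map_smul, ex_single (by simp [hx]), smul_comm (X v : MvPolynomial V K) (sg _ x),
      smul_smul, smul_smul, Finset.erase_insert_of_ne hvx, ← add_smul]
    obtain ⟨σ, hσ, rfl⟩ : ∃ σ, v ∉ σ ∧ insert v σ = τ := ⟨τ.erase v, by simp, Finset.insert_erase hv⟩
    have hxσ : x ∉ σ := fun h => hx (by simp [h])
    rw [Finset.erase_insert hσ]
    have h1 : sg (insert x (insert v σ)) v = sg (insert x σ) v := by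
      rw [Finset.insert_comm, sg_insert (by simp [hσ, hvx.symm])]; simp
    have h2 : sg (insert v σ) v = sg σ v := by rw [sg_insert hσ]; simp
    rw [h1, sg_key hxσ hσ hvx, h2]
    rw [mul_comm (sg σ v)]; simp

lemma bd_bd (z : Finset V →₀ M) : bd K (bd K z) = 0 := by
  have := chain_zero (φ := ((bd K) ∘ₗ (bd K) : (Finset V →₀ M) →ₗ[MvPolynomial V K] (Finset V →₀ M)).toAddMonoidHom) ?_ z
  · simpa using this
  intro τ
  simp only [LinearMap.toAddMonoidHom_coe, LinearMap.comp_apply]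
  induction τ using Finset.induction_on with
  | empty => intro f; simp [bd_single]
  | insert x τ hx ih =>
    intro f
    have e : single (insert x τ) f = sg τ x • ex K x (single τ f) := by
      rw [ex_single hx, smul_smul, sg_mul_self, one_smul]
    have h1 : bd K (ex K x (single τ f)) = (X x : MvPolynomial V K) • single τ f
       - ex K x (bd K (single τ f)) := by rw [← leibniz]; abel
    have h2 : bd K (ex K x (bd K (single τ f))) =
       (X x : MvPolynomial V K) • (bd K (single τ f)) := by
      rw [← leibniz, ih]; simp
    rw [e, map_zsmul, map_zsmul, h1, map_sub, map_smul, h2]; simp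

/-- Chains with all coefficients in `P`. -/
def chs (P : AddSubgroup M) : AddSubgroup (Finset V →₀ M) where
  carrier := {z | ∀ τ, z τ ∈ P}
  zero_mem' := by intro τ; simp
  add_mem' := by intro a b ha hb τ; exact P.add_mem (ha τ) (hb τ)
  neg_mem' := by intro a ha τ; exact P.neg_mem (ha τ)

lemma mem_chs {P : AddSubgroup M} {z : Finset V →₀ M} : z ∈ chs P ↔ ∀ τ, z τ ∈ P := Iff.rfl

lemma chs_mono {P Q : AddSubgroup M} (h : P ≤ Q) {z : Finset V →₀ M} (hz : z ∈ chs P) : z ∈ chs Q :=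
  fun τ => h (hz τ)

lemma chs_smul {P Q : AddSubgroup M} (g : MvPolynomial V K) (h : ∀ f ∈ P, g • f ∈ Q)
    {z : Finset V →₀ M} (hz : z ∈ chs P) : g • z ∈ chs Q := by
  intro τ; rw [Finsupp.smul_apply]; exact h _ (hz τ)

lemma single_mem_chs {P : AddSubgroup M} {τ : Finset V} {f : M} (hf : f ∈ P) :
    single τ f ∈ chs P := by
  intro σ
  rw [Finsupp.single_apply]
  split_ifs
  · exact hf
  · exact P.zero_mem

lemma map_mem_of_single {A : Type*} [AddCommGroup A] {P : AddSubgroup M} (φ : (Finset V →₀ M) →+ A)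
    (Q : AddSubgroup A) (h : ∀ τ, ∀ f ∈ P, φ (single τ f) ∈ Q) {z : Finset V →₀ M}
    (hz : z ∈ chs P) : φ z ∈ Q := by
  rw [← Finsupp.sum_single z, Finsupp.sum, map_sum]
  exact Q.sum_mem fun τ _ => h τ _ (hz τ)

lemma bd_mem {P Q : AddSubgroup M} (h : ∀ v, ∀ f ∈ P, (X v : MvPolynomial V K) • f ∈ Q)
    {z : Finset V →₀ M} (hz : z ∈ chs P) : bd K z ∈ chs Q := by
  refine map_mem_of_single (bd K : (Finset V →₀ M) →ₗ[MvPolynomial V K] (Finset V →₀ M)).toAddMonoidHom (chs Q) ?_ hz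
  intro τ f hf
  rw [LinearMap.toAddMonoidHom_coe, bd_single]
  refine AddSubgroup.sum_mem _ fun v _ => AddSubgroup.zsmul_mem _ ?_ _
  rw [Finsupp.smul_single]
  exact single_mem_chs (h v f hf)

lemma ex_mem {P : AddSubgroup M} (x : V) {z : Finset V →₀ M} (hz : z ∈ chs P) : ex K x z ∈ chs P := by
  refine map_mem_of_single (ex K x : (Finset V →₀ M) →ₗ[MvPolynomial V K] (Finset V →₀ M)).toAddMonoidHom (chs P) ?_ hz
  intro τ f hf
  rw [LinearMap.toAddMonoidHom_coe]
  by_cases hx : x ∈ τ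
  · rw [ex_single_mem hx]; exact AddSubgroup.zero_mem _
  · rw [ex_single hx]; exact AddSubgroup.zsmul_mem _ (single_mem_chs hf) _

lemma chain_choose {Q : AddSubgroup M} {P : AddSubgroup N} (R : M → N → Prop) (h0 : R 0 0)
    (h : ∀ f ∈ Q, ∃ g ∈ P, R f g) {z : Finset V →₀ M} (hz : z ∈ chs Q) :
    ∃ y ∈ chs (V := V) P, ∀ τ, R (z τ) (y τ) := by
  classical
  have : ∀ f, ∃ g, (f ∈ Q → g ∈ P ∧ R f g) ∧ (f = 0 → g = 0) := by
    intro f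
    by_cases hf : f = 0
    · exact ⟨0, fun _ => ⟨P.zero_mem, hf ▸ h0⟩, fun _ => rfl⟩
    · by_cases hq : f ∈ Q
      · obtain ⟨g, hg, hr⟩ := h f hq
        exact ⟨g, fun _ => ⟨hg, hr⟩, fun e => absurd e hf⟩
      · exact ⟨0, fun e => absurd e hq, fun e => absurd e hf⟩
  choose g hg using this
  refine ⟨Finsupp.mapRange g ((hg 0).2 rfl) z, fun τ => ?_, fun τ => ?_⟩
  · rw [Finsupp.mapRange_apply]; exact ((hg _).1 (hz τ)).1
  · rw [Finsupp.mapRange_apply]; exact ((hg _).1 (hz τ)).2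

lemma bd_map (φ : M →ₗ[MvPolynomial V K] N) (z : Finset V →₀ M) :
    Finsupp.mapRange.linearMap φ (bd K z) = bd K (Finsupp.mapRange.linearMap φ z) := by
  have := chain_ext (φ := ((Finsupp.mapRange.linearMap φ) ∘ₗ (bd K : (Finset V →₀ M) →ₗ[MvPolynomial V K] (Finset V →₀ M))).toAddMonoidHom)
    (ψ := ((bd K : (Finset V →₀ N) →ₗ[MvPolynomial V K] (Finset V →₀ N)) ∘ₗ (Finsupp.mapRange.linearMap φ)).toAddMonoidHom) ?_ z
  · simpa using this
  intro τ f
  simp [bd_single, map_sum, Finsupp.smul_single]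

end KZ
end

noncomputable section
set_option linter.all false
namespace KZ
open MvPolynomial Finsupp
variable {V : Type*} {K : Type*} [Field K]

variable (K) in
/-- Polynomials supported in a set of exponents. -/
def sp (A : Set (V →₀ ℕ)) : AddSubgroup (MvPolynomial V K) where
  carrier := {f | ∀ a, coeff a f ≠ 0 → a ∈ A}
  zero_mem' := by intro a h; simp at h
  add_mem' := by
    intro f g hf hg a h
    by_cases h1 : coeff a f = 0
    · refine hg a ?_
      rw [coeff_add, h1, zero_add] at h; exact h
    · exact hf a h1
  neg_mem' := by
    intro f hf a h
    refine hf a ?_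
    simpa using h

lemma mem_sp {A : Set (V →₀ ℕ)} {f : MvPolynomial V K} :
    f ∈ sp K A ↔ ∀ a, coeff a f ≠ 0 → a ∈ A := Iff.rfl

lemma sp_mono {A B : Set (V →₀ ℕ)} (h : A ⊆ B) : sp K A ≤ sp K B := fun _ hf a ha => h (hf a ha)

lemma sp_inter {A B : Set (V →₀ ℕ)} {f : MvPolynomial V K} (h1 : f ∈ sp K A) (h2 : f ∈ sp K B) :
    f ∈ sp K (A ∩ B) := fun a ha => ⟨h1 a ha, h2 a ha⟩

lemma sp_split {A B D : Set (V →₀ ℕ)} {f : MvPolynomial V K} (h1 : f ∈ sp K D)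
    (h2 : f ∈ sp K (A ∪ B)) : ∃ g ∈ sp K (A ∩ D), f - g ∈ sp K (B ∩ D) := by
  classical
  have hc : ∀ a, coeff a (∑ b ∈ f.support.filter (· ∈ A), monomial b (coeff b f)) =
      if a ∈ A then coeff a f else 0 := by
    intro a
    rw [coeff_sum]
    simp only [coeff_monomial]
    rw [Finset.sum_ite_eq']
    by_cases h : a ∈ A <;> by_cases h' : coeff a f = 0 <;> simp [h, h']
  refine ⟨∑ b ∈ f.support.filter (· ∈ A), monomial b (coeff b f), ?_, ?_⟩
  · intro a ha
    rw [hc] at ha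
    split_ifs at ha with h
    · exact ⟨h, h1 a ha⟩
    · exact absurd rfl ha
  · intro a ha
    rw [coeff_sub, hc] at ha
    split_ifs at ha with h
    · simp at ha
    · rw [sub_zero] at ha
      exact ⟨(h2 a ha).resolve_left h, h1 a ha⟩

lemma monomial_smul_mem {A B : Set (V →₀ ℕ)} {m : V →₀ ℕ} (h : ∀ a ∈ A, a + m ∈ B)
    {f : MvPolynomial V K} (hf : f ∈ sp K A) : monomial m (1 : K) • f ∈ sp K B := by
  classical
  intro a ha
  rw [smul_eq_mul, coeff_monomial_mul'] at ha
  split_ifs at ha with hm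
  · have := h _ (hf (a - m) (by simpa using ha))
    rwa [tsub_add_cancel_of_le hm] at this
  · exact absurd rfl ha

lemma of_monomial_smul_mem {B : Set (V →₀ ℕ)} {m : V →₀ ℕ}
    {f : MvPolynomial V K} (hf : monomial m (1 : K) • f ∈ sp K B) : f ∈ sp K {a | a + m ∈ B} := by
  intro a ha
  refine hf (a + m) ?_
  rw [smul_eq_mul, add_comm, coeff_monomial_mul]; simpa using ha

lemma X_smul_mem {A B : Set (V →₀ ℕ)} {v : V} (h : ∀ a ∈ A, a + single v 1 ∈ B)
    {f : MvPolynomial V K} (hf : f ∈ sp K A) : (X v : MvPolynomial V K) • f ∈ sp K B :=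
  monomial_smul_mem h hf

lemma sp_div {A : Set (V →₀ ℕ)} {m : V →₀ ℕ} {f : MvPolynomial V K} (hf : f ∈ sp K A)
    (hA : A ⊆ Set.Ici m) : ∃ g ∈ sp K {a | a + m ∈ A}, f = monomial m (1 : K) • g := by
  classical
  have : f = monomial m (1 : K) • (f.divMonomial m) := by
    ext a
    rw [smul_eq_mul, coeff_monomial_mul', one_mul, coeff_divMonomial]
    split_ifs with h
    · rw [add_tsub_cancel_of_le h]
    · by_contra h2
      exact h (hA (hf a h2))
  refine ⟨f.divMonomial m, of_monomial_smul_mem (this ▸ hf), this⟩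

/-- Exponents of degree `c`. -/
def Dg (c : ℤ) : Set (V →₀ ℕ) := {a | (a.degree : ℤ) = c}

lemma mem_Dg {c : ℤ} {a : V →₀ ℕ} : a ∈ Dg c ↔ (a.degree : ℤ) = c := Iff.rfl

lemma Dg_add {c : ℤ} {a m : V →₀ ℕ} : a + m ∈ Dg c ↔ a ∈ Dg (c - m.degree) := by
  rw [mem_Dg, mem_Dg, map_add]; push_cast; constructor <;> intro h <;> linarith

lemma Dg_single {x : V} {c : ℤ} {a : V →₀ ℕ} : a + single x 1 ∈ Dg c ↔ a ∈ Dg (c - 1) := by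
  rw [Dg_add]; simp

variable [LinearOrder V]

abbrev Chn (V K : Type*) [Field K] := Finset V →₀ MvPolynomial V K

variable (K) in
/-- chains supported in a set of exponents -/
def cs (A : Set (V →₀ ℕ)) : AddSubgroup (Chn V K) := chs (sp K A)

lemma cs_mono {A B : Set (V →₀ ℕ)} (h : A ⊆ B) {z : Chn V K} (hz : z ∈ cs K A) : z ∈ cs K B :=
  fun τ => sp_mono h (hz τ)

lemma cs_inter {A B : Set (V →₀ ℕ)} {z : Chn V K} (h1 : z ∈ cs K A) (h2 : z ∈ cs K B) :
    z ∈ cs K (A ∩ B) := fun τ => sp_inter (h1 τ) (h2 τ)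

lemma cs_split {A B D : Set (V →₀ ℕ)} {z : Chn V K} (h1 : z ∈ cs K D)
    (h2 : z ∈ cs K (A ∪ B)) : ∃ y u : Chn V K, y ∈ cs K (A ∩ D) ∧ u ∈ cs K (B ∩ D) ∧ z = y + u := by
  obtain ⟨y, hy, hr⟩ := chain_choose (V := V) (Q := sp K (D ∩ (A ∪ B))) (P := sp K (A ∩ D))
    (fun f g => f - g ∈ sp K (B ∩ D)) (by simp)
    (fun f hf => sp_split (sp_mono Set.inter_subset_left hf) (sp_mono Set.inter_subset_right hf))
    (cs_inter h1 h2)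
  exact ⟨y, z - y, hy, fun τ => by simpa using hr τ, by abel⟩

lemma cs_mon {A B : Set (V →₀ ℕ)} {m : V →₀ ℕ} (h : ∀ a ∈ A, a + m ∈ B)
    {z : Chn V K} (hz : z ∈ cs K A) : monomial m (1 : K) • z ∈ cs K B :=
  chs_smul _ (fun _ => monomial_smul_mem h) hz

lemma of_cs_mon {B : Set (V →₀ ℕ)} {m : V →₀ ℕ} {z : Chn V K}
    (hz : monomial m (1 : K) • z ∈ cs K B) : z ∈ cs K {a | a + m ∈ B} :=
  fun τ => of_monomial_smul_mem (hz τ)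

lemma cs_div {A : Set (V →₀ ℕ)} {m : V →₀ ℕ} {z : Chn V K} (hz : z ∈ cs K A)
    (hA : A ⊆ Set.Ici m) : ∃ y ∈ cs K {a | a + m ∈ A}, z = monomial m (1 : K) • y := by
  obtain ⟨y, hy, hr⟩ := chain_choose (V := V) (Q := sp K A) (P := sp K {a | a + m ∈ A})
    (fun f g => f = monomial m (1 : K) • g) (by simp) (fun f hf => sp_div hf hA) hz
  exact ⟨y, hy, by ext1 τ; rw [hr τ]; rfl⟩

lemma cs_bd_upper {U : Set (V →₀ ℕ)} (hU : IsUpperSet U) {z : Chn V K} (hz : z ∈ cs K U) :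
    bd K z ∈ cs K U :=
  bd_mem (fun _ _ => X_smul_mem (fun _ ha => hU le_self_add ha)) hz

lemma cs_bd_Dg {c : ℤ} {z : Chn V K} (hz : z ∈ cs K (Dg c)) : bd K z ∈ cs K (Dg (c + 1)) :=
  bd_mem (fun _ _ => X_smul_mem (fun _ ha => by rw [Dg_single]; simpa using ha)) hz

lemma cs_bd_Dg' {c : ℤ} {z : Chn V K} (hz : z ∈ cs K (Dg (c - 1))) : bd K z ∈ cs K (Dg c) := by
  simpa using cs_bd_Dg hz

lemma cs_ex {A : Set (V →₀ ℕ)} (x : V) {z : Chn V K} (hz : z ∈ cs K A) : ex K x z ∈ cs K A :=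
  ex_mem x hz

variable (K) in
/-- Koszul vanishing above degree `d`. -/
def KV (U : Set (V →₀ ℕ)) (d : ℤ) : Prop :=
  ∀ c : ℤ, d < c → ∀ z : Chn V K, z ∈ cs K (Dg c) → bd K z ∈ cs K U →
    ∃ w : Chn V K, w ∈ cs K (Dg (c - 1)) ∧ z - bd K w ∈ cs K U

lemma KV.mono {U : Set (V →₀ ℕ)} {d d' : ℤ} (h : KV K U d) (hd : d ≤ d') : KV K U d' :=
  fun c hc => h c (lt_of_le_of_lt hd hc)

lemma KV_univ (d : ℤ) : KV K (Set.univ : Set (V →₀ ℕ)) d :=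
  fun c _ z _ _ => ⟨0, AddSubgroup.zero_mem _, fun _ _ _ => trivial⟩

lemma split_mon {U : Set (V →₀ ℕ)} {m : V →₀ ℕ} {c : ℤ} {z : Chn V K} (h1 : z ∈ cs K (Dg c))
    (h2 : z ∈ cs K (U ∪ Set.Ici m)) :
    ∃ u y : Chn V K, u ∈ cs K U ∧ u ∈ cs K (Dg c) ∧ y ∈ cs K (Dg (c - m.degree)) ∧
      z = u + monomial m (1 : K) • y := by
  obtain ⟨u, t, hu, ht, rfl⟩ := cs_split h1 h2
  obtain ⟨y, hy, rfl⟩ := cs_div ht Set.inter_subset_left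
  exact ⟨u, y, cs_mono Set.inter_subset_left hu, cs_mono Set.inter_subset_right hu,
    cs_mono (fun a ha => Dg_add.1 ha.2) hy, rfl⟩

lemma T1 {U : Set (V →₀ ℕ)} (hU : IsUpperSet U) {m : V →₀ ℕ} {d : ℤ}
    (h1 : KV K {a | a + m ∈ U} (d - m.degree)) (h2 : KV K (U ∪ Set.Ici m) d) : KV K U d := by
  intro c hc z hz hbz
  obtain ⟨w1, hw1, hz1⟩ := h2 c hc z hz (cs_mono Set.subset_union_left hbz)
  obtain ⟨u, y, hu, -, hy, he⟩ := split_mon (AddSubgroup.sub_mem _ hz (cs_bd_Dg' hw1)) hz1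
  have hby : bd K y ∈ cs K {a | a + m ∈ U} := by
    apply of_cs_mon
    have : monomial m (1 : K) • bd K y = bd K z - bd K u := by
      have := congrArg (bd K) he
      rw [map_sub, bd_bd, map_add, map_smul] at this
      rw [sub_zero] at this; rw [this]; abel
    rw [this]
    exact AddSubgroup.sub_mem _ hbz (cs_bd_upper hU hu)
  obtain ⟨w2, hw2, hz2⟩ := h1 (c - m.degree) (by linarith) y hy hby
  refine ⟨w1 + monomial m (1 : K) • w2, AddSubgroup.add_mem _ hw1
    (cs_mon (fun a ha => by rw [Dg_add]; convert ha using 2; ring) hw2), ?_⟩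
  have : z - bd K (w1 + monomial m (1 : K) • w2) = u + monomial m (1 : K) • (y - bd K w2) := by
    rw [map_add, map_smul, smul_sub, ← sub_sub, he]; abel
  rw [this]
  exact AddSubgroup.add_mem _ hu (cs_mon (fun a ha => ha) hz2)

lemma T2 {A B : Set (V →₀ ℕ)} (hA : IsUpperSet A) (hB : IsUpperSet B) {d : ℤ}
    (h1 : KV K A d) (h2 : KV K B d) (h3 : KV K (A ∪ B) (d - 1)) : KV K (A ∩ B) d := by
  intro c hc z hz hbz
  obtain ⟨w1, hw1, hz1⟩ := h1 c hc z hz (cs_mono Set.inter_subset_left hbz)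
  obtain ⟨w2, hw2, hz2⟩ := h2 c hc z hz (cs_mono Set.inter_subset_right hbz)
  have hb : bd K (w1 - w2) ∈ cs K (A ∪ B) := by
    have : bd K (w1 - w2) = (z - bd K w2) - (z - bd K w1) := by rw [map_sub]; abel
    rw [this]
    exact AddSubgroup.sub_mem _ (cs_mono Set.subset_union_right hz2) (cs_mono Set.subset_union_left hz1)
  have hw := AddSubgroup.sub_mem _ hw1 hw2
  obtain ⟨v, hv, hz3⟩ := h3 (c - 1) (by linarith) _ hw hb
  obtain ⟨a, b, ha, hb, he⟩ := cs_split (AddSubgroup.sub_mem _ hw (cs_bd_Dg' hv)) hz3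
  refine ⟨w1 - a, AddSubgroup.sub_mem _ hw1 (cs_mono Set.inter_subset_right ha), cs_inter ?_ ?_⟩
  · have : z - bd K (w1 - a) = (z - bd K w1) + bd K a := by rw [map_sub]; abel
    rw [this]
    exact AddSubgroup.add_mem _ hz1 (cs_bd_upper hA (cs_mono Set.inter_subset_left ha))
  · have : z - bd K (w1 - a) = (z - bd K w2) - bd K b := by
      have e : w1 - a = w2 + bd K v + b := by
        have : w1 = (w1 - w2 - bd K v) + w2 + bd K v := by abel
        rw [this, he]; abel
      rw [e, map_add, map_add, bd_bd]; abel
    rw [this]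
    exact AddSubgroup.sub_mem _ hz2 (cs_bd_upper hB (cs_mono Set.inter_subset_left hb))

lemma T4 {U : Set (V →₀ ℕ)} (hU : IsUpperSet U) {m : V →₀ ℕ} {x : V} (hm : single x 1 ≤ m) {d : ℤ}
    (hc : ∀ a, a + m ∈ U → a ∈ U) (h : KV K (U ∪ Set.Ici m) d) : KV K U (d + 1 - m.degree) := by
  intro c hdc z hz hbz
  obtain ⟨m0, rfl⟩ := exists_add_of_le hm
  have hdeg : ((single x 1 + m0).degree : ℤ) = 1 + m0.degree := by rw [map_add]; simp
  have hmm : monomial (single x 1 + m0) (1 : K) = monomial m0 (1 : K) * X x := by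
    rw [X, monomial_mul, add_comm, one_mul]
  have hq : monomial m0 (1 : K) • ex K x z ∈ cs K (Dg (c + m0.degree)) :=
    cs_mon (fun a ha => by rw [Dg_add]; simpa using ha) (cs_ex x hz)
  have hbq : bd K (monomial m0 (1 : K) • ex K x z) =
      monomial (single x 1 + m0) (1 : K) • z - monomial m0 (1 : K) • ex K x (bd K z) := by
    rw [map_smul, hmm, mul_smul, ← leibniz, smul_add]; abel
  have hu1 : monomial m0 (1 : K) • ex K x (bd K z) ∈ cs K U :=
    cs_mon (fun a ha => hU le_self_add ha) (cs_ex x hbz)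
  obtain ⟨w, hw, hz1⟩ := h (c + m0.degree) (by rw [hdeg] at hdc; linarith) _ hq (by
    rw [hbq]
    refine AddSubgroup.sub_mem _ (cs_mon ?_ hz) (cs_mono Set.subset_union_left hu1)
    intro a _; right; simp)
  obtain ⟨u, v, hu, -, hv, he⟩ := split_mon (AddSubgroup.sub_mem _ hq (cs_bd_Dg' hw)) hz1
  refine ⟨v, by convert hv using 3; rw [hdeg]; ring, ?_⟩
  refine cs_mono hc (of_cs_mon ?_)
  have := congrArg (bd K) he
  rw [map_sub, bd_bd, map_add, hbq, map_smul] at this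
  have e : monomial (single x 1 + m0) (1 : K) • (z - bd K v) =
      bd K u + monomial m0 (1 : K) • ex K x (bd K z) := by
    rw [sub_zero, sub_eq_iff_eq_add] at this
    rw [smul_sub, this]; abel
  rw [e]
  exact AddSubgroup.add_mem _ (cs_bd_upper hU hu) hu1

lemma T5 {U : Set (V →₀ ℕ)} (hU : IsUpperSet U) {x : V} {d : ℤ}
    (hc : ∀ a, a + single x 1 ∈ U → a ∈ U) (h : KV K (U ∪ Set.Ici (single x 1)) d) : KV K U d := by
  have := T4 hU (le_refl (single x 1)) hc h
  simpa using this

lemma T6 {U : Set (V →₀ ℕ)} (hU : IsUpperSet U) {m : V →₀ ℕ} {d d' D : ℤ}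
    (h1 : KV K U d) (h2 : KV K {a | a + m ∈ U} d') (hD1 : d ≤ D) (hD2 : d' + m.degree - 1 ≤ D) :
    KV K (U ∪ Set.Ici m) D := by
  intro c hc z hz hbz
  obtain ⟨u, y, hu, hu', hy, he⟩ := split_mon (cs_bd_Dg hz) hbz
  have hby : bd K y ∈ cs K {a | a + m ∈ U} := by
    apply of_cs_mon
    have := congrArg (bd K) he
    rw [bd_bd, map_add, map_smul] at this
    rw [← neg_eq_of_add_eq_zero_right this.symm]
    exact AddSubgroup.neg_mem _ (cs_bd_upper hU hu)
  obtain ⟨w, hw, hz2⟩ := h2 _ (by linarith) y hy hby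
  have hmw : monomial m (1 : K) • w ∈ cs K (Dg c) :=
    cs_mon (fun a ha => by rw [Dg_add]; convert ha using 2; ring) hw
  obtain ⟨v, hv, hz3⟩ := h1 c (by linarith) _ (AddSubgroup.sub_mem _ hz hmw) (by
    have : bd K (z - monomial m (1 : K) • w) = u + monomial m (1 : K) • (y - bd K w) := by
      rw [map_sub, map_smul, he, smul_sub]; abel
    rw [this]
    exact AddSubgroup.add_mem _ hu (cs_mon (fun a ha => ha) hz2))
  refine ⟨v, hv, ?_⟩
  have : z - bd K v = (z - monomial m (1 : K) • w - bd K v) + monomial m (1 : K) • w := by abel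
  rw [this]
  refine AddSubgroup.add_mem _ (cs_mono Set.subset_union_left hz3) (cs_mon (A := Set.univ) ?_ (fun _ _ _ => trivial))
  intro a _; right; simp
end KZ
end

noncomputable section
set_option linter.all false
namespace KZ
open MvPolynomial Finsupp
variable {V : Type*} {K : Type*} [Field K] [LinearOrder V]

variable (K) in
/-- kill monomials divisible by `x` -/
def pi0 (x : V) : MvPolynomial V K →+ MvPolynomial V K where
  toFun f := f.modMonomial (single x 1)
  map_zero' := by
    ext a
    by_cases h : single x 1 ≤ a
    · rw [coeff_modMonomial_of_le _ h]; simp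
    · rw [coeff_modMonomial_of_not_le _ h]
  map_add' f g := by
    ext a
    by_cases h : single x 1 ≤ a
    · simp [coeff_modMonomial_of_le _ h]
    · simp [coeff_modMonomial_of_not_le _ h]

lemma coeff_pi0 (x : V) (f : MvPolynomial V K) (a : V →₀ ℕ) :
    coeff a (pi0 K x f) = if a x = 0 then coeff a f else 0 := by
  change coeff a (f.modMonomial (single x 1)) = _
  by_cases h : single x 1 ≤ a
  · rw [coeff_modMonomial_of_le _ h, if_neg]
    rw [Finsupp.single_le_iff] at h; omega
  · rw [coeff_modMonomial_of_not_le _ h, if_pos]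
    rw [Finsupp.single_le_iff] at h; omega

lemma pi0_X_ne {x v : V} (h : v ≠ x) (f : MvPolynomial V K) :
    pi0 K x ((X v : MvPolynomial V K) • f) = (X v : MvPolynomial V K) • pi0 K x f := by
  ext a
  rw [coeff_pi0, smul_eq_mul, smul_eq_mul, coeff_X_mul', coeff_X_mul', coeff_pi0]
  have : (a - (single v 1 : V →₀ ℕ)) x = a x := by simp [h]
  rw [this]
  split_ifs <;> rfl

lemma pi0_X_self (x : V) (f : MvPolynomial V K) :
    pi0 K x ((X x : MvPolynomial V K) • f) = 0 := by
  ext a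
  rw [coeff_pi0, smul_eq_mul, coeff_X_mul', coeff_zero]
  split_ifs with h1 h2
  · simp [h1] at h2
  · rfl
  · rfl

lemma pi0_mem {x : V} {A B : Set (V →₀ ℕ)} (h : ∀ a ∈ A, a x = 0 → a ∈ B) {f : MvPolynomial V K}
    (hf : f ∈ sp K A) : pi0 K x f ∈ sp K B := by
  intro a ha
  rw [coeff_pi0] at ha
  split_ifs at ha with h1
  · exact h a (hf a ha) h1
  · exact absurd rfl ha

lemma sub_pi0_mem (x : V) (f : MvPolynomial V K) : f - pi0 K x f ∈ sp K (Set.Ici (single x 1)) := by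
  intro a ha
  rw [coeff_sub, coeff_pi0] at ha
  split_ifs at ha with h1
  · simp at ha
  · rw [Set.mem_Ici, Finsupp.single_le_iff]; omega

variable (K) in
def rho (x : V) : Chn V K →+ Chn V K :=
  Finsupp.liftAddHom (fun τ => if x ∈ τ then 0 else (Finsupp.singleAddHom τ).comp (pi0 K x))

variable (K) in
def kap (x : V) : Chn V K →+ Chn V K :=
  Finsupp.liftAddHom (fun τ => if x ∈ τ then
    sg (τ.erase x) x • (Finsupp.singleAddHom (τ.erase x)).comp (pi0 K x) else 0)

lemma rho_single (x : V) (τ : Finset V) (f : MvPolynomial V K) :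
    rho K x (single τ f) = if x ∈ τ then 0 else single τ (pi0 K x f) := by
  unfold rho
  rw [Finsupp.liftAddHom_apply_single]
  split_ifs <;> simp

lemma kap_single (x : V) (τ : Finset V) (f : MvPolynomial V K) :
    kap K x (single τ f) = if x ∈ τ then sg (τ.erase x) x • single (τ.erase x) (pi0 K x f) else 0 := by
  unfold kap
  rw [Finsupp.liftAddHom_apply_single]
  split_ifs <;> simp

lemma X_single (v : V) (τ : Finset V) (f : MvPolynomial V K) :
    (X v : MvPolynomial V K) • (single τ f : Chn V K) = single τ ((X v : MvPolynomial V K) • f) :=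
  Finsupp.smul_single _ _ _

abbrev bdA : Chn V K →+ Chn V K := (bd K : Chn V K →ₗ[MvPolynomial V K] Chn V K).toAddMonoidHom
abbrev exA (x : V) : Chn V K →+ Chn V K := (ex K x : Chn V K →ₗ[MvPolynomial V K] Chn V K).toAddMonoidHom

lemma rho_bd (x : V) (z : Chn V K) : rho K x (bd K z) = bd K (rho K x z) := by
  refine chain_ext (φ := (rho K x).comp bdA) (ψ := bdA.comp (rho K x)) ?_ z
  intro τ f
  simp only [AddMonoidHom.comp_apply, LinearMap.toAddMonoidHom_coe, bd_single, rho_single, map_sum,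
    map_zsmul, X_single]
  by_cases hx : x ∈ τ
  · rw [if_pos hx, map_zero]
    apply Finset.sum_eq_zero
    intro v hv
    by_cases hvx : v = x
    · subst hvx; rw [pi0_X_self]; simp
    · rw [if_pos (by simp [hx, Ne.symm hvx])]; simp
  · rw [if_neg hx, bd_single]
    apply Finset.sum_congr rfl
    intro v hv
    have hvx : v ≠ x := fun h => hx (h ▸ hv)
    rw [if_neg (by simp [hx]), pi0_X_ne hvx, X_single]

lemma kap_bd (x : V) (z : Chn V K) : kap K x (bd K z) = - bd K (kap K x z) := by
  refine chain_ext (φ := (kap K x).comp bdA) (ψ := - (bdA.comp (kap K x))) ?_ z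
  intro τ f
  simp only [AddMonoidHom.comp_apply, AddMonoidHom.neg_apply, LinearMap.toAddMonoidHom_coe, bd_single, kap_single, map_sum,
    map_zsmul, X_single]
  by_cases hx : x ∈ τ
  · rw [if_pos hx, map_zsmul, bd_single]
    rw [← Finset.add_sum_erase _ _ hx, pi0_X_self, if_neg (by simp), smul_zero, zero_add, Finset.smul_sum,
      ← Finset.sum_neg_distrib]
    apply Finset.sum_congr rfl
    intro v hv
    rw [Finset.mem_erase] at hv
    have hvx := hv.1
    rw [if_pos (by simp [hx, hvx.symm]), pi0_X_ne hvx, X_single, Finset.erase_right_comm, smul_smul,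
      smul_smul, ← neg_smul]
    congr 1
    obtain ⟨σ, hxσ, hvσ, rfl⟩ : ∃ σ, x ∉ σ ∧ v ∉ σ ∧ insert x (insert v σ) = τ :=
      ⟨(τ.erase x).erase v, by simp, by simp, by
        rw [Finset.insert_erase (by simp [hv]), Finset.insert_erase hx]⟩
    have hxv' : x ∉ insert v σ := by simp [hxσ, hvx.symm]
    rw [Finset.erase_insert hxv', Finset.erase_insert hvσ, sg_insert hxv' v, sg_insert hvσ v, sg_insert hvσ x]
    rcases lt_or_gt_of_ne hvx with h | h
    · simp [h, h.not_gt]; ring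
    · simp [h, h.not_gt]; ring
  · rw [if_neg hx, map_zero, neg_zero]
    apply Finset.sum_eq_zero
    intro v hv
    rw [if_neg (by simp [hx])]; simp

lemma rho_mem {x : V} {A B : Set (V →₀ ℕ)} (h : ∀ a ∈ A, a x = 0 → a ∈ B) {z : Chn V K}
    (hz : z ∈ cs K A) : rho K x z ∈ cs K B := by
  refine map_mem_of_single (rho K x) (cs K B) ?_ hz
  intro τ f hf
  rw [rho_single]
  split_ifs
  · exact AddSubgroup.zero_mem _
  · exact single_mem_chs (pi0_mem h hf)

lemma kap_mem {x : V} {A B : Set (V →₀ ℕ)} (h : ∀ a ∈ A, a x = 0 → a ∈ B) {z : Chn V K}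
    (hz : z ∈ cs K A) : kap K x z ∈ cs K B := by
  refine map_mem_of_single (kap K x) (cs K B) ?_ hz
  intro τ f hf
  rw [kap_single]
  split_ifs
  · exact AddSubgroup.zsmul_mem _ (single_mem_chs (pi0_mem h hf)) _
  · exact AddSubgroup.zero_mem _

lemma decomp_mem (x : V) (z : Chn V K) : z - rho K x z - ex K x (kap K x z) ∈ cs K (Set.Ici (single x 1)) := by
  refine map_mem_of_single (P := ⊤) (AddMonoidHom.id _ - rho K x - (exA x).comp (kap K x)) (cs K (Set.Ici (single x 1))) ?_ (fun _ => trivial)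
  intro τ f _
  simp only [AddMonoidHom.sub_apply, AddMonoidHom.comp_apply, AddMonoidHom.id_apply, LinearMap.toAddMonoidHom_coe,
    rho_single, kap_single]
  by_cases hx : x ∈ τ
  · rw [if_pos hx, if_pos hx, map_zsmul, ex_single (by simp), Finset.insert_erase hx, smul_smul, sg_mul_self,
      one_smul, sub_zero, ← Finsupp.single_sub]
    exact single_mem_chs (sub_pi0_mem x f)
  · rw [if_neg hx, if_neg hx, map_zero, sub_zero, ← Finsupp.single_sub]
    exact single_mem_chs (sub_pi0_mem x f)

lemma T3 {U : Set (V →₀ ℕ)} {x : V} {d : ℤ}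
    (h : KV K U d) : KV K (U ∪ Set.Ici (single x 1)) d := by
  have key : ∀ a ∈ U ∪ Set.Ici (single x 1), a x = 0 → a ∈ U := by
    rintro a (ha | ha) h0
    · exact ha
    · rw [Set.mem_Ici, Finsupp.single_le_iff] at ha; omega
  intro c hc z hz hbz
  obtain ⟨w0, hw0, h0⟩ := h c hc (rho K x z) (rho_mem (fun a ha _ => ha) hz) (by
    rw [← rho_bd]; exact rho_mem key hbz)
  obtain ⟨w1, hw1, h1⟩ := h c hc (kap K x z) (kap_mem (fun a ha _ => ha) hz) (by
    rw [← neg_neg (bd K _), ← kap_bd]; exact AddSubgroup.neg_mem _ (kap_mem key hbz))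
  refine ⟨w0 - ex K x w1, AddSubgroup.sub_mem _ hw0 (cs_ex x hw1), ?_⟩
  have e : z - bd K (w0 - ex K x w1) = (z - rho K x z - ex K x (kap K x z)) + (rho K x z - bd K w0)
      + ex K x (kap K x z - bd K w1) + (X x : MvPolynomial V K) • w1 := by
    rw [← leibniz, map_sub, map_sub]; abel
  rw [e]
  refine AddSubgroup.add_mem _ (AddSubgroup.add_mem _ (AddSubgroup.add_mem _
    (cs_mono Set.subset_union_right (decomp_mem x z)) (cs_mono Set.subset_union_left h0))
    (cs_mono Set.subset_union_left (cs_ex x h1))) ?_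
  refine cs_mon (A := Set.univ) ?_ (fun _ _ _ => trivial)
  intro a _; right; simp

/-- exponents involving a variable in `Z` -/
def vs (Z : Finset V) : Set (V →₀ ℕ) := {a | ∃ v ∈ Z, 0 < a v}

lemma vs_upper (Z : Finset V) : IsUpperSet (vs Z) := by
  rintro a b hab ⟨v, hv, h⟩
  exact ⟨v, hv, lt_of_lt_of_le h (hab v)⟩

lemma vs_insert (x : V) (Z : Finset V) : vs (insert x Z) = vs Z ∪ Set.Ici (single x 1) := by
  ext a
  simp only [vs, Set.mem_setOf_eq, Finset.mem_insert, Set.mem_union, Set.mem_Ici, Finsupp.single_le_iff]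
  constructor
  · rintro ⟨v, rfl | hv, h⟩
    · right; exact h
    · left; exact ⟨v, hv, h⟩
  · rintro (⟨v, hv, h⟩ | h)
    · exact ⟨v, Or.inr hv, h⟩
    · exact ⟨x, Or.inl rfl, h⟩

lemma T3s {U : Set (V →₀ ℕ)} {d : ℤ} (Z : Finset V) (h : KV K U d) : KV K (U ∪ vs Z) d := by
  induction Z using Finset.induction_on with
  | empty => simpa [vs] using h
  | insert x Z _ ih => rw [vs_insert, ← Set.union_assoc]; exact T3 ih

lemma T5s {U : Set (V →₀ ℕ)} (hU : IsUpperSet U) {d : ℤ} (Z : Finset V)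
    (hc : ∀ x ∈ Z, ∀ a, a + single x 1 ∈ U → a ∈ U) (h : KV K (U ∪ vs Z) d) : KV K U d := by
  induction Z using Finset.induction_on with
  | empty => simpa [vs] using h
  | insert x Z hx ih =>
    rw [vs_insert, ← Set.union_assoc] at h
    refine ih (fun y hy => hc y (Finset.mem_insert_of_mem hy)) (T5 (hU.union (vs_upper Z)) ?_ h)
    rintro a (ha | ⟨v, hv, ha⟩)
    · exact Or.inl (hc x (Finset.mem_insert_self _ _) a ha)
    · refine Or.inr ⟨v, hv, ?_⟩
      have : x ≠ v := fun h => hx (h ▸ hv)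
      simpa [Finsupp.single_apply, this] using ha

/-- up-set generated by a list -/
def gl : List (V →₀ ℕ) → Set (V →₀ ℕ)
  | [] => ∅
  | m :: L => gl L ∪ Set.Ici m

lemma gl_upper (L : List (V →₀ ℕ)) : IsUpperSet (gl L) := by
  induction L with
  | nil => exact isUpperSet_empty
  | cons m L ih => exact ih.union (isUpperSet_Ici m)

lemma mem_gl (L : List (V →₀ ℕ)) (a : V →₀ ℕ) : a ∈ gl L ↔ ∃ m ∈ L, m ≤ a := by
  induction L with
  | nil => simp [gl]
  | cons m L ih => simp [gl, ih, or_comm]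

lemma gl_colon (L : List (V →₀ ℕ)) (m : V →₀ ℕ) : {a | a + m ∈ gl L} = gl (L.map (· - m)) := by
  ext a
  simp [mem_gl, tsub_le_iff_right]

lemma KV_bound {U : Set (V →₀ ℕ)} (hU : IsUpperSet U) (h0 : KV K (∅ : Set (V →₀ ℕ)) 0) (n : ℕ) :
    ∀ L : List (V →₀ ℕ), L.length = n → ∃ d, KV K (gl L) d := by
  induction n with
  | zero => intro L hL; rw [List.length_eq_zero_iff] at hL; subst hL; exact ⟨0, h0⟩
  | succ n ih =>
    intro L hL
    match L, hL with
    | m :: L, hL =>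
      obtain ⟨d, hd⟩ := ih L (by simpa using hL)
      obtain ⟨d', hd'⟩ := ih (L.map (· - m)) (by simpa using hL)
      rw [← gl_colon] at hd'
      exact ⟨_, T6 (gl_upper L) hd hd' (le_max_left _ _) (le_max_right _ _)⟩

lemma cs_empty {z : Chn V K} (hz : z ∈ cs K (∅ : Set (V →₀ ℕ))) : z = 0 := by
  ext τ a
  by_contra h
  exact hz τ a h

lemma exact_aux (c : ℤ) (Z : Finset V) : ∀ z : Chn V K, z ∈ cs K (Dg c) → z ∈ cs K (vs Z) → bd K z = 0 →
    ∃ w : Chn V K, w ∈ cs K (Dg (c - 1)) ∧ z = bd K w := by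
  induction Z using Finset.induction_on with
  | empty =>
    intro z _ hz _
    refine ⟨0, AddSubgroup.zero_mem _, ?_⟩
    rw [map_zero]
    exact cs_empty (cs_mono (by simp [vs]) hz)
  | insert x Z hx ih =>
    intro z hz hz2 hb
    rw [vs_insert] at hz2
    obtain ⟨u, v, hu, hu', hv, rfl⟩ := split_mon hz hz2
    have hv' : v ∈ cs K (Dg (c - 1)) := by simpa using hv
    have hbv : bd K v ∈ cs K (vs Z) := by
      have h1 : monomial (single x 1) (1 : K) • bd K v ∈ cs K (vs Z) := by
        rw [map_add, map_smul] at hb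
        rw [← neg_eq_of_add_eq_zero_right hb]
        exact AddSubgroup.neg_mem _ (cs_bd_upper (vs_upper Z) hu)
      refine cs_mono ?_ (of_cs_mon h1)
      rintro a ⟨y, hy, h⟩
      refine ⟨y, hy, ?_⟩
      have : x ≠ y := fun h => hx (h ▸ hy)
      simpa [Finsupp.single_apply, this] using h
    have e : u + monomial (single x 1) (1 : K) • v - bd K (ex K x v) = u + ex K x (bd K v) := by
      have := leibniz (K := K) x v
      change _ = monomial (single x 1) (1 : K) • v at this
      rw [← this]; abel
    obtain ⟨w, hw, hw2⟩ := ih (u + monomial (single x 1) (1 : K) • v - bd K (ex K x v))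
      (AddSubgroup.sub_mem _ hz (cs_bd_Dg' (cs_ex x hv')))
      (by rw [e]; exact AddSubgroup.add_mem _ hu (cs_ex x hbv))
      (by rw [map_sub, hb, bd_bd, sub_zero])
    refine ⟨w + ex K x v, AddSubgroup.add_mem _ hw (cs_ex x hv'), ?_⟩
    rw [map_add, ← hw2]; abel

lemma exact_pos {c : ℤ} (hc : 0 < c) {z : Chn V K} (hz : z ∈ cs K (Dg c)) (hb : bd K z = 0) :
    ∃ w : Chn V K, w ∈ cs K (Dg (c - 1)) ∧ z = bd K w := by
  refine exact_aux c (z.support.biUnion fun τ => (z τ).vars) z hz ?_ hb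
  intro τ a ha
  have h1 := hz τ a ha
  have : a ≠ 0 := by rintro rfl; rw [mem_Dg] at h1; simp at h1; omega
  obtain ⟨v, hv⟩ := Finsupp.ne_iff.1 this
  refine ⟨v, ?_, Nat.pos_of_ne_zero hv⟩
  rw [Finset.mem_biUnion]
  refine ⟨τ, ?_, ?_⟩
  · rw [Finsupp.mem_support_iff]; rintro h; simp [h] at ha
  · rw [mem_vars]; exact ⟨a, by simpa [MvPolynomial.mem_support_iff] using ha, by simpa using hv⟩

lemma KV_empty : KV K (∅ : Set (V →₀ ℕ)) 0 := by
  intro c hc z hz hb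
  obtain ⟨w, hw, rfl⟩ := exact_pos hc hz (cs_empty hb)
  exact ⟨w, hw, by rw [sub_self]; exact AddSubgroup.zero_mem _⟩

lemma KV_gl (L : List (V →₀ ℕ)) : ∃ d, KV K (gl L) d := KV_bound isUpperSet_empty KV_empty _ L rfl
end KZ
end

noncomputable section
set_option linter.all false
namespace KZ
open MvPolynomial Finsupp
variable {V : Type*} {K : Type*} [Field K]

open Classical in
variable (K) in
/-- projection to monomials in `A` -/
def pr (A : Set (V →₀ ℕ)) (f : MvPolynomial V K) : MvPolynomial V K :=
  ∑ b ∈ f.support.filter (· ∈ A), monomial b (coeff b f)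

open Classical in
lemma coeff_pr (A : Set (V →₀ ℕ)) (f : MvPolynomial V K) (a : V →₀ ℕ) :
    coeff a (pr K A f) = if a ∈ A then coeff a f else 0 := by
  unfold pr
  rw [coeff_sum]
  simp only [coeff_monomial]
  rw [Finset.sum_ite_eq']
  by_cases h : a ∈ A <;> by_cases h' : coeff a f = 0 <;> simp [h, h']

lemma pr_sum {ι : Type*} (A : Set (V →₀ ℕ)) (s : Finset ι) (f : ι → MvPolynomial V K) :
    pr K A (∑ i ∈ s, f i) = ∑ i ∈ s, pr K A (f i) := by
  classical
  ext a
  rw [coeff_pr, coeff_sum, coeff_sum]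
  simp only [coeff_pr]
  split_ifs <;> simp

lemma pr_mem (A : Set (V →₀ ℕ)) (f : MvPolynomial V K) : pr K A f ∈ sp K A := by
  classical
  intro a ha
  rw [coeff_pr] at ha
  by_contra h
  simp [h] at ha

lemma pr_eq {A : Set (V →₀ ℕ)} {f : MvPolynomial V K} (hf : f ∈ sp K A) : pr K A f = f := by
  classical
  ext a
  rw [coeff_pr]
  split_ifs with h
  · rfl
  · by_contra h2; exact h (hf a (Ne.symm h2))

lemma hom_deg {g : MvPolynomial V K} {e : ℕ} (hg : g.IsHomogeneous e) {a : V →₀ ℕ} (h : coeff a g ≠ 0) :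
    a.degree = e := by
  rw [Finsupp.degree_eq_weight_one]; exact hg h

lemma pr_mul {g : MvPolynomial V K} {e : ℕ} (hg : g.IsHomogeneous e) (c : ℤ) (f : MvPolynomial V K) :
    pr K (Dg (c + e)) (g * f) = g * pr K (Dg c) f := by
  classical
  ext a
  rw [coeff_pr, coeff_mul, coeff_mul]
  have key : ∀ x ∈ Finset.HasAntidiagonal.antidiagonal a, coeff x.1 g * coeff x.2 (pr K (Dg c) f) =
      if a ∈ Dg (c + e) then coeff x.1 g * coeff x.2 f else 0 := by
    intro x hx
    rw [Finset.HasAntidiagonal.mem_antidiagonal] at hx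
    by_cases h0 : coeff x.1 g = 0
    · simp [h0]
    · have h1 : x.1.degree = e := hom_deg hg h0
      have : x.2 ∈ Dg c ↔ a ∈ Dg (c + e) := by
        rw [← hx, add_comm x.1 x.2, Dg_add, h1]; simp
      rw [coeff_pr]
      simp only [this]
      split_ifs <;> simp
  rw [Finset.sum_congr rfl key]
  split_ifs <;> simp

lemma pr_zero (A : Set (V →₀ ℕ)) : pr K A 0 = 0 := pr_eq (AddSubgroup.zero_mem _)

/-- graded pieces of a graded free module -/
def gr {n : ℕ} (deg : Fin n → ℕ) (c : ℤ) : AddSubgroup (Fin n → MvPolynomial V K) where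
  carrier := {v | ∀ k, v k ∈ sp K (Dg (c - deg k))}
  zero_mem' := fun k => AddSubgroup.zero_mem _
  add_mem' := fun ha hb k => AddSubgroup.add_mem _ (ha k) (hb k)
  neg_mem' := fun ha k => AddSubgroup.neg_mem _ (ha k)

/-- homogeneous component of a vector -/
def hcp {n : ℕ} (deg : Fin n → ℕ) (c : ℤ) (v : Fin n → MvPolynomial V K) : Fin n → MvPolynomial V K :=
  fun k => pr K (Dg (c - deg k)) (v k)

lemma hcp_mem {n : ℕ} (deg : Fin n → ℕ) (c : ℤ) (v : Fin n → MvPolynomial V K) : hcp deg c v ∈ gr deg c :=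
  fun k => pr_mem _ _

lemma hcp_eq {n : ℕ} {deg : Fin n → ℕ} {c : ℤ} {v : Fin n → MvPolynomial V K} (hv : v ∈ gr deg c) :
   hcp deg c v = v := funext fun k => pr_eq (hv k)

/-- homogeneous matrices -/
def HM {m n : ℕ} (dm : Fin m → ℕ) (dn : Fin n → ℕ) (A : Matrix (Fin m) (Fin n) (MvPolynomial V K)) : Prop :=
  ∀ k j, A k j = 0 ∨ ∃ e, dn j = dm k + e ∧ (A k j).IsHomogeneous e

lemma hcp_mulVec {m n : ℕ} {dm : Fin m → ℕ} {dn : Fin n → ℕ} {A : Matrix (Fin m) (Fin n) (MvPolynomial V K)}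
    (hA : HM dm dn A) (c : ℤ) (v : Fin n → MvPolynomial V K) :
    hcp dm c (A.mulVec v) = A.mulVec (hcp dn c v) := by
  funext k
  simp only [hcp, Matrix.mulVec, dotProduct]
  rw [pr_sum]
  refine Finset.sum_congr rfl fun j _ => ?_
  rcases hA k j with h | ⟨e, h1, h2⟩
  · simp [h, pr_zero]
  · rw [← pr_mul h2, h1]
    congr 2; push_cast; ring

lemma gr_mulVec {m n : ℕ} {dm : Fin m → ℕ} {dn : Fin n → ℕ} {A : Matrix (Fin m) (Fin n) (MvPolynomial V K)}
    (hA : HM dm dn A) {c : ℤ} {v : Fin n → MvPolynomial V K} (hv : v ∈ gr dn c) :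
    A.mulVecLin v ∈ gr dm c := by
  rw [← hcp_eq hv, Matrix.mulVecLin_apply, ← hcp_mulVec hA]; exact hcp_mem _ _ _

lemma gr_lift {m n : ℕ} {dm : Fin m → ℕ} {dn : Fin n → ℕ} {A : Matrix (Fin m) (Fin n) (MvPolynomial V K)}
    (hA : HM dm dn A) {c : ℤ} {v : Fin m → MvPolynomial V K} (hv : v ∈ gr dm c)
    (hr : v ∈ LinearMap.range A.mulVecLin) : ∃ y ∈ gr dn c, A.mulVecLin y = v := by
  obtain ⟨y, rfl⟩ := hr
  refine ⟨hcp dn c y, hcp_mem _ _ _, ?_⟩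
  rw [Matrix.mulVecLin_apply, ← hcp_mulVec hA]
  exact hcp_eq hv

variable [LinearOrder V]

lemma gr_bd {n : ℕ} {dn : Fin n → ℕ} {c : ℤ} {z : Finset V →₀ (Fin n → MvPolynomial V K)}
    (hz : z ∈ chs (gr dn c)) : bd K z ∈ chs (gr dn (c + 1)) := by
  refine bd_mem (fun v f hf k => ?_) hz
  exact X_smul_mem (fun a ha => by rw [Dg_single]; convert ha using 2; ring) (hf k)

lemma gr_exact {n : ℕ} {dn : Fin n → ℕ} {c : ℤ} (hc : ∀ k, (dn k : ℤ) < c)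
    {z : Finset V →₀ (Fin n → MvPolynomial V K)} (hz : z ∈ chs (gr dn c)) (hb : bd K z = 0) :
    ∃ w ∈ chs (V := V) (gr dn (c - 1)), z = bd K w := by
  have h : ∀ k, ∃ w : Chn V K, w ∈ cs K (Dg (c - dn k - 1)) ∧
      Finsupp.mapRange.linearMap (LinearMap.proj (R := MvPolynomial V K) (φ := fun _ : Fin n => MvPolynomial V K) k) z = bd K w := by
    intro k
    refine exact_pos (by have := hc k; linarith) (fun τ => ?_) ?_
    · exact hz τ k
    · rw [← bd_map, hb, map_zero]
  choose w hw he using h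
  refine ⟨∑ k, Finsupp.mapRange.linearMap (LinearMap.single (MvPolynomial V K) (fun _ : Fin n => MvPolynomial V K) k) (w k), ?_, ?_⟩
  · intro τ j
    have : (∑ k, Finsupp.mapRange.linearMap (LinearMap.single (MvPolynomial V K) (fun _ : Fin n => MvPolynomial V K) k) (w k)) τ j = w j τ := by
      rw [Finsupp.finset_sum_apply, Finset.sum_apply]
      simp only [Finsupp.mapRange.linearMap_apply, Finsupp.mapRange_apply, LinearMap.single_apply]
      rw [Finset.sum_eq_single j]
      · simp
      · intro b _ hb; simp [Pi.single_apply, hb.symm]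
      · simp
    rw [this]
    have := hw j τ
    convert this using 3; ring
  · rw [map_sum]
    simp only [← bd_map, ← he]
    ext1 τ
    funext j
    rw [Finsupp.finset_sum_apply, Finset.sum_apply]
    simp only [Finsupp.mapRange.linearMap_apply, Finsupp.mapRange_apply, LinearMap.single_apply, LinearMap.proj_apply]
    rw [Finset.sum_eq_single j]
    · simp
    · intro b _ hb; simp [Pi.single_apply, hb.symm]
    · simp

/-- chains supported on small sets -/
def sml (M : Type*) [AddCommGroup M] (q : ℕ) : AddSubgroup (Finset V →₀ M) where
  carrier := {z | ∀ τ, z τ ≠ 0 → τ.card < q}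
  zero_mem' := by intro τ h; simp at h
  add_mem' := by
    intro f g hf hg τ h
    by_cases h1 : f τ = 0
    · refine hg τ ?_
      rw [Finsupp.add_apply, h1, zero_add] at h; exact h
    · exact hf τ h1
  neg_mem' := by
    intro f hf τ h
    refine hf τ ?_
    simpa using h

lemma sml_bd {M : Type*} [AddCommGroup M] [Module (MvPolynomial V K) M] {q : ℕ} {z : Finset V →₀ M}
    (hz : z ∈ sml M (q + 1)) : bd K z ∈ sml M q := by
  rw [← Finsupp.sum_single z, Finsupp.sum, map_sum]
  refine AddSubgroup.sum_mem _ fun τ hτ => ?_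
  have h1 := hz τ (by simpa using hτ)
  rw [bd_single]
  refine AddSubgroup.sum_mem _ fun v hv => AddSubgroup.zsmul_mem _ ?_ _
  rw [Finsupp.smul_single]
  intro σ hσ
  have : σ = τ.erase v := by
    by_contra h
    exact hσ (Finsupp.single_eq_of_ne h)
  rw [this, Finset.card_erase_of_mem hv]
  have := Finset.card_pos.2 ⟨v, hv⟩
  omega

end KZ
namespace KZ
open MvPolynomial Finsupp EdgeIdealReg
variable {V : Type} {K : Type} [Field K] [LinearOrder V]

lemma P1_aux {I : Ideal (MvPolynomial V K)} (F : GradedFreeResolution I) {d : ℤ}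
    (hd : ∀ i (k : Fin (F.rank i)), (F.deg i k : ℤ) ≤ d + i) (q : ℕ) : ∀ (p : ℕ) (c : ℤ), d + p + 1 < c →
    ∀ z : Finset V →₀ (Fin (F.rank p) → MvPolynomial V K),
    z ∈ chs (LinearMap.range (F.mat p).mulVecLin).toAddSubgroup → z ∈ chs (gr (F.deg p) c) →
    z ∈ sml _ q → bd K z = 0 →
    ∃ w : Finset V →₀ (Fin (F.rank p) → MvPolynomial V K),
    w ∈ chs (LinearMap.range (F.mat p).mulVecLin).toAddSubgroup ∧ w ∈ chs (gr (F.deg p) (c - 1)) ∧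
    z = bd K w := by
  induction q with
  | zero =>
    intro p c _ z _ _ hz _
    refine ⟨0, AddSubgroup.zero_mem _, AddSubgroup.zero_mem _, ?_⟩
    rw [map_zero]
    ext1 τ
    by_contra h
    have := hz τ h
    omega
  | succ q ih =>
    intro p c hc z hzr hz hq hb
    obtain ⟨y, hy, hR⟩ := chain_choose (V := V)
      (Q := (LinearMap.range (F.mat p).mulVecLin).toAddSubgroup ⊓ gr (F.deg p) c)
      (P := gr (F.deg (p + 1)) c) (fun f g => (F.mat p).mulVecLin g = f ∧ (f = 0 → g = 0)) (by simp)
      (by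
        rintro f ⟨hf1, hf2⟩
        by_cases h : f = 0
        · exact ⟨0, AddSubgroup.zero_mem _, by simp [h]⟩
        · obtain ⟨g, hg, hg2⟩ := gr_lift (F.homog p) hf2 hf1
          exact ⟨g, hg, hg2, fun h' => absurd h' h⟩) (z := z) (fun τ => ⟨hzr τ, hz τ⟩)
    have hAy : Finsupp.mapRange.linearMap (F.mat p).mulVecLin y = z := by
      ext1 τ; exact (hR τ).1
    have hyq : y ∈ sml _ (q + 1) := fun τ h => hq τ fun h' => h ((hR τ).2 h')
    obtain ⟨w, hw1, hw2, hw3⟩ := ih (p + 1) (c + 1) (by push_cast; linarith) (bd K y) (by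
        intro τ
        change _ ∈ LinearMap.range _
        rw [← F.isExact, LinearMap.mem_ker]
        have := bd_map (F.mat p).mulVecLin y
        rw [hAy, hb] at this
        exact DFunLike.congr_fun this τ) (gr_bd hy) (sml_bd hyq) (bd_bd _)
    rw [add_sub_cancel_right] at hw2
    obtain ⟨v, hv, hv2⟩ := gr_exact (z := y - w) (c := c) (dn := F.deg (p + 1))
      (fun k => by have := hd (p + 1) k; push_cast at this; linarith)
      (AddSubgroup.sub_mem _ hy hw2) (by rw [map_sub, hw3, sub_self])
    refine ⟨Finsupp.mapRange.linearMap (F.mat p).mulVecLin v, fun τ => ⟨v τ, rfl⟩, fun τ => ?_, ?_⟩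
    · exact gr_mulVec (F.homog p) (hv τ)
    · rw [← bd_map, ← hv2, map_sub, hAy]
      have : Finsupp.mapRange.linearMap (F.mat p).mulVecLin w = 0 := by
        ext1 τ
        have h := hw1 τ
        change _ ∈ LinearMap.range _ at h
        rw [← F.isExact, LinearMap.mem_ker] at h
        exact h
      rw [this, sub_zero]

theorem P1 {I : Ideal (MvPolynomial V K)} {U : Set (V →₀ ℕ)} (hI : ∀ f, f ∈ I ↔ f ∈ sp K U)
    (F : GradedFreeResolution I) {d : ℤ}
    (hd : ∀ i (k : Fin (F.rank i)), (F.deg i k : ℤ) ≤ d + i) : KV K U d := by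
  intro c hc z hz hbz
  have k0 : Fin (F.rank 0) := Fin.cast F.rank_zero.symm 0
  have hsub : ∀ k : Fin (F.rank 0), k = k0 := by
    intro k; apply Fin.ext; have := F.rank_zero; omega
  let cst : MvPolynomial V K →ₗ[MvPolynomial V K] (Fin (F.rank 0) → MvPolynomial V K) :=
    LinearMap.pi (fun _ => LinearMap.id)
  let pj : (Fin (F.rank 0) → MvPolynomial V K) →ₗ[MvPolynomial V K] MvPolynomial V K := LinearMap.proj k0
  have hcz : Finsupp.mapRange.linearMap cst (bd K z) ∈ chs (LinearMap.range (F.mat 0).mulVecLin).toAddSubgroup := by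
    intro τ
    exact (F.range_zero _).1 ((hI _).2 (hbz τ))
  have hfin : ∃ q, Finsupp.mapRange.linearMap cst (bd K z) ∈ sml (V := V) _ q := by
    refine ⟨((Finsupp.mapRange.linearMap cst (bd K z)).support.sup Finset.card) + 1, fun τ h => ?_⟩
    exact Nat.lt_succ_of_le (Finset.le_sup (f := Finset.card) (by simpa using h))
  obtain ⟨q, hq⟩ := hfin
  obtain ⟨w, hw1, hw2, hw3⟩ := P1_aux F hd q 0 (c + 1) (by simpa using hc) _ hcz (by
    intro τ k
    have := cs_bd_Dg hz τ
    rw [F.deg_zero, Nat.cast_zero, sub_zero]; exact this) hq (by rw [← bd_map, bd_bd, map_zero])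
  have hd0 : 0 ≤ d := by
    have := hd 0 k0
    rw [F.deg_zero] at this; simpa using this
  have hwU : Finsupp.mapRange.linearMap pj w ∈ cs K U := by
    intro τ
    rw [← hI, F.range_zero]
    have e : (fun _ => (Finsupp.mapRange.linearMap pj w) τ) = w τ := by
      funext k
      rw [hsub k]; rfl
    rw [e]; exact hw1 τ
  have hwD : Finsupp.mapRange.linearMap pj w ∈ cs K (Dg c) := by
    intro τ
    have := hw2 τ k0
    rw [F.deg_zero, Nat.cast_zero, sub_zero, add_sub_cancel_right] at this
    exact this
  have hbw : bd K z = bd K (Finsupp.mapRange.linearMap pj w) := by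
    rw [← bd_map, ← hw3]
    ext1 τ
    rfl
  obtain ⟨v, hv, hv2⟩ := exact_pos (lt_of_le_of_lt hd0 hc) (AddSubgroup.sub_mem _ hz hwD) (by
    rw [map_sub, hbw, sub_self])
  refine ⟨v, hv, ?_⟩
  rw [← hv2, sub_sub_cancel]; exact hwU
end KZ
end

noncomputable section
set_option linter.all false
namespace KZ
open MvPolynomial Finsupp

lemma ker_fg_of_free {R S : Type*} [CommRing R] [IsNoetherianRing R] [CommRing S] [Algebra R S]
    [Module.Free R S] {m n : ℕ} (A : Matrix (Fin m) (Fin n) R) :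
    (LinearMap.ker (A.map (algebraMap R S)).mulVecLin).FG := by
  classical
  obtain ⟨s, hs⟩ : (LinearMap.ker A.mulVecLin).FG := IsNoetherian.noetherian _
  let φ : (Fin n → R) → (Fin n → S) := fun y j => algebraMap R S (y j)
  refine ⟨s.image φ, le_antisymm ?_ ?_⟩
  · rw [Submodule.span_le]
    intro v hv
    rw [Finset.coe_image] at hv
    obtain ⟨y, hy, rfl⟩ := hv
    have : y ∈ LinearMap.ker A.mulVecLin := hs ▸ Submodule.subset_span hy
    rw [LinearMap.mem_ker, Matrix.mulVecLin_apply] at this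
    change _ = _
    rw [Matrix.mulVecLin_apply]
    funext k
    have h1 := congrFun this k
    have := congrArg (algebraMap R S) h1
    simpa [Matrix.mulVec, dotProduct, φ] using this
  · have hφ : ∀ y ∈ LinearMap.ker A.mulVecLin, φ y ∈ Submodule.span S ((s.image φ : Finset _) : Set (Fin n → S)) := by
      intro y hy
      rw [← hs] at hy
      induction hy using Submodule.span_induction with
      | mem x hx => exact Submodule.subset_span (by rw [Finset.coe_image]; exact ⟨x, hx, rfl⟩)
      | zero => convert Submodule.zero_mem _; funext j; simp [φ]
      | add x y _ _ hx hy =>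
        have : φ (x + y) = φ x + φ y := by funext j; simp [φ]
        rw [this]; exact Submodule.add_mem _ hx hy
      | smul a x _ hx =>
        have : φ (a • x) = algebraMap R S a • φ x := by funext j; simp [φ]
        rw [this]; exact Submodule.smul_mem _ _ hx
    intro y hy
    let b := Module.Free.chooseBasis R S
    let Y : Module.Free.ChooseBasisIndex R S → Fin n → R := fun i j => b.repr (y j) i
    have hY : ∀ i, Y i ∈ LinearMap.ker A.mulVecLin := by
      intro i
      rw [LinearMap.mem_ker, Matrix.mulVecLin_apply]
      funext k
      rw [LinearMap.mem_ker, Matrix.mulVecLin_apply] at hy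
      have h1 := congrFun hy k
      simp only [Matrix.mulVec, dotProduct, Matrix.map_apply, Pi.zero_apply] at h1 ⊢
      have h2 := congrArg (fun t => b.repr t i) h1
      simp only [← Algebra.smul_def, map_sum, map_smul, map_zero, Finsupp.coe_zero, Pi.zero_apply,
        Finsupp.finset_sum_apply, Finsupp.smul_apply, smul_eq_mul] at h2
      exact h2
    have hsum : y = ∑ i ∈ Finset.univ.biUnion (fun j => (b.repr (y j)).support), b i • φ (Y i) := by
      funext j
      rw [Finset.sum_apply]
      conv_lhs => rw [← b.linearCombination_repr (y j), Finsupp.linearCombination_apply, Finsupp.sum]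
      rw [Finset.sum_subset (Finset.subset_biUnion_of_mem (fun j => (b.repr (y j)).support) (Finset.mem_univ j))]
      · refine Finset.sum_congr rfl fun i _ => ?_
        simp [φ, Y, Algebra.smul_def, mul_comm]
      · intro i _ hi
        rw [Finsupp.notMem_support_iff.1 hi, zero_smul]
    rw [hsum]
    exact Submodule.sum_mem _ fun i _ => Submodule.smul_mem _ _ (hφ _ (hY i))

lemma ker_fg {V K : Type*} [Field K] {m n : ℕ} (A : Matrix (Fin m) (Fin n) (MvPolynomial V K)) :
    (LinearMap.ker A.mulVecLin).FG := by
  classical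
  let W : Finset V := Finset.univ.biUnion fun k => Finset.univ.biUnion fun j => (A k j).vars
  have hB : ∀ k j, ∃ q : MvPolynomial W K, rename Subtype.val q = A k j := by
    intro k j
    refine exists_rename_eq_of_vars_subset_range _ _ Subtype.val_injective ?_
    intro v hv
    rw [Subtype.range_coe]
    simp only [W, Finset.coe_biUnion, Set.mem_iUnion]
    exact ⟨k, by simp, j, by simp, hv⟩
  choose B hB using hB
  letI : Algebra (MvPolynomial W K) (MvPolynomial V K) :=
    (rename (R := K) (Subtype.val : W → V)).toRingHom.toAlgebra
  let σ : V ≃ {v // ¬ v ∈ W} ⊕ {v // v ∈ W} := (Equiv.sumCompl (· ∈ W)).symm.trans (Equiv.sumComm _ _)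
  let e : MvPolynomial V K ≃ₐ[K] MvPolynomial {v // ¬ v ∈ W} (MvPolynomial W K) :=
    (renameEquiv K σ).trans (sumAlgEquiv K _ _)
  have he : ∀ f : MvPolynomial W K, e (rename Subtype.val f) = C f := by
    intro f
    have : (e : MvPolynomial V K →ₐ[K] _).comp (rename (Subtype.val : W → V)) =
        IsScalarTower.toAlgHom K (MvPolynomial W K) (MvPolynomial {v // ¬ v ∈ W} (MvPolynomial W K)) := by
      ext1 v
      simp [e, σ, algebraMap_eq]
    exact DFunLike.congr_fun this f
  let el : MvPolynomial V K ≃ₗ[MvPolynomial W K] MvPolynomial {v // ¬ v ∈ W} (MvPolynomial W K) :=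
    { e.toRingEquiv.toAddEquiv with
      map_smul' := by
        intro f g
        change e (rename Subtype.val f * g) = f • e g
        rw [map_mul, he, C_mul'] }
  haveI : Module.Free (MvPolynomial W K) (MvPolynomial V K) := Module.Free.of_equiv el.symm
  have := ker_fg_of_free (S := MvPolynomial V K) (Matrix.of B)
  have h2 : (Matrix.of B).map (algebraMap (MvPolynomial W K) (MvPolynomial V K)) = A := by
    funext k j
    exact hB k j
  rw [h2] at this
  exact this
end KZ
end

noncomputable section
set_option linter.all false
namespace KZ
open MvPolynomial Finsupp EdgeIdealReg
variable {V : Type} {K : Type} [Field K]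

/-- vector decomposes into its homogeneous components -/
lemma sum_hcp {n : ℕ} (deg : Fin n → ℕ) (v : Fin n → MvPolynomial V K) :
    ∃ N : ℕ, v = ∑ c ∈ Finset.range N, hcp deg (c : ℤ) v := by
  classical
  refine ⟨(Finset.univ.sup fun k => (v k).support.sup fun a => a.degree + deg k) + 1, ?_⟩
  funext k
  rw [Finset.sum_apply]
  ext a
  rw [coeff_sum]
  simp only [hcp, coeff_pr]
  by_cases h : coeff a (v k) = 0
  · simp [h]
  · rw [Finset.sum_eq_single (a.degree + deg k)]
    · rw [if_pos]; rw [mem_Dg]; push_cast; ring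
    · intro b _ hb
      rw [if_neg]; rw [mem_Dg]; intro h2; apply hb; push_cast at h2; omega
    · intro h2
      exfalso; apply h2
      rw [Finset.mem_range, Nat.lt_succ_iff]
      refine le_trans ?_ (Finset.le_sup (f := fun k => (v k).support.sup fun a => a.degree + deg k) (Finset.mem_univ k))
      exact Finset.le_sup (f := fun a => a.degree + deg k) (MvPolynomial.mem_support_iff.2 h)

lemma gr_neg {n : ℕ} {deg : Fin n → ℕ} {c : ℤ} (hc : c < 0) {v : Fin n → MvPolynomial V K}
    (hv : v ∈ gr deg c) : v = 0 := by
  funext k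
  ext a
  by_contra h
  have := hv k a h
  rw [mem_Dg] at this; omega

variable [LinearOrder V]

/-- Koszul cycle condition for a submodule -/
def CC {n : ℕ} (deg : Fin n → ℕ) (M : Submodule (MvPolynomial V K) (Fin n → MvPolynomial V K)) (D : ℤ) : Prop :=
  ∀ c, D < c → ∀ z : Finset V →₀ (Fin n → MvPolynomial V K), z ∈ chs M.toAddSubgroup → z ∈ chs (gr deg c) →
    bd K z = 0 → ∃ w : Finset V →₀ (Fin n → MvPolynomial V K), w ∈ chs M.toAddSubgroup ∧
      w ∈ chs (gr deg (c - 1)) ∧ z = bd K w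

lemma nak {n : ℕ} {deg : Fin n → ℕ} {M : Submodule (MvPolynomial V K) (Fin n → MvPolynomial V K)} {D : ℤ}
    (h : CC deg M D) {c : ℤ} (hc : D < c) {v : Fin n → MvPolynomial V K} (hv : v ∈ M) (hg : v ∈ gr deg c) :
    v ∈ Submodule.span (MvPolynomial V K) {u | u ∈ M ∧ u ∈ gr deg (c - 1)} := by
  obtain ⟨w, hw1, hw2, hw3⟩ := h c hc (single ∅ v) (single_mem_chs hv) (single_mem_chs hg) (by simp [bd_single])
  have : bd K w ∈ chs (Submodule.span (MvPolynomial V K) {u | u ∈ M ∧ u ∈ gr deg (c - 1)}).toAddSubgroup := by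
    refine bd_mem (P := M.toAddSubgroup ⊓ gr deg (c - 1)) ?_ (fun τ => ⟨hw1 τ, hw2 τ⟩)
    rintro x f ⟨hf1, hf2⟩
    exact Submodule.smul_mem _ _ (Submodule.subset_span ⟨hf1, hf2⟩)
  rw [← hw3] at this
  simpa using this ∅

/-- generators of degree at most `D` -/
def gens {n : ℕ} (deg : Fin n → ℕ) (M : Submodule (MvPolynomial V K) (Fin n → MvPolynomial V K)) (D : ℤ) :
    Set (Fin n → MvPolynomial V K) := {v | v ∈ M ∧ ∃ c : ℕ, (c : ℤ) ≤ D ∧ v ∈ gr deg (c : ℤ)}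

lemma nak2 {n : ℕ} {deg : Fin n → ℕ} {M : Submodule (MvPolynomial V K) (Fin n → MvPolynomial V K)} {D : ℤ}
    (h : CC deg M D) (N : ℕ) : ∀ {c : ℤ}, c ≤ D + N → ∀ {v : Fin n → MvPolynomial V K}, v ∈ M → v ∈ gr deg c →
    v ∈ Submodule.span (MvPolynomial V K) (gens deg M D) := by
  have base : ∀ {c : ℤ}, c ≤ D → ∀ {v : Fin n → MvPolynomial V K}, v ∈ M → v ∈ gr deg c →
    v ∈ Submodule.span (MvPolynomial V K) (gens deg M D) := by
    intro c hc v hv hg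
    rcases lt_or_ge c 0 with h0 | h0
    · rw [gr_neg h0 hg]; exact Submodule.zero_mem _
    · obtain ⟨k, rfl⟩ := Int.eq_ofNat_of_zero_le h0
      exact Submodule.subset_span ⟨hv, k, hc, hg⟩
  induction N with
  | zero => intro c hc v hv hg; exact base (by simpa using hc) hv hg
  | succ N ih =>
    intro c hc v hv hg
    rcases le_or_gt c D with h0 | h0
    · exact base h0 hv hg
    · refine Submodule.span_le.2 ?_ (nak h h0 hv hg)
      rintro u ⟨hu1, hu2⟩
      exact ih (by push_cast at hc; linarith) hu1 hu2

/-- state of the construction of the resolution -/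
structure St (V K : Type) [Field K] [LinearOrder V] where
  n : ℕ
  deg : Fin n → ℕ
  M : Submodule (MvPolynomial V K) (Fin n → MvPolynomial V K)
  D : ℤ
  hom : ∀ v ∈ M, ∀ c, hcp deg c v ∈ M
  fg : M.FG
  cc : CC deg M D

lemma St.span (s : St V K) : Submodule.span (MvPolynomial V K) (gens s.deg s.M s.D) = s.M := by
  apply le_antisymm
  · rw [Submodule.span_le]; exact fun v hv => hv.1
  · intro v hv
    obtain ⟨N, hN⟩ := sum_hcp s.deg v
    rw [hN]
    refine Submodule.sum_mem _ fun c _ => ?_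
    exact nak2 s.cc (((c : ℤ) - s.D).toNat) (by have := Int.self_le_toNat ((c : ℤ) - s.D); linarith)
      (s.hom v hv c) (hcp_mem _ _ _)

lemma hom_of_sp {f : MvPolynomial V K} {e : ℕ} (hf : f ∈ sp K (Dg (e : ℤ))) : f.IsHomogeneous e := by
  intro a ha
  have := hf a ha
  rw [mem_Dg] at this
  have h2 : a.degree = e := by exact_mod_cast this
  rw [Finsupp.degree_eq_weight_one] at h2; exact h2

lemma St.next (s : St V K) : ∃ (t : St V K) (A : Matrix (Fin s.n) (Fin t.n) (MvPolynomial V K)),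
    HM s.deg t.deg A ∧ LinearMap.range A.mulVecLin = s.M ∧ LinearMap.ker A.mulVecLin = t.M ∧
    t.D = s.D + 1 ∧ ∀ j, (t.deg j : ℤ) ≤ s.D := by
  classical
  have hfg := s.fg
  rw [← s.span, Submodule.fg_span_iff_fg_span_finset_subset] at hfg
  obtain ⟨T, hT, hspan⟩ := hfg
  rw [s.span] at hspan
  let en := T.equivFin.symm
  have hg : ∀ j, (en j : Fin s.n → MvPolynomial V K) ∈ s.M ∧ ∃ c : ℕ, (c : ℤ) ≤ s.D ∧
    (en j : Fin s.n → MvPolynomial V K) ∈ gr s.deg (c : ℤ) := fun j => hT (en j).2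
  choose hgM dg hdg hgr using hg
  let A : Matrix (Fin s.n) (Fin T.card) (MvPolynomial V K) := Matrix.of fun k j => (en j : Fin s.n → MvPolynomial V K) k
  have hA : HM s.deg dg A := by
    intro k j
    by_cases h0 : A k j = 0
    · exact Or.inl h0
    · right
      have h1 := hgr j k
      obtain ⟨a, ha⟩ := MvPolynomial.ne_zero_iff.1 h0
      have h2 := h1 a ha
      rw [mem_Dg] at h2
      refine ⟨dg j - s.deg k, by omega, hom_of_sp ?_⟩
      have : ((dg j - s.deg k : ℕ) : ℤ) = (dg j : ℤ) - s.deg k := by omega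
      rw [this]; exact h1
  have hr : LinearMap.range A.mulVecLin = s.M := by
    rw [Matrix.range_mulVecLin, hspan]
    congr 1
    ext v
    constructor
    · rintro ⟨j, rfl⟩
      exact (en j).2
    · intro hv
      exact ⟨en.symm ⟨v, hv⟩, by funext k; simp [A, Matrix.col]⟩
  refine ⟨⟨T.card, dg, LinearMap.ker A.mulVecLin, s.D + 1, ?_, ker_fg A, ?_⟩, A, hA, hr, rfl, rfl, hdg⟩
  · intro v hv c
    rw [LinearMap.mem_ker, Matrix.mulVecLin_apply] at hv ⊢
    rw [← hcp_mulVec hA, hv]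
    exact hcp_eq (AddSubgroup.zero_mem _)
  · intro c hc z hzM hz hb
    obtain ⟨y, hy, rfl⟩ := gr_exact (fun k => by have := hdg k; linarith) hz hb
    obtain ⟨w, hw1, hw2, hw3⟩ := s.cc (c - 1) (by linarith) (Finsupp.mapRange.linearMap A.mulVecLin y)
      (fun τ => by rw [← hr]; exact ⟨y τ, rfl⟩) (fun τ => gr_mulVec hA (hy τ)) (by
        rw [← bd_map]; ext1 τ; exact hzM τ)
    obtain ⟨u, hu, hR⟩ := chain_choose (V := V)
      (Q := s.M.toAddSubgroup ⊓ gr s.deg (c - 1 - 1))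
      (P := gr dg (c - 1 - 1)) (fun f g => A.mulVecLin g = f) (by simp)
      (by
        rintro f ⟨hf1, hf2⟩
        exact gr_lift hA hf2 (by rw [hr]; exact hf1)) (z := w) (fun τ => ⟨hw1 τ, hw2 τ⟩)
    have hAu : Finsupp.mapRange.linearMap A.mulVecLin u = w := by ext1 τ; exact hR τ
    refine ⟨y - bd K u, ?_, AddSubgroup.sub_mem _ hy (by simpa using gr_bd hu), by rw [map_sub, bd_bd, sub_zero]⟩
    intro τ
    have : Finsupp.mapRange.linearMap A.mulVecLin (y - bd K u) = 0 := by
      rw [map_sub, bd_map, hAu, hw3, sub_self]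
    exact DFunLike.congr_fun this τ

theorem P2 {I : Ideal (MvPolynomial V K)} {U : Set (V →₀ ℕ)} (hU : IsUpperSet U) (hI : ∀ f, f ∈ I ↔ f ∈ sp K U)
    (hfg : I.FG) {d : ℤ} (hd : 0 ≤ d) (hKV : KV K U d) :
    ∃ F : GradedFreeResolution I, ∀ i (k : Fin (F.rank i)), (F.deg i k : ℤ) ≤ d + i := by
  let M0 : Submodule (MvPolynomial V K) (Fin 1 → MvPolynomial V K) :=
    Submodule.map (LinearMap.pi (fun _ => LinearMap.id)) I
  have hM0 : ∀ v, v ∈ M0 ↔ v 0 ∈ I := by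
    intro v
    constructor
    · rintro ⟨f, hf, rfl⟩; exact hf
    · intro h; exact ⟨v 0, h, by funext k; rw [Subsingleton.elim k 0]; rfl⟩
  let s0 : St V K := ⟨1, fun _ => 0, M0, d + 1, by
      intro v hv c
      rw [hM0, hI] at hv ⊢
      intro a ha
      classical
      simp only [hcp, coeff_pr] at ha
      split_ifs at ha with h
      · exact hv a ha
      · exact absurd rfl ha, Submodule.FG.map _ hfg, by
      intro c hc z hzM hz hb
      obtain ⟨y, hy, rfl⟩ := gr_exact (fun k => by push_cast; linarith) hz hb
      let pj : (Fin 1 → MvPolynomial V K) →ₗ[MvPolynomial V K] MvPolynomial V K := LinearMap.proj 0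
      let cst : MvPolynomial V K →ₗ[MvPolynomial V K] (Fin 1 → MvPolynomial V K) :=
        LinearMap.pi (fun _ => LinearMap.id)
      obtain ⟨w, hw, hw2⟩ := hKV (c - 1) (by linarith) (Finsupp.mapRange.linearMap pj y)
        (fun τ => by have := hy τ 0; rw [Nat.cast_zero, sub_zero] at this; exact this)
        (by rw [← bd_map]; intro τ; rw [← hI]; exact (hM0 _).1 (hzM τ))
      have hcp1 : ∀ y : Finset V →₀ (Fin 1 → MvPolynomial V K),
          Finsupp.mapRange.linearMap cst (Finsupp.mapRange.linearMap pj y) = y := by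
        intro y; ext1 τ; funext k; rw [Subsingleton.elim k 0]; rfl
      refine ⟨y - bd K (Finsupp.mapRange.linearMap cst w), ?_, AddSubgroup.sub_mem _ hy ?_, ?_⟩
      · intro τ
        change _ ∈ M0
        rw [hM0, hI]
        have := hw2 τ
        rw [← bd_map]; exact this
      · have : Finsupp.mapRange.linearMap cst w ∈ chs (V := V) (gr (K := K) (fun _ : Fin 1 => 0) (c - 1 - 1)) := by
          intro τ k
          have := hw τ
          rw [Nat.cast_zero, sub_zero]; exact this
        simpa using gr_bd this
      · rw [map_sub, bd_bd, sub_zero]⟩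
  choose nx A hHM hr hk hD hdeg using (St.next (V := V) (K := K))
  let sq : ℕ → St V K := fun i => Nat.rec s0 (fun _ t => nx t) i
  have hsqD : ∀ i : ℕ, (sq i).D = d + 1 + i := by
    intro i
    induction i with
    | zero => simp [sq, s0]
    | succ i ih =>
      have : (sq (i + 1)).D = (sq i).D + 1 := hD (sq i)
      rw [this, ih]; push_cast; ring
  refine ⟨⟨fun i => (sq i).n, fun i => (sq i).deg, rfl, fun _ => rfl, fun i => A (sq i), ?_, ?_, ?_⟩, ?_⟩
  · intro i; exact hHM (sq i)
  · intro f
    have := hr (sq 0)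
    rw [this]
    exact (hM0 (fun _ => f)).symm
  · intro i
    rw [hk (sq i)]
    exact (hr (sq (i + 1))).symm
  · intro i
    match i with
    | 0 => intro k; change ((0 : ℕ) : ℤ) ≤ _; push_cast; linarith
    | i + 1 =>
      intro k
      have := hdeg (sq i) k
      rw [hsqD] at this
      push_cast
      change ((nx (sq i)).deg k : ℤ) ≤ _
      linarith
end KZ
end

noncomputable section
set_option linter.all false
namespace KZ
open MvPolynomial Finsupp
variable {V : Type*} {K : Type*} [Field K] [LinearOrder V]

/-- covers of a bipartite graph -/
def cov (X Y : Finset V) (E : V → V → Prop) (A B : Finset V) : Prop :=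
  A ⊆ X ∧ B ⊆ Y ∧ ∀ x ∈ X, ∀ y ∈ Y, E x y → x ∈ A ∨ y ∈ B

/-- bipartite symbolic powers -/
def BSym (X Y : Finset V) (E : V → V → Prop) (k : ℕ) : Set (V →₀ ℕ) :=
  {a | ∀ A B, cov X Y E A B → k ≤ ∑ v ∈ A, a v + ∑ v ∈ B, a v}

/-- tight covers -/
def tgt (X Y : Finset V) (E : V → V → Prop) (m : V →₀ ℕ) (k : ℕ) (A B : Finset V) : Prop :=
  cov X Y E A B ∧ ∑ v ∈ A, m v + ∑ v ∈ B, m v = k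

lemma BSym_upper (X Y : Finset V) (E : V → V → Prop) (k : ℕ) : IsUpperSet (BSym X Y E k) := by
  intro a b hab ha A B h
  exact (ha A B h).trans (add_le_add (Finset.sum_le_sum fun v _ => hab v) (Finset.sum_le_sum fun v _ => hab v))

lemma cov_swap {X Y : Finset V} {E : V → V → Prop} {A B : Finset V} (h : cov X Y E A B) :
    cov Y X (fun y x => E x y) B A :=
  ⟨h.2.1, h.1, fun y hy x hx e => (h.2.2 x hx y hy e).symm⟩

lemma BSym_swap (X Y : Finset V) (E : V → V → Prop) (k : ℕ) :
    BSym X Y E k = BSym Y X (fun y x => E x y) k := by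
  ext a
  constructor
  · intro h A B hc
    rw [add_comm]; exact h B A (cov_swap hc)
  · intro h A B hc
    rw [add_comm]; exact h B A (cov_swap hc)

lemma cov_X (X Y : Finset V) (E : V → V → Prop) : cov X Y E X ∅ :=
  ⟨le_rfl, by simp, fun x hx _ _ _ => Or.inl hx⟩

lemma cov_Y (X Y : Finset V) (E : V → V → Prop) : cov X Y E ∅ Y :=
  ⟨by simp, le_rfl, fun x hx _ hy _ => Or.inr hy⟩

lemma BSym_one (X Y : Finset V) (E : V → V → Prop) :
    BSym X Y E 1 = {a | ∃ x ∈ X, ∃ y ∈ Y, E x y ∧ 0 < a x ∧ 0 < a y} := by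
  ext a
  constructor
  · intro h
    by_contra hn
    have hn' : ∀ x ∈ X, ∀ y ∈ Y, E x y → a x = 0 ∨ a y = 0 := by
      intro x hx y hy e
      by_contra h2
      push Not at h2
      exact hn ⟨x, hx, y, hy, e, Nat.pos_of_ne_zero h2.1, Nat.pos_of_ne_zero h2.2⟩
    have := h (X.filter (fun v => a v = 0)) (Y.filter (fun v => a v = 0)) ⟨Finset.filter_subset _ _, Finset.filter_subset _ _, by
      intro x hx y hy e
      rw [Finset.mem_filter, Finset.mem_filter]
      rcases hn' x hx y hy e with h | h
      · exact Or.inl ⟨hx, h⟩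
      · exact Or.inr ⟨hy, h⟩⟩
    rw [Finset.sum_eq_zero (fun v hv => (Finset.mem_filter.1 hv).2), Finset.sum_eq_zero (fun v hv => (Finset.mem_filter.1 hv).2)] at this
    omega
  · rintro ⟨x, hx, y, hy, e, h1, h2⟩ A B hc
    rcases hc.2.2 x hx y hy e with h | h
    · have := Finset.single_le_sum (f := fun v => a v) (fun _ _ => Nat.zero_le _) h
      omega
    · have := Finset.single_le_sum (f := fun v => a v) (fun _ _ => Nat.zero_le _) h
      omega

lemma tgt_union {X Y : Finset V} {E : V → V → Prop} {m : V →₀ ℕ} {k : ℕ} (hm : m ∈ BSym X Y E k)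
    {A B A' B' : Finset V} (h : tgt X Y E m k A B) (h' : tgt X Y E m k A' B') :
    tgt X Y E m k (A ∪ A') (B ∩ B') ∧ tgt X Y E m k (A ∩ A') (B ∪ B') := by
  have c1 : cov X Y E (A ∪ A') (B ∩ B') := by
    refine ⟨Finset.union_subset h.1.1 h'.1.1, Finset.inter_subset_left.trans h.1.2.1, ?_⟩
    intro x hx y hy e
    rw [Finset.mem_union, Finset.mem_inter]
    have := h.1.2.2 x hx y hy e
    have := h'.1.2.2 x hx y hy e
    tauto
  have c2 : cov X Y E (A ∩ A') (B ∪ B') := by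
    refine ⟨Finset.inter_subset_left.trans h.1.1, Finset.union_subset h.1.2.1 h'.1.2.1, ?_⟩
    intro x hx y hy e
    rw [Finset.mem_union, Finset.mem_inter]
    have := h.1.2.2 x hx y hy e
    have := h'.1.2.2 x hx y hy e
    tauto
  have e1 := Finset.sum_union_inter (s₁ := A) (s₂ := A') (f := fun v => m v)
  have e2 := Finset.sum_union_inter (s₁ := B) (s₂ := B') (f := fun v => m v)
  have g1 := hm _ _ c1
  have g2 := hm _ _ c2
  have t1 := h.2
  have t2 := h'.2
  exact ⟨⟨c1, by omega⟩, ⟨c2, by omega⟩⟩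

lemma exists_top {X Y : Finset V} (P : Finset V → Finset V → Prop) (hsub : ∀ A B, P A B → A ⊆ X ∧ B ⊆ Y)
    (hne : ∃ A B, P A B) (hU : ∀ A B A' B', P A B → P A' B' → P (A ∪ A') (B ∩ B')) :
    ∃ A B, P A B ∧ ∀ A' B', P A' B' → A' ⊆ A ∧ B ⊆ B' := by
  classical
  let F : Finset (Finset V × Finset V) := (X.powerset ×ˢ Y.powerset).filter (fun p => P p.1 p.2)
  have hF : ∀ A B, (A, B) ∈ F ↔ P A B := by
    intro A B
    simp only [F, Finset.mem_filter, Finset.mem_product, Finset.mem_powerset]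
    exact ⟨fun h => h.2, fun h => ⟨hsub A B h, h⟩⟩
  obtain ⟨A0, B0, h0⟩ := hne
  obtain ⟨⟨A, B⟩, hAB, hmax⟩ := F.exists_max_image (fun p => (p.1.card : ℤ) - p.2.card) ⟨(A0, B0), (hF _ _).2 h0⟩
  refine ⟨A, B, (hF _ _).1 hAB, fun A' B' h' => ?_⟩
  have h1 := hmax (A ∪ A', B ∩ B') ((hF _ _).2 (hU _ _ _ _ ((hF _ _).1 hAB) h'))
  simp only at h1
  have c1 : A.card ≤ (A ∪ A').card := Finset.card_le_card Finset.subset_union_left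
  have c2 : (B ∩ B').card ≤ B.card := Finset.card_le_card Finset.inter_subset_left
  have d1 : A = A ∪ A' := Finset.eq_of_subset_of_card_le Finset.subset_union_left (by omega)
  have d2 : B ∩ B' = B := Finset.eq_of_subset_of_card_le Finset.inter_subset_left (by omega)
  exact ⟨Finset.union_eq_left.1 d1.symm, Finset.inter_eq_left.1 d2⟩

lemma sum_add_single (A : Finset V) (a : V →₀ ℕ) (x : V) :
    ∑ v ∈ A, (a + (single x 1 : V →₀ ℕ)) v = ∑ v ∈ A, a v + if x ∈ A then 1 else 0 := by
  simp only [Finsupp.add_apply]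
  rw [Finset.sum_add_distrib]
  congr 1
  simp [Finsupp.single_apply]

lemma sub_single {m : V →₀ ℕ} {x : V} (h : 0 < m x) : ∃ m' : V →₀ ℕ, m = m' + (single x 1 : V →₀ ℕ) := by
  have hle : (single x 1 : V →₀ ℕ) ≤ m := by rw [Finsupp.single_le_iff]; omega
  obtain ⟨m', rfl⟩ := exists_add_of_le hle
  exact ⟨m', add_comm _ _⟩

lemma min_key {X Y : Finset V} (hXY : Disjoint X Y) {E : V → V → Prop} {m : V →₀ ℕ} {k : ℕ} (hm : m ∈ BSym X Y E k)
    (hmin : ∀ m' ∈ BSym X Y E k, m' ≤ m → m' = m) {x : V} (hx : 0 < m x) :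
    ∃ A B, tgt X Y E m k A B ∧ (x ∈ A ∨ x ∈ B) := by
  obtain ⟨m', rfl⟩ := sub_single hx
  have hne : m' ∉ BSym X Y E k := by
    intro h
    have := hmin _ h le_self_add
    have := DFunLike.congr_fun this x
    simp at this
  rw [BSym, Set.mem_setOf_eq] at hne
  push Not at hne
  obtain ⟨A, B, hc, hlt⟩ := hne
  have h1 := hm A B hc
  refine ⟨A, B, ⟨hc, ?_⟩, ?_⟩
  · rw [sum_add_single, sum_add_single] at h1 ⊢
    have hd : ¬ (x ∈ A ∧ x ∈ B) := fun h => Finset.disjoint_left.1 hXY (hc.1 h.1) (hc.2.1 h.2)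
    split_ifs at h1 ⊢ with h2 h3 h3
    · exact absurd ⟨h2, h3⟩ hd
    all_goals omega
  · rw [sum_add_single, sum_add_single] at h1
    by_contra hn
    push Not at hn
    rw [if_neg hn.1, if_neg hn.2] at h1
    omega

lemma min_le {X Y : Finset V} (hXY : Disjoint X Y) {E : V → V → Prop} {m : V →₀ ℕ} {k : ℕ} (hm : m ∈ BSym X Y E k)
    (hmin : ∀ m' ∈ BSym X Y E k, m' ≤ m → m' = m) : ∑ v ∈ X, m v = k := by
  have hk : k ≤ ∑ v ∈ X, m v := by simpa using hm X ∅ (cov_X X Y E)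
  refine le_antisymm ?_ hk
  by_cases hk0 : ∃ x ∈ X, 0 < m x
  · obtain ⟨x0, hx0, h0⟩ := hk0
    obtain ⟨A0, B0, h00, -⟩ := min_key hXY hm hmin h0
    obtain ⟨A, B, hAB, hmax⟩ := exists_top (X := X) (Y := Y) (tgt X Y E m k) (fun A B h => ⟨h.1.1, h.1.2.1⟩) ⟨A0, B0, h00⟩
      (fun A B A' B' h h' => (tgt_union hm h h').1)
    have : ∑ v ∈ X, m v = ∑ v ∈ A, m v := by
      symm
      apply Finset.sum_subset hAB.1.1
      intro x hx hxA
      by_contra hne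
      obtain ⟨A1, B1, h1, h2⟩ := min_key hXY hm hmin (Nat.pos_of_ne_zero hne)
      rcases h2 with h2 | h2
      · exact hxA ((hmax _ _ h1).1 h2)
      · exact Finset.disjoint_left.1 hXY hx (h1.1.2.1 h2)
    have := hAB.2
    omega
  · push Not at hk0
    rw [Finset.sum_eq_zero (fun x hx => by have := hk0 x hx; omega)]; omega

/-- minimal generators -/
def MG (X Y : Finset V) (E : V → V → Prop) (k : ℕ) : Set (V →₀ ℕ) :=
  {m | m ∈ BSym X Y E k ∧ m.support ⊆ X ∪ Y ∧ ∑ v ∈ X, m v = k ∧ ∑ v ∈ Y, m v = k}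

lemma exists_MG {X Y : Finset V} (hXY : Disjoint X Y) {E : V → V → Prop} {a : V →₀ ℕ} {k : ℕ} (ha : a ∈ BSym X Y E k) :
    ∃ m ∈ MG X Y E k, m ≤ a := by
  obtain ⟨m, hle, hmm⟩ := exists_minimal_le_of_wellFoundedLT (fun m => m ∈ BSym X Y E k) a ha
  have hm := hmm.1
  have hmin : ∀ m' ∈ BSym X Y E k, m' ≤ m → m' = m := fun m' h1 h2 => le_antisymm h2 (hmm.2 h1 h2)
  refine ⟨m, ⟨hm, ?_, min_le hXY hm hmin, ?_⟩, hle⟩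
  · intro v hv
    obtain ⟨A, B, h1, h2⟩ := min_key hXY hm hmin (Nat.pos_of_ne_zero (Finsupp.mem_support_iff.1 hv))
    rw [Finset.mem_union]
    exact h2.imp (fun h => h1.1.1 h) (fun h => h1.1.2.1 h)
  · rw [BSym_swap] at hm hmin
    exact min_le hXY.symm hm hmin

lemma exch {X Y : Finset V} (hXY : Disjoint X Y) {E : V → V → Prop} {m m' : V →₀ ℕ} {k : ℕ}
    (hm : m ∈ BSym X Y E k) (hm' : m' ∈ BSym X Y E k)
    (hX : ∑ v ∈ X, m v = k) (hY : ∑ v ∈ Y, m v = k)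
    (hX' : ∑ v ∈ X, m' v = k) (hY' : ∑ v ∈ Y, m' v = k) {z : V} (hz : z ∈ X) (hlt : m z < m' z) :
    (∃ w ∈ X, m' w < m w ∧ ∀ n : V →₀ ℕ, n + (single w 1 : V →₀ ℕ) = m + (single z 1 : V →₀ ℕ) → n ∈ BSym X Y E k) ∨
    (∃ y ∈ Y, m y < m' y ∧ m + (single z 1 : V →₀ ℕ) + (single y 1 : V →₀ ℕ) ∈ BSym X Y E (k + 1)) := by
  by_contra hcon
  push Not at hcon
  obtain ⟨hc1, hc2⟩ := hcon
  obtain ⟨A, B, ⟨hAB, hzA⟩, hmax⟩ := exists_top (X := X) (Y := Y) (fun A B => tgt X Y E m k A B ∧ z ∉ A)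
    (fun A B h => ⟨h.1.1.1, h.1.1.2.1⟩)
    ⟨∅, Y, ⟨cov_Y X Y E, by simpa using hY⟩, by simp⟩
    (fun A B A' B' h h' => ⟨(tgt_union hm h.1 h'.1).1, by rw [Finset.mem_union]; push Not; exact ⟨h.2, h'.2⟩⟩)
  have hzY : z ∉ Y := Finset.disjoint_left.1 hXY hz
  have hzB : z ∉ B := fun h => hzY (hAB.1.2.1 h)
  -- all w are in A
  have hw : ∀ w ∈ X, m' w < m w → w ∈ A := by
    intro w hwX hlw
    obtain ⟨n, hn, hnS⟩ := hc1 w hwX hlw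
    rw [BSym, Set.mem_setOf_eq] at hnS
    push Not at hnS
    obtain ⟨A1, B1, hcv, hs⟩ := hnS
    have h1 := hm A1 B1 hcv
    have e1 := sum_add_single A1 n w
    have e2 := sum_add_single B1 n w
    rw [hn, sum_add_single] at e1 e2
    have hwB : w ∉ B1 := fun h => Finset.disjoint_left.1 hXY hwX (hcv.2.1 h)
    have hzB1 : z ∉ B1 := fun h => hzY (hcv.2.1 h)
    rw [if_neg hwB, if_neg hzB1] at e2
    have : tgt X Y E m k A1 B1 ∧ z ∉ A1 ∧ w ∈ A1 := by
      by_cases a1 : z ∈ A1 <;> by_cases a2 : w ∈ A1 <;> simp only [a1, a2, if_true, if_false] at e1 <;>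
        first | exact ⟨⟨hcv, by omega⟩, a1, a2⟩ | (exfalso; omega)
    exact (hmax A1 B1 ⟨this.1, this.2.1⟩).1 this.2.2
  have hy : ∀ y ∈ Y, m y < m' y → y ∉ B := by
    intro y hyY hly hyB
    have hnS := hc2 y hyY hly
    rw [BSym, Set.mem_setOf_eq] at hnS
    push Not at hnS
    obtain ⟨A1, B1, hcv, hs⟩ := hnS
    have h1 := hm A1 B1 hcv
    simp only [sum_add_single] at hs
    have hzA1 : z ∉ A1 := by
      intro h; rw [if_pos h] at hs; omega
    have hyB1 : y ∉ B1 := by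
      intro h; rw [if_pos h] at hs; omega
    have : tgt X Y E m k A1 B1 := ⟨hcv, by omega⟩
    exact hyB1 ((hmax A1 B1 ⟨this, hzA1⟩).2 hyB)
  -- m'(A) + m'(B) < k
  have hB : ∑ v ∈ B, m' v ≤ ∑ v ∈ B, m v := Finset.sum_le_sum fun v hv => by
    by_contra hh; push Not at hh
    exact hy v (hAB.1.2.1 hv) hh hv
  have hA : ∑ v ∈ X \ A, m v < ∑ v ∈ X \ A, m' v := by
    apply Finset.sum_lt_sum
    · intro v hv
      rw [Finset.mem_sdiff] at hv
      by_contra hh; push Not at hh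
      exact hv.2 (hw v hv.1 hh)
    · exact ⟨z, Finset.mem_sdiff.2 ⟨hz, hzA⟩, hlt⟩
  have s1 := Finset.sum_sdiff (f := fun v => m v) hAB.1.1
  have s2 := Finset.sum_sdiff (f := fun v => m' v) hAB.1.1
  have h1 := hm' A B hAB.1
  have h2 := hAB.2
  omega
end KZ
end

noncomputable section
set_option linter.all false
namespace KZ
open MvPolynomial Finsupp
variable {V : Type*} {K : Type*} [Field K] [LinearOrder V]

/-- even-connection closure -/
def Ec (E : V → V → Prop) (x0 y0 : V) : V → V → Prop := fun x y => E x y ∨ (E x y0 ∧ E x0 y)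

lemma pos_add_single {a : V →₀ ℕ} {x v : V} (h : 0 < (a + (single x 1 : V →₀ ℕ)) v) (hne : v ≠ x) : 0 < a v := by
  rw [Finsupp.add_apply, Finsupp.single_eq_of_ne hne] at h
  exact h

lemma KV_Ec {X Y : Finset V} (hXY : Disjoint X Y) {E : V → V → Prop} {x0 y0 : V} (hx0 : x0 ∈ X) (hy0 : y0 ∈ Y)
    (he : E x0 y0) {d : ℤ} (h : KV K (BSym X Y E 1) d) : KV K (BSym X Y (Ec E x0 y0) 1) d := by
  classical
  have hU := BSym_upper X Y E 1
  set Nx := Y.filter (fun y => E x0 y) with hNx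
  set Ny := X.filter (fun x => E x y0) with hNy
  have mNx : ∀ v, v ∈ Nx ↔ v ∈ Y ∧ E x0 v := fun v => by simp [hNx]
  have mNy : ∀ v, v ∈ Ny ↔ v ∈ X ∧ E v y0 := fun v => by simp [hNy]
  have dXY : ∀ v, v ∈ X → v ∈ Y → False := fun v h1 h2 => Finset.disjoint_left.1 hXY h1 h2
  have e0 : BSym X Y (Ec E x0 y0) 1 = (BSym X Y E 1 ∪ vs Nx) ∩ (BSym X Y E 1 ∪ vs Ny) := by
    ext a
    rw [BSym_one, BSym_one]
    constructor
    · rintro ⟨x, hx, y, hy, e, h1, h2⟩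
      rcases e with e | ⟨e1, e2⟩
      · exact ⟨Or.inl ⟨x, hx, y, hy, e, h1, h2⟩, Or.inl ⟨x, hx, y, hy, e, h1, h2⟩⟩
      · exact ⟨Or.inr ⟨y, (mNx y).2 ⟨hy, e2⟩, h2⟩, Or.inr ⟨x, (mNy x).2 ⟨hx, e1⟩, h1⟩⟩
    · rintro ⟨h1, h2⟩
      rcases h1 with ⟨x, hx, y, hy, e, h1, h3⟩ | ⟨y, hy, h1⟩
      · exact ⟨x, hx, y, hy, Or.inl e, h1, h3⟩
      rcases h2 with ⟨x, hx, y, hy, e, h1, h3⟩ | ⟨x, hx, h2⟩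
      · exact ⟨x, hx, y, hy, Or.inl e, h1, h3⟩
      rw [mNx] at hy
      rw [mNy] at hx
      exact ⟨x, hx.1, y, hy.1, Or.inr ⟨hx.2, hy.2⟩, h2, h1⟩
  set Z := Nx ∪ Ny with hZ
  set J : Set (V →₀ ℕ) := {a | ∃ x ∈ X, ∃ y ∈ Y, x ∉ Z ∧ y ∉ Z ∧ E x y ∧ 0 < a x ∧ 0 < a y} with hJ
  have hJu : IsUpperSet J := by
    rintro a b hab ⟨x, hx, y, hy, h1, h2, h3, h4, h5⟩
    exact ⟨x, hx, y, hy, h1, h2, h3, h4.trans_le (hab x), h5.trans_le (hab y)⟩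
  have hJc : ∀ z ∈ Z, ∀ a : V →₀ ℕ, a + (single z 1 : V →₀ ℕ) ∈ J → a ∈ J := by
    rintro z hz a ⟨x, hx, y, hy, h1, h2, h3, h4, h5⟩
    exact ⟨x, hx, y, hy, h1, h2, h3, pos_add_single h4 (fun h => h1 (h ▸ hz)), pos_add_single h5 (fun h => h2 (h ▸ hz))⟩
  have hy0Z : y0 ∈ Z := Finset.mem_union_left _ ((mNx y0).2 ⟨hy0, he⟩)
  have hx0Z : x0 ∈ Z := Finset.mem_union_right _ ((mNy x0).2 ⟨hx0, he⟩)
  have hne : x0 ≠ y0 := fun h => dXY x0 hx0 (h ▸ hy0)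
  set m : V →₀ ℕ := (single x0 1 : V →₀ ℕ) + (single y0 1 : V →₀ ℕ) with hm
  have hmdeg : m.degree = 2 := by
    rw [hm, map_add, Finsupp.degree_single, Finsupp.degree_single]
  have hmle : ∀ a : V →₀ ℕ, m ≤ a ↔ 0 < a x0 ∧ 0 < a y0 := by
    intro a
    constructor
    · intro h
      have h1 := h x0
      have h2 := h y0
      rw [hm, Finsupp.add_apply, Finsupp.single_eq_same] at h1
      rw [hm, Finsupp.add_apply, Finsupp.single_eq_same] at h2
      omega
    · rintro ⟨h1, h2⟩ v
      rw [hm, Finsupp.add_apply]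
      by_cases hv1 : v = x0
      · subst hv1
        rw [Finsupp.single_eq_same, Finsupp.single_eq_of_ne hne]; omega
      · by_cases hv2 : v = y0
        · subst hv2
          rw [Finsupp.single_eq_same, Finsupp.single_eq_of_ne hv1]; omega
        · rw [Finsupp.single_eq_of_ne hv1, Finsupp.single_eq_of_ne hv2]; omega
  set Z2 := (Z.erase x0).erase y0 with hZ2
  have e1 : BSym X Y E 1 ∪ vs Z2 = (J ∪ Set.Ici m) ∪ vs Z2 := by
    ext a
    rw [BSym_one]
    constructor
    · rintro (⟨x, hx, y, hy, e, h1, h2⟩ | h)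
      · by_cases hxZ2 : x ∈ Z2
        · exact Or.inr ⟨x, hxZ2, h1⟩
        by_cases hyZ2 : y ∈ Z2
        · exact Or.inr ⟨y, hyZ2, h2⟩
        left
        have hxy0 : x ≠ y0 := fun h => dXY x hx (h ▸ hy0)
        have hyx0 : y ≠ x0 := fun h => dXY x0 hx0 (h ▸ hy)
        by_cases hxx : x = x0
        · have hyZ : y ∈ Z := Finset.mem_union_left _ ((mNx y).2 ⟨hy, hxx ▸ e⟩)
          have hyy : y = y0 := by
            by_contra hh
            exact hyZ2 (Finset.mem_erase.2 ⟨hh, Finset.mem_erase.2 ⟨hyx0, hyZ⟩⟩)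
          right
          show m ≤ a
          rw [hmle]
          exact ⟨hxx ▸ h1, hyy ▸ h2⟩
        · have hxZ : x ∉ Z := fun hh => hxZ2 (Finset.mem_erase.2 ⟨hxy0, Finset.mem_erase.2 ⟨hxx, hh⟩⟩)
          have hyy : y ≠ y0 := by
            rintro rfl
            exact hxZ (Finset.mem_union_right _ ((mNy x).2 ⟨hx, e⟩))
          have hyZ : y ∉ Z := fun hh => hyZ2 (Finset.mem_erase.2 ⟨hyy, Finset.mem_erase.2 ⟨hyx0, hh⟩⟩)
          exact Or.inl ⟨x, hx, y, hy, hxZ, hyZ, e, h1, h2⟩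
      · exact Or.inr h
    · rintro ((⟨x, hx, y, hy, -, -, e, h1, h2⟩ | h) | h)
      · exact Or.inl ⟨x, hx, y, hy, e, h1, h2⟩
      · have := (hmle a).1 h
        exact Or.inl ⟨x0, hx0, y0, hy0, he, this.1, this.2⟩
      · exact Or.inr h
  have e2 : (BSym X Y E 1 ∪ vs Nx) ∪ (BSym X Y E 1 ∪ vs Ny) = J ∪ vs Z := by
    ext a
    rw [BSym_one]
    constructor
    · have key : (∃ x ∈ X, ∃ y ∈ Y, E x y ∧ 0 < a x ∧ 0 < a y) → a ∈ J ∪ vs Z := by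
        rintro ⟨x, hx, y, hy, e, h1, h2⟩
        by_cases hxZ : x ∈ Z
        · exact Or.inr ⟨x, hxZ, h1⟩
        by_cases hyZ : y ∈ Z
        · exact Or.inr ⟨y, hyZ, h2⟩
        exact Or.inl ⟨x, hx, y, hy, hxZ, hyZ, e, h1, h2⟩
      rintro ((h | ⟨v, hv, h⟩) | (h | ⟨v, hv, h⟩))
      · exact key h
      · exact Or.inr ⟨v, Finset.mem_union_left _ hv, h⟩
      · exact key h
      · exact Or.inr ⟨v, Finset.mem_union_right _ hv, h⟩
    · rintro (⟨x, hx, y, hy, -, -, e, h1, h2⟩ | ⟨v, hv, h⟩)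
      · exact Or.inl (Or.inl ⟨x, hx, y, hy, e, h1, h2⟩)
      · rcases Finset.mem_union.1 hv with hv | hv
        · exact Or.inl (Or.inr ⟨v, hv, h⟩)
        · exact Or.inr (Or.inr ⟨v, hv, h⟩)
  rw [e0]
  apply T2 (hU.union (vs_upper _)) (hU.union (vs_upper _)) (T3s _ h) (T3s _ h)
  rw [e2]
  apply T3s
  have h1 : KV K (J ∪ Set.Ici m) d := by
    apply T5s (hJu.union (isUpperSet_Ici m)) Z2
    · intro z hz a hza
      rw [hZ2, Finset.mem_erase, Finset.mem_erase] at hz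
      rcases hza with hza | hza
      · exact Or.inl (hJc z hz.2.2 a hza)
      · right
        have := (hmle _).1 hza
        exact (hmle a).2 ⟨pos_add_single this.1 (Ne.symm hz.2.1), pos_add_single this.2 (Ne.symm hz.1)⟩
    · rw [← e1]
      exact T3s _ h
  have := T4 (x := x0) hJu (m := m) (by rw [hm]; exact le_self_add) (by
    intro a ha
    rw [hm, ← add_assoc] at ha
    exact hJc x0 hx0Z _ (hJc y0 hy0Z _ ha)) h1
  rw [hmdeg] at this
  convert this using 1
  push_cast; ring

lemma exists_pair {X Y : Finset V} (hXY : Disjoint X Y) {E : V → V → Prop} {m : V →₀ ℕ} {k : ℕ}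
    (hm : m ∈ BSym X Y E k) (hX : ∑ v ∈ X, m v = k) {x0 : V} (hx0 : x0 ∈ X) (h0 : 0 < m x0) :
    ∃ y ∈ Y, E x0 y ∧ 0 < m y ∧ ∀ A B, cov X Y E A B → x0 ∈ A → y ∈ B → k + 1 ≤ ∑ v ∈ A, m v + ∑ v ∈ B, m v := by
  classical
  by_contra hcon
  push Not at hcon
  obtain ⟨B, A, ⟨hAB, hxA⟩, hmax⟩ := exists_top (X := Y) (Y := X) (fun B A => tgt X Y E m k A B ∧ x0 ∈ A)
    (fun B A h => ⟨h.1.1.2.1, h.1.1.1⟩)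
    ⟨∅, X, ⟨cov_X X Y E, by simpa using hX⟩, hx0⟩
    (fun A B A' B' h h' => ⟨(tgt_union hm h.1 h'.1).2, Finset.mem_inter.2 ⟨h.2, h'.2⟩⟩)
  set N := Y.filter (fun y => E x0 y) with hN
  have hc : cov X Y E (A.erase x0) (B ∪ N) := by
    refine ⟨(Finset.erase_subset _ _).trans hAB.1.1, Finset.union_subset hAB.1.2.1 (Finset.filter_subset _ _), ?_⟩
    intro x hx y hy e
    by_cases hxx : x = x0
    · right
      exact Finset.mem_union_right _ (Finset.mem_filter.2 ⟨hy, hxx ▸ e⟩)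
    · rcases hAB.1.2.2 x hx y hy e with h | h
      · exact Or.inl (Finset.mem_erase.2 ⟨hxx, h⟩)
      · exact Or.inr (Finset.mem_union_left _ h)
  have h1 := hm _ _ hc
  have h2 := Finset.add_sum_erase A (fun v => m v) hxA
  have h3 : ∑ v ∈ B, m v = ∑ v ∈ B ∪ N, m v := by
    apply Finset.sum_subset Finset.subset_union_left
    intro y hy hyB
    by_contra hne
    have hyN : y ∈ N := (Finset.mem_union.1 hy).resolve_left hyB
    rw [hN, Finset.mem_filter] at hyN
    obtain ⟨A1, B1, hc1, hxA1, hyB1, hlt⟩ := hcon y hyN.1 hyN.2 (Nat.pos_of_ne_zero hne)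
    have := hm _ _ hc1
    exact hyB ((hmax B1 A1 ⟨⟨hc1, by omega⟩, hxA1⟩).1 hyB1)
  have h4 := hAB.2
  omega

lemma colon_eq {X Y : Finset V} (hXY : Disjoint X Y) {E : V → V → Prop} {m0 : V →₀ ℕ} {k : ℕ} {x0 y0 : V}
    (hx0 : x0 ∈ X) (hy0 : y0 ∈ Y) (he : E x0 y0)
    (hnt : ∀ A B, cov X Y E A B → x0 ∈ A → y0 ∈ B → k + 1 ≤ ∑ v ∈ A, m0 v + ∑ v ∈ B, m0 v + 2) :
    {a : V →₀ ℕ | a + (m0 + (single y0 1 : V →₀ ℕ) + (single x0 1 : V →₀ ℕ)) ∈ BSym X Y E (k + 1)} =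
      {a | a + m0 ∈ BSym X Y (Ec E x0 y0) k} := by
  classical
  ext a
  have dXY : ∀ v, v ∈ X → v ∈ Y → False := fun v h1 h2 => Finset.disjoint_left.1 hXY h1 h2
  have val : ∀ A B, A ⊆ X → B ⊆ Y → ∑ v ∈ A, (a + (m0 + (single y0 1 : V →₀ ℕ) + (single x0 1 : V →₀ ℕ))) v +
      ∑ v ∈ B, (a + (m0 + (single y0 1 : V →₀ ℕ) + (single x0 1 : V →₀ ℕ))) v =
      (∑ v ∈ A, (a + m0) v + ∑ v ∈ B, (a + m0) v) + ((if x0 ∈ A then 1 else 0) + (if y0 ∈ B then 1 else 0)) := by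
    intro A B hA hB
    rw [← add_assoc, ← add_assoc, sum_add_single, sum_add_single, sum_add_single, sum_add_single]
    rw [if_neg (fun h => dXY y0 (hA h) hy0 : y0 ∉ A), if_neg (fun h => dXY x0 hx0 (hB h) : x0 ∉ B)]
    omega
  constructor
  · intro h A B hc
    have hcE : cov X Y E A B := ⟨hc.1, hc.2.1, fun x hx y hy e => hc.2.2 x hx y hy (Or.inl e)⟩
    have h1 := h A B hcE
    rw [val A B hc.1 hc.2.1] at h1
    by_cases hxA : x0 ∈ A
    · by_cases hyB : y0 ∈ B
      · by_cases hN : ∀ x ∈ X, E x y0 → x ∈ A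
        · have hc2 : cov X Y E A (B.erase y0) := by
            refine ⟨hc.1, (Finset.erase_subset _ _).trans hc.2.1, ?_⟩
            intro x hx y hy e
            by_cases hyy : y = y0
            · exact Or.inl (hN x hx (hyy ▸ e))
            · exact (hcE.2.2 x hx y hy e).imp id (fun h => Finset.mem_erase.2 ⟨hyy, h⟩)
          have h2 := h _ _ hc2
          rw [val _ _ hc2.1 hc2.2.1, if_pos hxA, if_neg (Finset.notMem_erase _ _)] at h2
          have := Finset.sum_le_sum_of_subset (f := fun v => (a + m0) v) (Finset.erase_subset y0 B)
          omega
        · push Not at hN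
          obtain ⟨x1, hx1, e1, hx1A⟩ := hN
          have hc2 : cov X Y E (A.erase x0) B := by
            refine ⟨(Finset.erase_subset _ _).trans hc.1, hc.2.1, ?_⟩
            intro x hx y hy e
            by_cases hxx : x = x0
            · exact Or.inr ((hc.2.2 x1 hx1 y hy (Or.inr ⟨e1, hxx ▸ e⟩)).resolve_left hx1A)
            · exact (hcE.2.2 x hx y hy e).imp (fun h => Finset.mem_erase.2 ⟨hxx, h⟩) id
          have h2 := h _ _ hc2
          rw [val _ _ hc2.1 hc2.2.1, if_pos hyB, if_neg (Finset.notMem_erase _ _)] at h2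
          have := Finset.sum_le_sum_of_subset (f := fun v => (a + m0) v) (Finset.erase_subset x0 A)
          omega
      · rw [if_pos hxA, if_neg hyB] at h1
        omega
    · rw [if_neg hxA] at h1
      split_ifs at h1 <;> omega
  · intro h A B hc
    rw [val A B hc.1 hc.2.1]
    by_cases hc' : cov X Y (Ec E x0 y0) A B
    · have h1 := h A B hc'
      rcases hc.2.2 x0 hx0 y0 hy0 he with h2 | h2
      · rw [if_pos h2]; split_ifs <;> omega
      · rw [if_pos h2]; split_ifs <;> omega
    · have : ∃ x ∈ X, ∃ y ∈ Y, Ec E x0 y0 x y ∧ x ∉ A ∧ y ∉ B := by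
        by_contra hn
        push Not at hn
        apply hc'
        refine ⟨hc.1, hc.2.1, fun x hx y hy e => ?_⟩
        by_contra h3
        push Not at h3
        exact h3.2 (hn x hx y hy e h3.1)
      obtain ⟨x, hx, y, hy, e, hxA, hyB⟩ := this
      rcases e with e | ⟨e1, e2⟩
      · exact absurd (hc.2.2 x hx y hy e) (by tauto)
      have hyB0 : y0 ∈ B := (hc.2.2 x hx y0 hy0 e1).resolve_left hxA
      have hxA0 : x0 ∈ A := (hc.2.2 x0 hx0 y hy e2).resolve_right hyB
      have h1 := hnt A B hc hxA0 hyB0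
      rw [if_pos hxA0, if_pos hyB0]
      have s1 : ∑ v ∈ A, m0 v ≤ ∑ v ∈ A, (a + m0) v := Finset.sum_le_sum fun v _ => by rw [Finsupp.add_apply]; omega
      have s2 : ∑ v ∈ B, m0 v ≤ ∑ v ∈ B, (a + m0) v := Finset.sum_le_sum fun v _ => by rw [Finsupp.add_apply]; omega
      omega

lemma colon_lem {X Y : Finset V} (hXY : Disjoint X Y) {d : ℤ} : ∀ (k : ℕ) (E : V → V → Prop) (m : V →₀ ℕ),
    KV K (BSym X Y E 1) d → m ∈ BSym X Y E k → ∑ v ∈ X, m v = k → ∑ v ∈ Y, m v = k →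
    KV K {a | a + m ∈ BSym X Y E (k + 1)} d := by
  intro k
  induction k with
  | zero =>
    intro E m h hm hX hY
    convert h using 1
    ext a
    have : ∀ A B, cov X Y E A B → ∑ v ∈ A, (a + m) v + ∑ v ∈ B, (a + m) v = ∑ v ∈ A, a v + ∑ v ∈ B, a v := by
      intro A B hc
      congr 1
      · apply Finset.sum_congr rfl
        intro v hv
        rw [Finsupp.add_apply, Finset.sum_eq_zero_iff.1 hX v (hc.1 hv), add_zero]
      · apply Finset.sum_congr rfl
        intro v hv
        rw [Finsupp.add_apply, Finset.sum_eq_zero_iff.1 hY v (hc.2.1 hv), add_zero]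
    constructor
    · intro h A B hc
      rw [← this A B hc]; exact h A B hc
    · intro h A B hc
      rw [this A B hc]; exact h A B hc
  | succ j ih =>
    intro E m h hm hX hY
    have : ∃ x ∈ X, 0 < m x := by
      by_contra hn
      push Not at hn
      rw [Finset.sum_eq_zero (fun x hx => by have := hn x hx; omega)] at hX
      omega
    obtain ⟨x0, hx0, hpx⟩ := this
    obtain ⟨y0, hy0, he, hpy, hnt⟩ := exists_pair hXY hm hX hx0 hpx
    have dXY : ∀ v, v ∈ X → v ∈ Y → False := fun v h1 h2 => Finset.disjoint_left.1 hXY h1 h2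
    obtain ⟨m1, rfl⟩ := sub_single hpx
    have hpy' := pos_add_single hpy (fun h => dXY x0 hx0 (h ▸ hy0))
    obtain ⟨m0, rfl⟩ := sub_single hpy'
    have hy0X : y0 ∉ X := fun h => dXY _ h hy0
    have hx0Y : x0 ∉ Y := fun h => dXY _ hx0 h
    have val : ∀ A B, A ⊆ X → B ⊆ Y → ∑ v ∈ A, (m0 + (single y0 1 : V →₀ ℕ) + (single x0 1 : V →₀ ℕ)) v +
      ∑ v ∈ B, (m0 + (single y0 1 : V →₀ ℕ) + (single x0 1 : V →₀ ℕ)) v =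
      (∑ v ∈ A, m0 v + ∑ v ∈ B, m0 v) + ((if x0 ∈ A then 1 else 0) + (if y0 ∈ B then 1 else 0)) := by
      intro A B hA hB
      rw [sum_add_single, sum_add_single, sum_add_single, sum_add_single]
      rw [if_neg (fun h => dXY y0 (hA h) hy0 : y0 ∉ A), if_neg (fun h => dXY x0 hx0 (hB h) : x0 ∉ B)]
      omega
    rw [colon_eq hXY hx0 hy0 he (by
      intro A B hc h1 h2
      have := hnt A B hc h1 h2
      rw [val A B hc.1 hc.2.1, if_pos h1, if_pos h2] at this
      omega)]
    apply ih (Ec E x0 y0) m0 (KV_Ec hXY hx0 hy0 he h)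
    · intro A B hc
      have hcE : cov X Y E A B := ⟨hc.1, hc.2.1, fun x hx y hy e => hc.2.2 x hx y hy (Or.inl e)⟩
      have h1 := hm A B hcE
      rw [val A B hc.1 hc.2.1] at h1
      by_cases h2 : x0 ∈ A
      · by_cases h3 : y0 ∈ B
        · have := hnt A B hcE h2 h3
          rw [val A B hc.1 hc.2.1, if_pos h2, if_pos h3] at this
          omega
        · rw [if_pos h2, if_neg h3] at h1
          omega
      · rw [if_neg h2] at h1
        split_ifs at h1 <;> omega
    · rw [sum_add_single, sum_add_single, if_pos hx0, if_neg hy0X] at hX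
      omega
    · rw [sum_add_single, sum_add_single, if_pos hy0, if_neg hx0Y] at hY
      omega
end KZ
end

noncomputable section
set_option linter.all false
namespace KZ
open MvPolynomial Finsupp
variable {V : Type*} {K : Type*} [Field K] [LinearOrder V]

lemma MG_swap (X Y : Finset V) (E : V → V → Prop) (k : ℕ) :
    MG X Y E k = MG Y X (fun y x => E x y) k := by
  ext m
  unfold MG
  rw [Set.mem_setOf_eq, Set.mem_setOf_eq, BSym_swap, Finset.union_comm]
  tauto

lemma MG_exch_aux {X Y : Finset V} (hXY : Disjoint X Y) {E : V → V → Prop} {m m' : V →₀ ℕ} {k : ℕ}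
    (hm : m ∈ MG X Y E k) (hm' : m' ∈ MG X Y E k) {z : V} (hz : z ∈ X) (hlt : m z < m' z) :
    (∃ n ∈ MG X Y E k, ∃ w, n + (single w 1 : V →₀ ℕ) = m + (single z 1 : V →₀ ℕ) ∧ m' w < m w) ∨
    (∃ y, y ≠ z ∧ m y < m' y ∧ m + (single z 1 : V →₀ ℕ) + (single y 1 : V →₀ ℕ) ∈ BSym X Y E (k + 1)) := by
  have dXY : ∀ v, v ∈ X → v ∈ Y → False := fun v h1 h2 => Finset.disjoint_left.1 hXY h1 h2
  rcases exch hXY hm.1 hm'.1 hm.2.2.1 hm.2.2.2 hm'.2.2.1 hm'.2.2.2 hz hlt with ⟨w, hw, h1, h2⟩ | ⟨y, hy, h1, h2⟩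
  · left
    obtain ⟨n0, rfl⟩ := sub_single (m := m) (x := w) (by omega)
    have hn := h2 (n0 + (single z 1 : V →₀ ℕ)) (by rw [add_right_comm])
    have hwY : w ∉ Y := fun h => dXY w hw h
    have hzY : z ∉ Y := fun h => dXY z hz h
    have s1 := hm.2.2.1
    have s2 := hm.2.2.2
    rw [sum_add_single] at s1 s2
    rw [if_pos hw] at s1
    rw [if_neg hwY] at s2
    refine ⟨n0 + (single z 1 : V →₀ ℕ), ⟨hn, ?_, ?_, ?_⟩, w, by rw [add_right_comm], h1⟩
    · intro v hv
      by_cases hvz : v = z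
      · exact Finset.mem_union_left _ (hvz ▸ hz)
      · apply hm.2.1
        rw [Finsupp.mem_support_iff] at hv ⊢
        rw [Finsupp.add_apply, Finsupp.single_eq_of_ne hvz] at hv
        rw [Finsupp.add_apply]; omega
    · rw [sum_add_single, if_pos hz]; exact s1
    · rw [sum_add_single, if_neg hzY]; exact s2
  · right
    exact ⟨y, fun h => dXY y (h ▸ hz) hy, h1, h2⟩

lemma MG_exch {X Y : Finset V} (hXY : Disjoint X Y) {E : V → V → Prop} {m m' : V →₀ ℕ} {k : ℕ}
    (hm : m ∈ MG X Y E k) (hm' : m' ∈ MG X Y E k) {z : V} (hlt : m z < m' z) :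
    (∃ n ∈ MG X Y E k, ∃ w, n + (single w 1 : V →₀ ℕ) = m + (single z 1 : V →₀ ℕ) ∧ m' w < m w) ∨
    (∃ y, y ≠ z ∧ m y < m' y ∧ m + (single z 1 : V →₀ ℕ) + (single y 1 : V →₀ ℕ) ∈ BSym X Y E (k + 1)) := by
  have hz : z ∈ X ∪ Y := hm'.2.1 (Finsupp.mem_support_iff.2 (by omega))
  rcases Finset.mem_union.1 hz with hz | hz
  · exact MG_exch_aux hXY hm hm' hz hlt
  · rw [MG_swap] at hm hm' ⊢
    rw [BSym_swap]
    exact MG_exch_aux hXY.symm hm hm' hz hlt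

lemma MG_finite (X Y : Finset V) (E : V → V → Prop) (k : ℕ) : (MG X Y E k).Finite := by
  apply (Finset.finsupp (X ∪ Y) (fun _ => Finset.range (k + 1))).finite_toSet.subset
  intro m hm
  rw [Finset.mem_coe, Finset.mem_finsupp_iff]
  refine ⟨hm.2.1, fun v hv => ?_⟩
  rw [Finset.mem_range]
  rcases Finset.mem_union.1 hv with hv | hv
  · have := Finset.single_le_sum (f := fun v => m v) (fun _ _ => Nat.zero_le _) hv
    have := hm.2.2.1
    omega
  · have := Finset.single_le_sum (f := fun v => m v) (fun _ _ => Nat.zero_le _) hv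
    have := hm.2.2.2
    omega

lemma MG_degree {X Y : Finset V} (hXY : Disjoint X Y) {E : V → V → Prop} {m : V →₀ ℕ} {k : ℕ}
    (hm : m ∈ MG X Y E k) : m.degree = 2 * k := by
  have : m.degree = ∑ v ∈ X ∪ Y, m v := by
    rw [Finsupp.degree_apply]
    exact Finset.sum_subset hm.2.1 (fun v _ h => by simpa using h)
  rw [this, Finset.sum_union hXY, hm.2.2.1, hm.2.2.2]; ring

/-- up-closure of a set -/
def upS (s : Set (V →₀ ℕ)) : Set (V →₀ ℕ) := {a | ∃ m ∈ s, m ≤ a}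

lemma upS_upper (s : Set (V →₀ ℕ)) : IsUpperSet (upS s) := by
  rintro a b hab ⟨m, hm, h⟩
  exact ⟨m, hm, h.trans hab⟩

lemma bip_step {X Y : Finset V} (hXY : Disjoint X Y) {E : V → V → Prop} {d : ℤ} {k : ℕ}
    (h1 : KV K (BSym X Y E 1) d) (hk : KV K (BSym X Y E k) (d + 2 * k)) :
    ∀ (n : ℕ) (s : Finset (V →₀ ℕ)), (∀ m ∈ s, m ∈ MG X Y E k) →
      (∀ m ∈ s, ∀ m' ∈ MG X Y E k, toLex m < toLex m' → m' ∈ s) →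
      ((MG_finite X Y E k).toFinset \ s).card = n →
      KV K (BSym X Y E (k + 1) ∪ upS (s : Set (V →₀ ℕ))) (d + 2 * k) := by
  classical
  intro n
  induction n with
  | zero =>
    intro s hs hc hn
    convert hk using 1
    have hsub := Finset.sdiff_eq_empty_iff_subset.1 (Finset.card_eq_zero.1 hn)
    ext a
    constructor
    · rintro (h | ⟨m, hm, hma⟩)
      · intro A B hAB
        exact (Nat.le_succ k).trans (h A B hAB)
      · exact BSym_upper X Y E k hma (hs m hm).1
    · intro h
      obtain ⟨m, hm, hma⟩ := exists_MG hXY h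
      exact Or.inr ⟨m, hsub ((Set.Finite.mem_toFinset _).2 hm), hma⟩
  | succ n ih =>
    intro s hs hc hn
    have hne : ((MG_finite X Y E k).toFinset \ s).Nonempty := Finset.card_pos.1 (by omega)
    obtain ⟨m, hmm, hmax⟩ := Finset.exists_max_image _ (fun m : V →₀ ℕ => toLex m) hne
    have hms := (Finset.mem_sdiff.1 hmm).2
    have hm : m ∈ MG X Y E k := (Set.Finite.mem_toFinset _).1 (Finset.mem_sdiff.1 hmm).1
    have hgt : ∀ m' ∈ MG X Y E k, toLex m < toLex m' → m' ∈ s := by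
      intro m' hm' hlt
      by_contra hns
      exact absurd (hmax m' (Finset.mem_sdiff.2 ⟨(Set.Finite.mem_toFinset _).2 hm', hns⟩)) (not_le.2 hlt)
    have IH := ih (insert m s) (by
      intro m' hm'
      rcases Finset.mem_insert.1 hm' with rfl | h
      · exact hm
      · exact hs m' h) (by
      intro m1 hm1 m' hm' hlt
      rcases Finset.mem_insert.1 hm1 with rfl | h
      · exact Finset.mem_insert_of_mem (hgt m' hm' hlt)
      · exact Finset.mem_insert_of_mem (hc m1 h m' hm' hlt)) (by
      have : (MG_finite X Y E k).toFinset \ insert m s = ((MG_finite X Y E k).toFinset \ s).erase m := by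
        ext v
        simp only [Finset.mem_sdiff, Finset.mem_insert, Finset.mem_erase]
        tauto
      rw [this, Finset.card_erase_of_mem hmm, hn]; rfl)
    have hU : IsUpperSet (BSym X Y E (k + 1) ∪ upS (s : Set (V →₀ ℕ))) := (BSym_upper _ _ _ _).union (upS_upper _)
    refine T1 hU (m := m) ?_ ?_
    · set Z := (X ∪ Y).filter (fun z => m + (single z 1 : V →₀ ℕ) ∈ BSym X Y E (k + 1) ∪ upS (s : Set (V →₀ ℕ))) with hZ
      have : {a | a + m ∈ BSym X Y E (k + 1) ∪ upS (s : Set (V →₀ ℕ))} = {a | a + m ∈ BSym X Y E (k + 1)} ∪ vs Z := by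
        ext a
        constructor
        · rintro (h | ⟨m', hm's, hle⟩)
          · exact Or.inl h
          have hm' := hs m' hm's
          have hlt : toLex m < toLex m' := by
            rcases lt_trichotomy (toLex m) (toLex m') with h | h | h
            · exact h
            · exact absurd (toLex.injective h ▸ hm's) hms
            · exact absurd (hc m' hm's m hm h) hms
          obtain ⟨z, hz1, hz2⟩ := Finsupp.Lex.lt_iff.1 hlt
          have hz1 : ∀ j < z, m j = m' j := hz1
          have hz2 : m z < m' z := hz2
          have hposa : ∀ v, m v < m' v → 0 < a v := by
            intro v hv
            have := hle v
            rw [Finsupp.add_apply] at this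
            omega
          rcases MG_exch hXY hm hm' hz2 with ⟨n1, hn1, w, hw1, hw2⟩ | ⟨y, hyz, hy1, hy2⟩
          · right
            have hzw : z < w := by
              rcases lt_trichotomy z w with h | h | h
              · exact h
              · subst h; omega
              · have := hz1 w h; omega
            have hval : ∀ v, n1 v + (single w 1 : V →₀ ℕ) v = m v + (single z 1 : V →₀ ℕ) v := fun v => by
              rw [← Finsupp.add_apply, hw1, Finsupp.add_apply]
            have hn1s : n1 ∈ s := by
              apply hgt n1 hn1
              rw [Finsupp.Lex.lt_iff]
              refine ⟨z, ?_, ?_⟩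
              · intro j hj
                have := hval j
                rw [Finsupp.single_eq_of_ne (hj.trans hzw).ne, Finsupp.single_eq_of_ne hj.ne] at this
                show m j = n1 j
                omega
              · have := hval z
                rw [Finsupp.single_eq_of_ne hzw.ne, Finsupp.single_eq_same] at this
                show m z < n1 z
                omega
            refine ⟨z, Finset.mem_filter.2 ⟨hm'.2.1 (Finsupp.mem_support_iff.2 (by omega)), Or.inr ⟨n1, hn1s, ?_⟩⟩, hposa z hz2⟩
            rw [← hw1]; exact le_self_add
          · left
            refine BSym_upper X Y E (k + 1) ?_ hy2
            intro v
            rw [Finsupp.add_apply, Finsupp.add_apply, Finsupp.add_apply]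
            have p1 := hposa z hz2
            have p2 := hposa y hy1
            by_cases v1 : v = z
            · subst v1
              rw [Finsupp.single_eq_same, Finsupp.single_eq_of_ne (Ne.symm hyz)]; omega
            · by_cases v2 : v = y
              · subst v2
                rw [Finsupp.single_eq_same, Finsupp.single_eq_of_ne hyz]; omega
              · rw [Finsupp.single_eq_of_ne v1, Finsupp.single_eq_of_ne v2]; omega
        · rintro (h | ⟨z, hz, hpos⟩)
          · exact Or.inl h
          · refine hU ?_ (Finset.mem_filter.1 hz).2
            rw [add_comm a m]
            refine add_le_add le_rfl ?_
            rw [Finsupp.single_le_iff]; omega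
      rw [this, MG_degree hXY hm]
      apply T3s
      have := colon_lem (K := K) hXY k E m h1 hm.1 hm.2.2.1 hm.2.2.2
      convert this using 1
      push_cast; ring
    · convert IH using 1
      ext a
      constructor
      · rintro ((h | ⟨m1, h1, h2⟩) | h)
        · exact Or.inl h
        · exact Or.inr ⟨m1, Finset.mem_insert_of_mem h1, h2⟩
        · exact Or.inr ⟨m, Finset.mem_insert_self _ _, h⟩
      · rintro (h | ⟨m1, h1, h2⟩)
        · exact Or.inl (Or.inl h)
        · rcases Finset.mem_insert.1 h1 with rfl | h1
          · exact Or.inr h2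
          · exact Or.inl (Or.inr ⟨m1, h1, h2⟩)

theorem bip {X Y : Finset V} (hXY : Disjoint X Y) {E : V → V → Prop} {d : ℤ}
    (h1 : KV K (BSym X Y E 1) d) : ∀ k : ℕ, KV K (BSym X Y E (k + 1)) (d + 2 * k) := by
  intro k
  induction k with
  | zero => simpa using h1
  | succ k ih =>
    have := bip_step hXY h1 (k := k + 1) (ih.mono (by push_cast; omega)) _ ∅ (by simp) (by simp) rfl
    convert this using 1
    ext a
    simp [upS]
end KZ
end

noncomputable section
set_option linter.all false
namespace KZ
open MvPolynomial Finsupp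
variable {V : Type*} {K : Type*} [Field K] [LinearOrder V]

/-- vertex covers of the induced graph -/
def gcov (G : SimpleGraph V) (W C : Finset V) : Prop :=
  C ⊆ W ∧ ∀ u ∈ W, ∀ v ∈ W, G.Adj u v → u ∈ C ∨ v ∈ C

/-- exponents of symbolic powers -/
def Sym (G : SimpleGraph V) (W : Finset V) (r : ℕ) : Set (V →₀ ℕ) :=
  {a | ∀ C, gcov G W C → r ≤ ∑ v ∈ C, a v}

/-- exponents of the edge ideal -/
def UE (G : SimpleGraph V) (W : Finset V) : Set (V →₀ ℕ) :=
  {a | ∃ u ∈ W, ∃ v ∈ W, G.Adj u v ∧ 0 < a u ∧ 0 < a v}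

lemma Sym_upper (G : SimpleGraph V) (W : Finset V) (r : ℕ) : IsUpperSet (Sym G W r) := by
  intro a b hab ha C hC
  exact (ha C hC).trans (Finset.sum_le_sum fun v _ => hab v)

lemma UE_upper (G : SimpleGraph V) (W : Finset V) : IsUpperSet (UE G W) := by
  rintro a b hab ⟨u, hu, v, hv, e, h1, h2⟩
  exact ⟨u, hu, v, hv, e, h1.trans_le (hab u), h2.trans_le (hab v)⟩

lemma Sym_one (G : SimpleGraph V) (W : Finset V) : Sym G W 1 = UE G W := by
  ext a
  constructor
  · intro h
    by_contra hn
    have := h (W.filter (fun v => a v = 0)) ⟨Finset.filter_subset _ _, by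
      intro u hu v hv e
      by_contra h2
      rw [Finset.mem_filter, Finset.mem_filter] at h2
      push Not at h2
      exact hn ⟨u, hu, v, hv, e, Nat.pos_of_ne_zero (h2.1 hu), Nat.pos_of_ne_zero (h2.2 hv)⟩⟩
    rw [Finset.sum_eq_zero (fun v hv => (Finset.mem_filter.1 hv).2)] at this
    omega
  · rintro ⟨u, hu, v, hv, e, h1, h2⟩ C hC
    rcases hC.2 u hu v hv e with h | h
    · have := Finset.single_le_sum (f := fun v => a v) (fun _ _ => Nat.zero_le _) h
      omega
    · have := Finset.single_le_sum (f := fun v => a v) (fun _ _ => Nat.zero_le _) h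
      omega

lemma UE_restrict {G : SimpleGraph V} {W W' : Finset V} (hW : W' ⊆ W) {d : ℤ} (h : KV K (UE G W) d) :
    KV K (UE G W') d := by
  apply T5s (UE_upper G W') (W \ W')
  · rintro x hx a ⟨u, hu, v, hv, e, h1, h2⟩
    have hxW := (Finset.mem_sdiff.1 hx).2
    exact ⟨u, hu, v, hv, e, pos_add_single h1 (fun h => hxW (h ▸ hu)), pos_add_single h2 (fun h => hxW (h ▸ hv))⟩
  · have : UE G W' ∪ vs (W \ W') = UE G W ∪ vs (W \ W') := by
      ext a
      constructor
      · rintro (⟨u, hu, v, hv, h⟩ | h)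
        · exact Or.inl ⟨u, hW hu, v, hW hv, h⟩
        · exact Or.inr h
      · rintro (⟨u, hu, v, hv, e, h1, h2⟩ | h)
        · by_cases hu' : u ∈ W'
          · by_cases hv' : v ∈ W'
            · exact Or.inl ⟨u, hu', v, hv', e, h1, h2⟩
            · exact Or.inr ⟨v, Finset.mem_sdiff.2 ⟨hv, hv'⟩, h2⟩
          · exact Or.inr ⟨u, Finset.mem_sdiff.2 ⟨hu, hu'⟩, h1⟩
        · exact Or.inr h
    rw [this]
    exact T3s _ h

lemma Sym_erase {G : SimpleGraph V} {W : Finset V} {r : ℕ} {v : V} (hv : v ∈ W) {a : V →₀ ℕ} (ha : a v = 0) :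
    a ∈ Sym G W r ↔ a ∈ Sym G (W.erase v) r := by
  constructor
  · intro h C hC
    have h1 := h (insert v C) ⟨Finset.insert_subset hv (hC.1.trans (Finset.erase_subset _ _)), by
      intro x hx y hy e
      by_cases hxv : x = v
      · exact Or.inl (hxv ▸ Finset.mem_insert_self _ _)
      by_cases hyv : y = v
      · exact Or.inr (hyv ▸ Finset.mem_insert_self _ _)
      exact (hC.2 x (Finset.mem_erase.2 ⟨hxv, hx⟩) y (Finset.mem_erase.2 ⟨hyv, hy⟩) e).imp
        Finset.mem_insert_of_mem Finset.mem_insert_of_mem⟩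
    rw [Finset.sum_insert (fun h => (Finset.mem_erase.1 (hC.1 h)).1 rfl), ha, zero_add] at h1
    exact h1
  · intro h C hC
    have h1 := h (C.erase v) ⟨Finset.erase_subset_erase _ hC.1, by
      intro x hx y hy e
      rw [Finset.mem_erase] at hx hy
      exact (hC.2 x hx.2 y hy.2 e).imp (fun h => Finset.mem_erase.2 ⟨hx.1, h⟩) (fun h => Finset.mem_erase.2 ⟨hy.1, h⟩)⟩
    exact h1.trans (Finset.sum_le_sum_of_subset (Finset.erase_subset _ _))

lemma Sym_bip {G : SimpleGraph V} {W : Finset V} (f : V → Bool) (hf : ∀ u ∈ W, ∀ v ∈ W, G.Adj u v → f u ≠ f v) (r : ℕ) :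
    Sym G W r = BSym (W.filter (fun v => f v = true)) (W.filter (fun v => f v = false)) G.Adj r := by
  have hd : Disjoint (W.filter (fun v => f v = true)) (W.filter (fun v => f v = false)) := by
    rw [Finset.disjoint_left]
    intro v h1 h2
    have := (Finset.mem_filter.1 h1).2
    have := (Finset.mem_filter.1 h2).2
    simp_all
  ext a
  constructor
  · intro h A B hc
    have h1 := h (A ∪ B) ⟨Finset.union_subset (hc.1.trans (Finset.filter_subset _ _)) (hc.2.1.trans (Finset.filter_subset _ _)), by
      intro u hu v hv e
      have hne := hf u hu v hv e
      rw [Finset.mem_union, Finset.mem_union]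
      rcases hfu : f u with _ | _ <;> rcases hfv : f v with _ | _
      · exact absurd (hfu.trans hfv.symm) hne
      · have := hc.2.2 v (Finset.mem_filter.2 ⟨hv, hfv⟩) u (Finset.mem_filter.2 ⟨hu, hfu⟩) e.symm
        tauto
      · have := hc.2.2 u (Finset.mem_filter.2 ⟨hu, hfu⟩) v (Finset.mem_filter.2 ⟨hv, hfv⟩) e
        tauto
      · exact absurd (hfu.trans hfv.symm) hne⟩
    rw [Finset.sum_union (Finset.disjoint_of_subset_left hc.1 (Finset.disjoint_of_subset_right hc.2.1 hd))] at h1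
    exact h1
  · intro h C hC
    have h1 := h (C.filter (fun v => f v = true)) (C.filter (fun v => f v = false))
      ⟨Finset.filter_subset_filter _ hC.1, Finset.filter_subset_filter _ hC.1, by
      intro x hx y hy e
      rw [Finset.mem_filter] at hx hy
      exact (hC.2 x hx.1 y hy.1 e).imp (fun h => Finset.mem_filter.2 ⟨h, hx.2⟩) (fun h => Finset.mem_filter.2 ⟨h, hy.2⟩)⟩
    have h2 : C.filter (fun v => f v = false) = C.filter (fun v => ¬ f v = true) := by
      apply Finset.filter_congr
      intro v _
      simp
    rw [h2, Finset.sum_filter_add_sum_filter_not] at h1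
    exact h1

/-- indicator -/
def ind (A : Finset V) : V →₀ ℕ := Finsupp.onFinset A (fun v => if v ∈ A then 1 else 0) (by
  intro v h
  by_contra hn
  exact h (if_neg hn))

lemma ind_apply (A : Finset V) (v : V) : ind A v = if v ∈ A then 1 else 0 := rfl

lemma sum_ind (A C : Finset V) : ∑ v ∈ C, ind A v = (C ∩ A).card := by
  simp only [ind_apply]
  rw [Finset.sum_ite_mem]; simp

lemma ind_insert {A : Finset V} {v : V} (hv : v ∉ A) : ind (insert v A) = (single v 1 : V →₀ ℕ) + ind A := by
  ext u
  rw [Finsupp.add_apply, ind_apply, ind_apply, Finsupp.single_apply]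
  by_cases h : v = u
  · subst h; simp [hv]
  · have h' : u ≠ v := Ne.symm h
    simp [h, h', Finset.mem_insert]

lemma ind_singleton (v : V) : ind {v} = (single v 1 : V →₀ ℕ) := by
  ext u
  rw [ind_apply, Finsupp.single_apply]
  simp [eq_comm]

lemma Sym_colon {G : SimpleGraph V} {W A : Finset V} {t : V} (htA : t ∈ A) (hAW : A ⊆ W)
    (hA : ∀ u ∈ W, G.Adj u t → u ∈ A) (hcl : ∀ u ∈ A, ∀ v ∈ A, u ≠ v → G.Adj u v) (r : ℕ) :
    {a : V →₀ ℕ | a + ind A ∈ Sym G W r} = Sym G W (r - (A.card - 1)) := by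
  have hpos : 0 < A.card := Finset.card_pos.2 ⟨t, htA⟩
  have hsum : ∀ (a : V →₀ ℕ) C, ∑ v ∈ C, (a + ind A) v = ∑ v ∈ C, a v + (C ∩ A).card := by
    intro a C
    simp only [Finsupp.add_apply]
    rw [Finset.sum_add_distrib, sum_ind]
  ext a
  constructor
  · intro h C hC
    by_cases hAC : A ⊆ C
    · have h1 := h (C.erase t) ⟨(Finset.erase_subset _ _).trans hC.1, by
        intro u hu v hv e
        by_cases hut : u = t
        · right
          subst hut
          exact Finset.mem_erase.2 ⟨e.ne', hAC (hA v hv e.symm)⟩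
        by_cases hvt : v = t
        · left
          subst hvt
          exact Finset.mem_erase.2 ⟨hut, hAC (hA u hu e)⟩
        exact (hC.2 u hu v hv e).imp (fun h => Finset.mem_erase.2 ⟨hut, h⟩) (fun h => Finset.mem_erase.2 ⟨hvt, h⟩)⟩
      rw [hsum] at h1
      have h2 : (C.erase t ∩ A).card ≤ (A.erase t).card := Finset.card_le_card (by
        intro v hv
        rw [Finset.mem_inter, Finset.mem_erase] at hv
        exact Finset.mem_erase.2 ⟨hv.1.1, hv.2⟩)
      rw [Finset.card_erase_of_mem htA] at h2
      have h3 := Finset.sum_le_sum_of_subset (f := fun v => a v) (Finset.erase_subset t C)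
      omega
    · obtain ⟨w, hwA, hwC⟩ := Finset.not_subset.1 hAC
      have h1 := h C hC
      rw [hsum] at h1
      have h2 : (C ∩ A).card ≤ (A.erase w).card := Finset.card_le_card (by
        intro v hv
        rw [Finset.mem_inter] at hv
        exact Finset.mem_erase.2 ⟨fun h => hwC (h ▸ hv.1), hv.2⟩)
      rw [Finset.card_erase_of_mem hwA] at h2
      omega
  · intro h C hC
    rw [hsum]
    have h1 := h C hC
    have h2 : A.card - 1 ≤ (C ∩ A).card := by
      by_cases hAC : A ⊆ C
      · rw [Finset.inter_eq_right.2 hAC]; omega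
      · obtain ⟨w, hwA, hwC⟩ := Finset.not_subset.1 hAC
        rw [← Finset.card_erase_of_mem hwA]
        apply Finset.card_le_card
        intro v hv
        rw [Finset.mem_erase] at hv
        exact Finset.mem_inter.2 ⟨(hC.2 v (hAW hv.2) w (hAW hwA) (hcl v hv.2 w hwA hv.1)).resolve_right hwC, hv.2⟩
    omega

/-- the structural dichotomy -/
def Good (G : SimpleGraph V) : Prop := ∀ W : Finset V,
  (∃ f : V → Bool, ∀ u ∈ W, ∀ v ∈ W, G.Adj u v → f u ≠ f v) ∨
  (∃ s ∈ W, ∃ t ∈ W, G.Adj s t ∧ (∀ u ∈ W, G.Adj u s → u ≠ t → G.Adj u t) ∧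
    (∀ u ∈ W, ∀ v ∈ W, G.Adj u t → G.Adj v t → u ≠ v → G.Adj u v))

lemma twin_base {G : SimpleGraph V} {W' : Finset V} {s t : V} (hs : s ∉ W') (ht : t ∈ W') (hst : G.Adj s t)
    (hiso : ∀ u ∈ W', ¬ G.Adj u t) (hns : ∀ u ∈ W', G.Adj u s → u = t) {d : ℤ}
    (h : KV K (UE G (insert s W')) d) : KV K (UE G W') (d - 1) := by
  have hne : s ≠ t := hst.ne
  have e1 : UE G (insert s W') = UE G W' ∪ Set.Ici ((single s 1 : V →₀ ℕ) + (single t 1 : V →₀ ℕ)) := by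
    have hle : ∀ a : V →₀ ℕ, (single s 1 : V →₀ ℕ) + (single t 1 : V →₀ ℕ) ≤ a ↔ 0 < a s ∧ 0 < a t := by
      intro a
      constructor
      · intro h
        have h1 := h s
        have h2 := h t
        rw [Finsupp.add_apply, Finsupp.single_eq_same] at h1
        rw [Finsupp.add_apply, Finsupp.single_eq_same] at h2
        omega
      · rintro ⟨h1, h2⟩ v
        rw [Finsupp.add_apply]
        by_cases hv1 : v = s
        · subst hv1
          rw [Finsupp.single_eq_same, Finsupp.single_eq_of_ne hne]; omega
        · by_cases hv2 : v = t
          · subst hv2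
            rw [Finsupp.single_eq_same, Finsupp.single_eq_of_ne hv1]; omega
          · rw [Finsupp.single_eq_of_ne hv1, Finsupp.single_eq_of_ne hv2]; omega
    ext a
    rw [Set.mem_union, Set.mem_Ici, hle]
    constructor
    · rintro ⟨u, hu, v, hv, e, h1, h2⟩
      rcases Finset.mem_insert.1 hu with hu1 | hu
      · rcases Finset.mem_insert.1 hv with hv1 | hv
        · rw [hu1, hv1] at e; exact absurd e (G.irrefl)
        · have := hns v hv (hu1 ▸ e.symm)
          exact Or.inr ⟨hu1 ▸ h1, this ▸ h2⟩
      · rcases Finset.mem_insert.1 hv with hv1 | hv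
        · have := hns u hu (hv1 ▸ e)
          exact Or.inr ⟨hv1 ▸ h2, this ▸ h1⟩
        · exact Or.inl ⟨u, hu, v, hv, e, h1, h2⟩
    · rintro (⟨u, hu, v, hv, h⟩ | h)
      · exact ⟨u, Finset.mem_insert_of_mem hu, v, Finset.mem_insert_of_mem hv, h⟩
      · exact ⟨s, Finset.mem_insert_self _ _, t, Finset.mem_insert_of_mem ht, hst, h.1, h.2⟩
  rw [e1] at h
  have := T4 (x := s) (UE_upper G W') le_self_add (by
    rintro a ⟨u, hu, v, hv, e, h1, h2⟩
    rw [← add_assoc] at h1 h2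
    have hus : u ≠ s := fun h => hs (h ▸ hu)
    have hvs : v ≠ s := fun h => hs (h ▸ hv)
    have hut : u ≠ t := fun h => hiso v hv (h ▸ e.symm)
    have hvt : v ≠ t := fun h => hiso u hu (h ▸ e)
    exact ⟨u, hu, v, hv, e, pos_add_single (pos_add_single h1 hut) hus, pos_add_single (pos_add_single h2 hvt) hvs⟩) h
  rw [map_add, Finsupp.degree_single, Finsupp.degree_single] at this
  convert this using 1
  push_cast; ring

theorem main_sym {G : SimpleGraph V} (hG : Good G) : ∀ (n : ℕ) (W : Finset V) (r : ℕ), W.card + r ≤ n → 1 ≤ r →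
    ∀ d : ℤ, KV K (UE G W) d → KV K (Sym G W r) (d + 2 * r - 2) := by
  intro n
  induction n with
  | zero => intro W r hn hr; omega
  | succ n ih =>
    intro W r hn hr d hd
    rcases hG W with ⟨f, hf⟩ | ⟨s, hs, t, ht, hst, htw, hcl⟩
    · obtain ⟨k, rfl⟩ : ∃ k, r = k + 1 := ⟨r - 1, by omega⟩
      rw [← Sym_one, Sym_bip f hf] at hd
      rw [Sym_bip f hf]
      have := bip (K := K) (by
        rw [Finset.disjoint_left]
        intro v h1 h2
        have := (Finset.mem_filter.1 h1).2
        have := (Finset.mem_filter.1 h2).2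
        simp_all) hd k
      convert this using 1
      push_cast; ring
    · have claim : ∀ R : Finset V, ∀ W' A : Finset V, W' ⊆ W → t ∈ A → A ⊆ W' → Disjoint A R →
          (∀ u, (u ∈ A ∨ u ∈ R) ↔ (u ∈ W' ∧ (u = t ∨ G.Adj u t))) →
          KV K {a | a + ind A ∈ Sym G W' r} (d + 2 * r - 2 - A.card) := by
        intro R
        induction R using Finset.induction_on with
        | empty =>
          intro W' A hW' htA hAW hdis hK
          have hK' : ∀ u, u ∈ A ↔ (u ∈ W' ∧ (u = t ∨ G.Adj u t)) := fun u => by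
            rw [← hK u]; simp
          have hclA : ∀ u ∈ A, ∀ v ∈ A, u ≠ v → G.Adj u v := by
            intro u hu v hv hne
            rw [hK'] at hu hv
            rcases hu.2 with h1 | h1
            · rcases hv.2 with h2 | h2
              · exact absurd (h1.trans h2.symm) hne
              · exact h1 ▸ h2.symm
            · rcases hv.2 with h2 | h2
              · exact h2 ▸ h1
              · exact hcl u (hW' hu.1) v (hW' hv.1) h1 h2 hne
          rw [Sym_colon htA hAW (fun u hu e => (hK' u).2 ⟨hu, Or.inr e⟩) hclA]
          have hpos : 0 < A.card := Finset.card_pos.2 ⟨t, htA⟩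
          have hcW := Finset.card_le_card hW'
          by_cases h2 : 2 ≤ A.card
          · by_cases h3 : r ≤ A.card - 1
            · have : Sym G W' (r - (A.card - 1)) = Set.univ := by
                rw [Nat.sub_eq_zero_of_le h3]
                ext a; simp [Sym]
              rw [this]
              exact KV_univ _
            · have := ih W' (r - (A.card - 1)) (by omega) (by omega) d (UE_restrict hW' hd)
              refine this.mono ?_
              omega
          · have h1 : A.card = 1 := by omega
            have hiso : ∀ u ∈ W', ¬ G.Adj u t := by
              intro u hu e
              have huA := (hK' u).2 ⟨hu, Or.inr e⟩
              exact e.ne (Finset.card_le_one.1 (by omega) u huA t htA)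
            have hsW : s ∉ W' := fun h => hiso s h hst
            have hb : KV K (UE G W') (d - 1) := by
              apply twin_base hsW (hAW htA) hst hiso
              · intro u hu e
                by_contra hne
                exact hiso u hu (htw u (hW' hu) e hne)
              · exact UE_restrict (Finset.insert_subset hs hW') hd
            have hlt : W'.card < W.card := Finset.card_lt_card ⟨hW', fun h => hsW (h hs)⟩
            rw [h1]
            have := ih W' r (by omega) hr (d - 1) hb
            convert this using 1
            · simp
            · push_cast; ring
        | insert v R hvR ihR =>
          intro W' A hW' htA hAW hdis hK
          have hvA : v ∉ A := fun h => Finset.disjoint_left.1 hdis h (Finset.mem_insert_self _ _)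
          have hvW : v ∈ W' := ((hK v).1 (Or.inr (Finset.mem_insert_self _ _))).1
          have hdis' : Disjoint A R := Finset.disjoint_of_subset_right (Finset.subset_insert _ _) hdis
          have hup : IsUpperSet {a : V →₀ ℕ | a + ind A ∈ Sym G W' r} := by
            intro a b hab ha
            exact Sym_upper G W' r (add_le_add hab le_rfl) ha
          refine T1 hup (m := (single v 1 : V →₀ ℕ)) ?_ ?_
          · have h1 := ihR W' (insert v A) hW' (Finset.mem_insert_of_mem htA) (Finset.insert_subset hvW hAW)
              (by rw [Finset.disjoint_insert_left]; exact ⟨hvR, hdis'⟩)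
              (by
                intro u
                rw [← hK u, Finset.mem_insert, Finset.mem_insert]
                tauto)
            rw [ind_insert hvA, Finset.card_insert_of_notMem hvA] at h1
            rw [Finsupp.degree_single]
            convert h1 using 1
            · ext a
              simp only [Set.mem_setOf_eq, add_assoc]
            · push_cast; ring
          · have h1 := ihR (W'.erase v) A ((Finset.erase_subset _ _).trans hW') htA
              (fun u hu => Finset.mem_erase.2 ⟨fun h => hvA (h ▸ hu), hAW hu⟩) hdis' (by
                intro u
                rw [Finset.mem_erase]
                have h1 := hK u
                rw [Finset.mem_insert] at h1
                by_cases huv : u = v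
                · subst huv; tauto
                · tauto)
            have h2 := T3 (x := v) h1
            convert h2 using 1
            ext a
            rw [Set.mem_union, Set.mem_union]
            by_cases hav : (single v 1 : V →₀ ℕ) ≤ a
            · exact ⟨fun _ => Or.inr hav, fun _ => Or.inr hav⟩
            · have h0 : a v = 0 := by
                rw [Finsupp.single_le_iff] at hav; omega
              have : (a + ind A) v = 0 := by
                rw [Finsupp.add_apply, ind_apply, if_neg hvA, h0]
              have h3 := Sym_erase (G := G) (r := r) hvW this
              exact or_congr h3 Iff.rfl
      refine T1 (Sym_upper G W r) (m := (single t 1 : V →₀ ℕ)) ?_ ?_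
      · classical
        have h1 := claim (W.filter (fun u => G.Adj u t)) W {t} le_rfl (Finset.mem_singleton_self _)
          (Finset.singleton_subset_iff.2 ht) (by
            rw [Finset.disjoint_singleton_left, Finset.mem_filter]
            exact fun h => G.irrefl h.2) (by
            intro u
            rw [Finset.mem_singleton, Finset.mem_filter]
            constructor
            · rintro (h | h)
              · exact ⟨h ▸ ht, Or.inl h⟩
              · exact ⟨h.1, Or.inr h.2⟩
            · rintro ⟨h1, h2 | h2⟩
              · exact Or.inl h2
              · exact Or.inr ⟨h1, h2⟩)
        rw [ind_singleton, Finset.card_singleton] at h1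
        rw [Finsupp.degree_single]
        exact h1
      · have hc := Finset.card_erase_of_mem ht
        have hp : 0 < W.card := Finset.card_pos.2 ⟨t, ht⟩
        have h1 := ih (W.erase t) r (by omega) hr d (UE_restrict (Finset.erase_subset _ _) hd)
        have h2 := T3 (x := t) h1
        convert h2 using 1
        ext a
        rw [Set.mem_union, Set.mem_union]
        by_cases hav : (single t 1 : V →₀ ℕ) ≤ a
        · exact ⟨fun _ => Or.inr hav, fun _ => Or.inr hav⟩
        · have h0 : a t = 0 := by
            rw [Finsupp.single_le_iff] at hav; omega
          exact or_congr (Sym_erase (G := G) (r := r) ht h0) Iff.rfl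
end KZ
end

noncomputable section
set_option linter.all false
namespace KZ
open MvPolynomial Finsupp EdgeIdealReg
variable {V : Type} {K : Type} [Field K] [LinearOrder V]

lemma good_of_attach {G : SimpleGraph V} {Hset T : Set V} (hbip : (G.induce Hset).Colorable 2)
    (D : CliqueAttachment G Hset T) : Good G := by
  classical
  have c : (G.induce Hset).Coloring Bool := hbip.toColoring (by simp)
  have haH : ∀ i, D.a i ∈ Hset := fun i => D.T_sub (D.a_mem_T i)
  have hH : ∀ i v, v ∈ D.C i → v ∈ Hset → v = D.a i := by
    intro i v h1 h2
    have : v ∈ (D.C i : Set V) ∩ Hset := ⟨h1, h2⟩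
    rw [D.inter_H i] at this
    exact this
  have huniq : ∀ i j v, v ∉ Hset → v ∈ D.C i → v ∈ D.C j → i = j := by
    intro i j v hv h1 h2
    by_contra hne
    have : v ∈ ({D.a i} : Set V) := D.pairwise_inter i j hne ⟨h1, h2⟩
    rw [Set.mem_singleton_iff] at this
    exact hv (this ▸ haH i)
  have hex : ∀ v, v ∉ Hset → ∃ i, v ∈ D.C i := by
    intro v hv
    have : v ∈ Hset ∪ (⋃ i, (D.C i : Set V)) := by rw [D.cover]; trivial
    rcases this with h | h
    · exact absurd h hv
    · simpa using h
  intro W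
  by_cases hcase : ∀ i, ∀ s ∈ W, ∀ t ∈ W, s ∈ D.C i → t ∈ D.C i → s ≠ D.a i → t ≠ D.a i → s = t
  · left
    let cc : V → Bool := fun v => if h : v ∈ Hset then c ⟨v, h⟩ else true
    let f : V → Bool := fun v => if h : v ∈ Hset then cc v else !(cc (D.a (hex v h).choose))
    have fH : ∀ v, v ∈ Hset → f v = cc v := fun v h => dif_pos h
    have fC : ∀ i v, v ∈ D.C i → v ∉ Hset → f v = !(cc (D.a i)) := by
      intro i v hv h
      have h1 : f v = !(cc (D.a (hex v h).choose)) := dif_neg h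
      rw [h1, huniq _ i v h (hex v h).choose_spec hv]
    refine ⟨f, ?_⟩
    have key : ∀ i v, v ∈ D.C i → v ≠ D.a i → f v ≠ f (D.a i) := by
      intro i v hv hne
      have hvH : v ∉ Hset := fun h => hne (hH i v hv h)
      rw [fC i v hv hvH, fH _ (haH i)]
      simp
    intro u hu v hv e
    rcases D.edges_sub u v e with ⟨h1, h2⟩ | ⟨i, h1, h2⟩
    · rw [fH u h1, fH v h2]
      have : c ⟨u, h1⟩ ≠ c ⟨v, h2⟩ := c.valid (by simpa using e)
      simpa [cc, h1, h2] using this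
    · by_cases hua : u = D.a i
      · have hva : v ≠ D.a i := fun h => e.ne (hua.trans h.symm)
        rw [hua]
        exact (key i v h2 hva).symm
      · by_cases hva : v = D.a i
        · rw [hva]; exact key i u h1 hua
        · exact absurd (hcase i u hu v hv h1 h2 hua hva) e.ne
  · right
    push Not at hcase
    obtain ⟨i, s, hs, t, ht, hsC, htC, hsa, hta, hne⟩ := hcase
    have hnb : ∀ x, x ∈ D.C i → x ≠ D.a i → ∀ u, G.Adj u x → u ∈ D.C i := by
      intro x hx hxa u e
      have hxH : x ∉ Hset := fun h => hxa (hH i x hx h)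
      rcases D.edges_sub u x e with ⟨h1, h2⟩ | ⟨j, h1, h2⟩
      · exact absurd h2 hxH
      · rw [huniq i j x hxH hx h2]; exact h1
    have hcl : ∀ u ∈ D.C i, ∀ v ∈ D.C i, u ≠ v → G.Adj u v := fun u hu v hv h => D.clique i hu hv h
    refine ⟨s, hs, t, ht, hcl s hsC t htC hne, ?_, ?_⟩
    · intro u _ e hut
      exact hcl u (hnb s hsC hsa u e) t htC hut
    · intro u _ v _ e1 e2 huv
      exact hcl u (hnb t htC hta u e1) v (hnb t htC hta v e2) huv

lemma mem_edgeIdeal {G : SimpleGraph V} {W : Finset V} (hW : ∀ u v, G.Adj u v → u ∈ W) (f : MvPolynomial V K) :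
    f ∈ edgeIdeal K G ↔ f ∈ sp K (UE G W) := by
  have e1 : { p : MvPolynomial V K | ∃ u v : V, G.Adj u v ∧ p = X u * X v } =
      (fun s => monomial s (1 : K)) '' {s | ∃ u v, G.Adj u v ∧ s = (single u 1 : V →₀ ℕ) + (single v 1 : V →₀ ℕ)} := by
    ext p
    constructor
    · rintro ⟨u, v, e, rfl⟩
      refine ⟨_, ⟨u, v, e, rfl⟩, ?_⟩
      simp [X, monomial_mul]
    · rintro ⟨_, ⟨u, v, e, rfl⟩, rfl⟩
      refine ⟨u, v, e, ?_⟩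
      simp [X, monomial_mul]
  rw [edgeIdeal, e1, mem_ideal_span_monomial_image, mem_sp]
  apply forall_congr'
  intro a
  rw [MvPolynomial.mem_support_iff]
  apply imp_congr_right
  intro _
  constructor
  · rintro ⟨_, ⟨u, v, e, rfl⟩, hle⟩
    have h1 := hle u
    have h2 := hle v
    rw [Finsupp.add_apply, Finsupp.single_eq_same] at h1 h2
    exact ⟨u, hW u v e, v, hW v u e.symm, e, by omega, by omega⟩
  · rintro ⟨u, hu, v, hv, e, h1, h2⟩
    refine ⟨_, ⟨u, v, e, rfl⟩, fun w => ?_⟩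
    rw [Finsupp.add_apply]
    have hne := e.ne
    by_cases hw1 : w = u
    · subst hw1
      rw [Finsupp.single_eq_same, Finsupp.single_eq_of_ne hne]; omega
    · by_cases hw2 : w = v
      · subst hw2
        rw [Finsupp.single_eq_same, Finsupp.single_eq_of_ne hw1]; omega
      · rw [Finsupp.single_eq_of_ne hw1, Finsupp.single_eq_of_ne hw2]; omega

/-- degree tracking map -/
def th (K : Type) [Field K] (C : Finset V) : MvPolynomial V K →ₐ[K] Polynomial (MvPolynomial V K) :=
  aeval (fun v => if v ∈ C then Polynomial.X * Polynomial.C (X v) else Polynomial.C (X v))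

lemma th_monomial_one (C : Finset V) (a : V →₀ ℕ) :
    th K C (monomial a 1) = Polynomial.X ^ (∑ v ∈ C, a v) * Polynomial.C (monomial a 1) := by
  induction a using Finsupp.induction_linear with
  | zero =>
    have : monomial (0 : V →₀ ℕ) (1 : K) = 1 := rfl
    simp [this]
  | add a b ha hb =>
    have h1 : monomial (a + b) (1 : K) = monomial a 1 * monomial b (1 : K) := by
      rw [monomial_mul, mul_one]
    have h2 : ∑ v ∈ C, (a + b) v = ∑ v ∈ C, a v + ∑ v ∈ C, b v := by
      simp only [Finsupp.add_apply]; rw [Finset.sum_add_distrib]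
    rw [h1, map_mul, ha, hb, h2, pow_add, Polynomial.C_mul]; ring
  | single v n =>
    rw [← X_pow_eq_monomial, map_pow, map_pow]
    have h1 : th K C (X v) = if v ∈ C then Polynomial.X * Polynomial.C (X v) else Polynomial.C (X v) := by
      rw [th, aeval_X]
    have h2 : ∑ w ∈ C, (single v n : V →₀ ℕ) w = if v ∈ C then n else 0 := by
      simp [Finsupp.single_apply]
    rw [h1, h2]
    split_ifs
    · rw [mul_pow]
    · simp

lemma th_monomial (C : Finset V) (a : V →₀ ℕ) (c : K) :
    th K C (monomial a c) = Polynomial.X ^ (∑ v ∈ C, a v) * Polynomial.C (monomial a c) := by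
  have h1 : monomial a c = c • monomial a (1 : K) := by rw [smul_monomial, smul_eq_mul, mul_one]
  rw [h1, map_smul, th_monomial_one]
  have h2 : Polynomial.C (c • monomial a (1 : K)) = c • Polynomial.C (monomial a (1 : K)) := by
    rw [Polynomial.smul_C]
  rw [h2, mul_smul_comm]

lemma th_coeff (C : Finset V) (f : MvPolynomial V K) (a : V →₀ ℕ) (d : ℕ) :
    coeff a ((th K C f).coeff d) = if ∑ v ∈ C, a v = d then coeff a f else 0 := by
  induction f using MvPolynomial.induction_on' with
  | monomial b c =>
    rw [th_monomial, Polynomial.coeff_X_pow_mul', Polynomial.coeff_C, coeff_monomial]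
    by_cases hb : b = a
    · subst hb
      by_cases h : ∑ v ∈ C, b v = d
      · simp [h]
      · rw [if_neg h]
        split_ifs with h1 h2
        · omega
        · simp
        · simp
    · split_ifs <;> simp [hb]
  | add p q hp hq =>
    rw [map_add, Polynomial.coeff_add, coeff_add, hp, hq, coeff_add]
    split_ifs <;> simp

lemma th_dvd (C : Finset V) (f : MvPolynomial V K) (r : ℕ) :
    Polynomial.X ^ r ∣ th K C f ↔ ∀ a, coeff a f ≠ 0 → r ≤ ∑ v ∈ C, a v := by
  rw [Polynomial.X_pow_dvd_iff]
  constructor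
  · intro h a ha
    by_contra hlt
    have := congrArg (coeff a) (h _ (not_le.1 hlt))
    rw [th_coeff, if_pos rfl] at this
    exact ha (by simpa using this)
  · intro h d hd
    ext a
    rw [th_coeff, coeff_zero]
    split_ifs with h1
    · by_contra hne
      have := h a hne
      omega
    · rfl

/-- the prime ideal generated by variables -/
def PC (K : Type) [Field K] (C : Finset V) : Ideal (MvPolynomial V K) :=
  Ideal.comap (th K C).toRingHom (Ideal.span {Polynomial.X})

lemma mem_PC {C : Finset V} {f : MvPolynomial V K} :
    f ∈ PC K C ↔ Polynomial.X ∣ th K C f := by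
  rw [PC, Ideal.mem_comap, Ideal.mem_span_singleton]; rfl

instance PC_prime (C : Finset V) : (PC K C).IsPrime := by
  have : (Ideal.span {(Polynomial.X : Polynomial (MvPolynomial V K))}).IsPrime := by
    rw [Ideal.span_singleton_prime Polynomial.X_ne_zero]
    exact Polynomial.prime_X
  exact Ideal.comap_isPrime _ _

lemma X_mem_PC {C : Finset V} {v : V} : (X v : MvPolynomial V K) ∈ PC K C ↔ v ∈ C := by
  rw [mem_PC, ← pow_one (Polynomial.X : Polynomial (MvPolynomial V K)), th_dvd]
  constructor
  · intro h
    have := h (single v 1) (by simp [X])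
    by_contra hv
    rw [Finset.sum_eq_zero] at this
    · omega
    · intro w hw
      exact Finsupp.single_eq_of_ne (fun h => hv (h ▸ hw))
  · intro h a ha
    have : a = single v 1 := by
      by_contra hne
      rw [X, coeff_monomial, if_neg (fun h => hne h.symm)] at ha
      exact ha rfl
    subst this
    have := Finset.single_le_sum (f := fun w => (single v 1 : V →₀ ℕ) w) (fun _ _ => Nat.zero_le _) h
    simpa using this

lemma PC_le {C : Finset V} {Q : Ideal (MvPolynomial V K)} (h : ∀ v ∈ C, X v ∈ Q) : PC K C ≤ Q := by
  intro f hf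
  rw [mem_PC, ← pow_one (Polynomial.X : Polynomial (MvPolynomial V K)), th_dvd] at hf
  have : f ∈ Ideal.span (X '' (C : Set V)) := by
    rw [mem_ideal_span_X_image]
    intro a ha
    have h1 := hf a (MvPolynomial.mem_support_iff.1 ha)
    by_contra hn
    push Not at hn
    rw [Finset.sum_eq_zero (fun v hv => hn v hv)] at h1
    omega
  refine (Ideal.span_le.2 ?_) this
  rintro _ ⟨v, hv, rfl⟩
  exact h v hv

lemma edge_le_PC {G : SimpleGraph V} {C : Finset V} (h : ∀ u v, G.Adj u v → u ∈ C ∨ v ∈ C) : edgeIdeal K G ≤ PC K C := by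
  apply Ideal.span_le.2
  rintro _ ⟨u, v, e, rfl⟩
  rcases h u v e with h | h
  · exact Ideal.mul_mem_right _ _ (X_mem_PC.2 h)
  · exact Ideal.mul_mem_left _ _ (X_mem_PC.2 h)

lemma th_pow {C : Finset V} {I : Ideal (MvPolynomial V K)} (h : I ≤ PC K C) {r : ℕ} {f : MvPolynomial V K}
    (hf : f ∈ I ^ r) : Polynomial.X ^ r ∣ th K C f := by
  have h1 : Ideal.map (th K C).toRingHom I ≤ Ideal.span {Polynomial.X} := Ideal.map_le_iff_le_comap.2 h
  have h2 : (th K C).toRingHom f ∈ (Ideal.map (th K C).toRingHom I) ^ r := by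
    rw [← Ideal.map_pow]
    exact Ideal.mem_map_of_mem _ hf
  have h3 := Ideal.pow_right_mono h1 r h2
  rw [Ideal.span_singleton_pow, Ideal.mem_span_singleton] at h3
  exact h3

lemma sym_sub {G : SimpleGraph V} {W : Finset V} (hW : ∀ u v, G.Adj u v → u ∈ W) {r : ℕ} {f : MvPolynomial V K}
    (hf : f ∈ symbolicPower (edgeIdeal K G) r) : f ∈ sp K (Sym G W r) := by
  classical
  rw [mem_sp]
  intro a ha C hC
  have hle : edgeIdeal K G ≤ PC K C := edge_le_PC (fun u v e => hC.2 u (hW u v e) v (hW v u e.symm) e)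
  obtain ⟨Q, hQ, hQC⟩ := Ideal.exists_minimalPrimes_le hle
  obtain ⟨s, hs, hsf⟩ := hf Q hQ
  set C' := C.filter (fun v => (X v : MvPolynomial V K) ∈ Q) with hC'
  have hQp : Q.IsPrime := hQ.1.1
  have hle' : edgeIdeal K G ≤ PC K C' := by
    apply edge_le_PC
    intro u v e
    have : (X u * X v : MvPolynomial V K) ∈ Q := hQ.1.2 (Ideal.subset_span ⟨u, v, e, rfl⟩)
    rcases hQp.mem_or_mem this with h | h
    · exact Or.inl (Finset.mem_filter.2 ⟨X_mem_PC.1 (hQC h), h⟩)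
    · exact Or.inr (Finset.mem_filter.2 ⟨X_mem_PC.1 (hQC h), h⟩)
  have hs' : s ∉ PC K C' := fun h => hs (PC_le (fun v hv => (Finset.mem_filter.1 hv).2) h)
  have h1 := th_pow hle' hsf
  rw [map_mul] at h1
  have h2 := Polynomial.prime_X.pow_dvd_of_dvd_mul_left r (fun h => hs' (mem_PC.2 h)) h1
  exact ((th_dvd C' f r).1 h2 a ha).trans (Finset.sum_le_sum_of_subset (Finset.filter_subset _ _))

lemma sym_sup {G : SimpleGraph V} {W : Finset V} (hW : ∀ u v, G.Adj u v → u ∈ W) {r : ℕ} {f : MvPolynomial V K}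
    (hf : f ∈ sp K (Sym G W r)) : f ∈ symbolicPower (edgeIdeal K G) r := by
  classical
  intro Q hQ
  have hQp : Q.IsPrime := hQ.1.1
  set C := W.filter (fun v => (X v : MvPolynomial V K) ∈ Q) with hC
  have hcov : gcov G W C := by
    refine ⟨Finset.filter_subset _ _, fun u hu v hv e => ?_⟩
    have : (X u * X v : MvPolynomial V K) ∈ Q := hQ.1.2 (Ideal.subset_span ⟨u, v, e, rfl⟩)
    exact (hQp.mem_or_mem this).imp (fun h => Finset.mem_filter.2 ⟨hu, h⟩) (fun h => Finset.mem_filter.2 ⟨hv, h⟩)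
  have hex : ∀ v, v ∈ C → ∃ u, G.Adj v u ∧ (X u : MvPolynomial V K) ∉ Q := by
    intro v0 hv0
    by_contra hn
    push Not at hn
    have h1 : edgeIdeal K G ≤ PC K (C.erase v0) := by
      apply edge_le_PC
      intro u v e
      by_cases hu : u = v0
      · right
        exact Finset.mem_erase.2 ⟨fun h => e.ne (hu.trans h.symm), Finset.mem_filter.2 ⟨hW v u e.symm, hn v (hu ▸ e)⟩⟩
      by_cases hv : v = v0
      · left
        exact Finset.mem_erase.2 ⟨hu, Finset.mem_filter.2 ⟨hW u v e, hn u (hv ▸ e.symm)⟩⟩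
      exact (hcov.2 u (hW u v e) v (hW v u e.symm) e).imp (fun h => Finset.mem_erase.2 ⟨hu, h⟩)
        (fun h => Finset.mem_erase.2 ⟨hv, h⟩)
    have h2 : PC K (C.erase v0) ≤ Q := PC_le (fun v hv => (Finset.mem_filter.1 (Finset.mem_erase.1 hv).2).2)
    have h3 := hQ.2 ⟨PC_prime _, h1⟩ h2 (Finset.mem_filter.1 hv0).2
    exact (Finset.mem_erase.1 (X_mem_PC.1 h3)).1 rfl
  choose! u hu1 hu2 using hex
  obtain ⟨N, hN⟩ : ∃ N, f.totalDegree ≤ N := ⟨_, le_rfl⟩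
  refine ⟨∏ v ∈ C, X (u v) ^ N, ?_, ?_⟩
  · intro h
    obtain ⟨v, hv, h⟩ := (hQp.prod_mem_iff).1 h
    exact hu2 v hv (hQp.mem_of_pow_mem _ h)
  · conv_rhs => rw [f.as_sum]
    rw [Finset.mul_sum]
    apply Ideal.sum_mem
    intro a ha
    have hsum : r ≤ ∑ v ∈ C, a v := hf a (MvPolynomial.mem_support_iff.1 ha) C hcov
    have hdeg : ∀ v, a v ≤ N := by
      intro v
      refine le_trans ?_ ((le_totalDegree ha).trans hN)
      by_cases hv : v ∈ a.support
      · exact Finset.single_le_sum (f := fun v => a v) (fun _ _ => Nat.zero_le _) hv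
      · rw [Finsupp.notMem_support_iff.1 hv]; exact Nat.zero_le _
    have hmem : ∏ v ∈ C, (X (u v) * X v : MvPolynomial V K) ^ a v ∈ edgeIdeal K G ^ r := by
      apply Ideal.pow_le_pow_right hsum
      rw [← Finset.prod_pow_eq_pow_sum]
      apply Ideal.prod_mem_prod
      intro v hv
      have hm : (X (u v) * X v : MvPolynomial V K) ∈ edgeIdeal K G :=
        Ideal.subset_span ⟨u v, v, (hu1 v hv).symm, rfl⟩
      exact Ideal.pow_mem_pow hm _
    refine Ideal.mem_of_dvd _ ?_ hmem
    simp only [mul_pow]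
    rw [Finset.prod_mul_distrib]
    apply mul_dvd_mul
    · exact Finset.prod_dvd_prod_of_dvd _ _ (fun v _ => pow_dvd_pow _ (hdeg v))
    · rw [monomial_eq]
      apply Dvd.dvd.mul_left
      have : a.prod (fun n e => (X n : MvPolynomial V K) ^ e) = ∏ v ∈ C ∪ a.support, (X v : MvPolynomial V K) ^ a v :=
        Finsupp.prod_of_support_subset _ Finset.subset_union_right _ (by simp)
      rw [this]
      exact Finset.prod_dvd_prod_of_subset _ _ _ Finset.subset_union_left

lemma mem_sym {G : SimpleGraph V} {W : Finset V} (hW : ∀ u v, G.Adj u v → u ∈ W) {r : ℕ} (f : MvPolynomial V K) :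
    f ∈ symbolicPower (edgeIdeal K G) r ↔ f ∈ sp K (Sym G W r) :=
  ⟨sym_sub hW, sym_sup hW⟩
end KZ
end

noncomputable section
set_option linter.all false
namespace KZ
open MvPolynomial Finsupp EdgeIdealReg
variable {V : Type} {K : Type} [Field K]

lemma edgeIdeal_ne_top (G : SimpleGraph V) : edgeIdeal K G ≠ ⊤ := by
  intro h
  have h1 : edgeIdeal K G ≤ RingHom.ker (constantCoeff : MvPolynomial V K →+* K) := by
    apply Ideal.span_le.2
    rintro _ ⟨u, v, e, rfl⟩
    simp [RingHom.mem_ker]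
  have h2 := h1 (h ▸ Submodule.mem_top : (1 : MvPolynomial V K) ∈ edgeIdeal K G)
  simp [RingHom.mem_ker] at h2

lemma fg_of_res {I : Ideal (MvPolynomial V K)} (F : GradedFreeResolution I) : I.FG := by
  have k0 : Fin (F.rank 0) := ⟨0, by rw [F.rank_zero]; omega⟩
  have huniq : ∀ k : Fin (F.rank 0), k = k0 := by
    intro k
    have h1 := k.2
    have h2 := k0.2
    apply Fin.ext
    have h3 := F.rank_zero
    omega
  have : I = Ideal.span (Set.range (F.mat 0 k0)) := by
    apply le_antisymm
    · intro f hf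
      obtain ⟨v, hv⟩ := (F.range_zero f).1 hf
      have h1 := congrFun hv k0
      rw [Matrix.mulVecLin_apply] at h1
      have h2 : (∑ j, F.mat 0 k0 j * v j) = f := h1
      rw [← h2]
      apply Ideal.sum_mem
      intro j _
      exact Ideal.mul_mem_right _ _ (Ideal.subset_span ⟨j, rfl⟩)
    · apply Ideal.span_le.2
      rintro _ ⟨j, rfl⟩
      apply (F.range_zero _).2
      refine ⟨Pi.single j 1, ?_⟩
      rw [Matrix.mulVecLin_apply]
      ext1 k
      rw [huniq k]
      simp
  rw [this]
  exact Submodule.fg_span (Set.finite_range _)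

lemma bdd_res {I : Ideal (MvPolynomial V K)} {d : ℤ} (F : GradedFreeResolution I)
    (h : ∀ i (k : Fin (F.rank i)), (F.deg i k : ℤ) ≤ d + i) : 0 ≤ d := by
  have k0 : Fin (F.rank 0) := ⟨0, by rw [F.rank_zero]; omega⟩
  have := h 0 k0
  rw [F.deg_zero] at this
  simpa using this

lemma edges_finite {G : SimpleGraph V} {r : ℕ} (hr : 1 ≤ r) (hfg : (symbolicPower (edgeIdeal K G) r).FG) :
    ∃ W : Finset V, ∀ u v, G.Adj u v → u ∈ W := by
  classical
  obtain ⟨A, hA⟩ := hfg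
  refine ⟨A.biUnion (fun g => g.vars), ?_⟩
  intro v u e
  by_contra hv
  let φ1 : MvPolynomial V K →ₐ[K] Polynomial K := aeval (fun w => if w = u then Polynomial.X else 0)
  let φ2 : MvPolynomial V K →ₐ[K] Polynomial K := aeval (fun w => if w = u ∨ w = v then Polynomial.X else 0)
  have hprime : (RingHom.ker φ1.toRingHom).IsPrime := RingHom.ker_isPrime _
  have hle : edgeIdeal K G ≤ RingHom.ker φ1.toRingHom := by
    apply Ideal.span_le.2
    rintro _ ⟨x, y, e, rfl⟩
    show φ1 (X x * X y) = 0
    rw [map_mul]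
    simp only [φ1, aeval_X]
    split_ifs with h1 h2
    · exact absurd (h1.trans h2.symm) e.ne
    · simp
    · simp
    · simp
  obtain ⟨Q, hQ, hQle⟩ := Ideal.exists_minimalPrimes_le hle
  have hJ1 : ∀ g ∈ symbolicPower (edgeIdeal K G) r, φ1 g = 0 := by
    intro g hg
    obtain ⟨s, hs, hsg⟩ := hg Q hQ
    have h1 : s * g ∈ Q := hQ.1.2 (Ideal.pow_le_self (by omega) hsg)
    exact hQle ((hQ.1.1.mem_or_mem h1).resolve_left hs)
  have hJ2 : symbolicPower (edgeIdeal K G) r ≤ RingHom.ker φ2.toRingHom := by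
    rw [← hA]
    apply Ideal.span_le.2
    intro g hg
    have h1 : φ1 g = 0 := hJ1 g (by rw [← hA]; exact Ideal.subset_span hg)
    show φ2 g = 0
    rw [← h1]
    have hvg : v ∉ g.vars := fun h => hv (Finset.mem_biUnion.2 ⟨g, hg, h⟩)
    apply eval₂Hom_congr' rfl _ rfl
    intro w hw _
    have : w ≠ v := fun h => hvg (h ▸ hw)
    simp [this]
  have hmem : (X u * X v : MvPolynomial V K) ^ r ∈ symbolicPower (edgeIdeal K G) r := by
    intro p hp
    refine ⟨1, (Ideal.ne_top_iff_one p).1 hp.1.1.ne_top, ?_⟩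
    rw [one_mul]
    have hm : (X u * X v : MvPolynomial V K) ∈ edgeIdeal K G := Ideal.subset_span ⟨u, v, e.symm, rfl⟩
    exact Ideal.pow_mem_pow hm _
  have h2 : φ2 ((X u * X v) ^ r) = 0 := hJ2 hmem
  rw [map_pow, map_mul] at h2
  simp [φ2] at h2

lemma edge_fg {G : SimpleGraph V} {W : Finset V} (hW : ∀ u v, G.Adj u v → u ∈ W) : (edgeIdeal K G).FG := by
  classical
  apply Submodule.fg_span
  apply ((W ×ˢ W).image (fun p : V × V => (X p.1 * X p.2 : MvPolynomial V K))).finite_toSet.subset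
  rintro _ ⟨u, v, e, rfl⟩
  rw [Finset.mem_coe, Finset.mem_image]
  exact ⟨(u, v), Finset.mem_product.2 ⟨hW u v e, hW v u e.symm⟩, rfl⟩

lemma edge_KV [LinearOrder V] {G : SimpleGraph V} {W : Finset V} (hW : ∀ u v, G.Adj u v → u ∈ W) :
    ∃ d, KV K (UE G W) d := by
  classical
  let L : List (V →₀ ℕ) := (((W ×ˢ W).filter (fun p => G.Adj p.1 p.2)).image
    (fun p : V × V => (single p.1 1 : V →₀ ℕ) + (single p.2 1 : V →₀ ℕ))).toList
  obtain ⟨d, hd⟩ := KV_gl (K := K) L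
  refine ⟨d, ?_⟩
  convert hd using 1
  ext a
  rw [mem_gl]
  constructor
  · rintro ⟨u, hu, v, hv, e, h1, h2⟩
    refine ⟨(single u 1 : V →₀ ℕ) + (single v 1 : V →₀ ℕ), ?_, ?_⟩
    · rw [Finset.mem_toList, Finset.mem_image]
      exact ⟨(u, v), Finset.mem_filter.2 ⟨Finset.mem_product.2 ⟨hu, hv⟩, e⟩, rfl⟩
    · intro w
      rw [Finsupp.add_apply]
      have hne := e.ne
      by_cases hw1 : w = u
      · subst hw1
        rw [Finsupp.single_eq_same, Finsupp.single_eq_of_ne hne]; omega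
      · by_cases hw2 : w = v
        · subst hw2
          rw [Finsupp.single_eq_same, Finsupp.single_eq_of_ne hw1]; omega
        · rw [Finsupp.single_eq_of_ne hw1, Finsupp.single_eq_of_ne hw2]; omega
  · rintro ⟨m, hm, hle⟩
    rw [Finset.mem_toList, Finset.mem_image] at hm
    obtain ⟨⟨u, v⟩, hp, rfl⟩ := hm
    rw [Finset.mem_filter, Finset.mem_product] at hp
    have h1 := hle u
    have h2 := hle v
    rw [Finsupp.add_apply, Finsupp.single_eq_same] at h1 h2
    exact ⟨u, hp.1.1, v, hp.1.2, hp.2, by omega, by omega⟩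

theorem final_bound (G : SimpleGraph V) (Hset T : Set V) (hbip : (G.induce Hset).Colorable 2)
    (hatt : Nonempty (CliqueAttachment G Hset T)) (r : ℕ) (hr : 1 ≤ r) :
    regQuot (symbolicPower (edgeIdeal K G) r) ≤
      ((2 * (r : ℤ) - 2 : ℤ) : WithBot ℤ) + regQuot (edgeIdeal K G) := by
  obtain ⟨D⟩ := hatt
  letI : LinearOrder V := (exists_wellOrder V).choose
  have hG := good_of_attach hbip D
  by_cases htop : symbolicPower (edgeIdeal K G) r = ⊤
  · rw [regQuot, if_pos htop]; exact bot_le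
  rw [regQuot, if_neg htop, regQuot, if_neg (edgeIdeal_ne_top G), ← WithBot.coe_add, WithBot.coe_le_coe]
  set S1 := { d : ℤ | ∃ F : GradedFreeResolution (symbolicPower (edgeIdeal K G) r),
      ∀ i (k : Fin (F.rank i)), (F.deg i k : ℤ) ≤ d + i } with hS1
  set S0 := { d : ℤ | ∃ F : GradedFreeResolution (edgeIdeal K G),
      ∀ i (k : Fin (F.rank i)), (F.deg i k : ℤ) ≤ d + i } with hS0
  have b1 : BddBelow S1 := ⟨0, fun d ⟨F, hF⟩ => bdd_res F hF⟩
  have b0 : BddBelow S0 := ⟨0, fun d ⟨F, hF⟩ => bdd_res F hF⟩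
  by_cases hne : S1.Nonempty
  · obtain ⟨d1, F1, hF1⟩ := hne
    have hfg := fg_of_res F1
    obtain ⟨W, hW⟩ := edges_finite hr hfg
    have hne0 : S0.Nonempty := by
      obtain ⟨d, hd⟩ := edge_KV (K := K) hW
      exact ⟨max d 0, P2 (UE_upper G W) (mem_edgeIdeal hW) (edge_fg hW) (le_max_right _ _) (hd.mono (le_max_left _ _))⟩
    obtain ⟨F0, hF0⟩ := Int.csInf_mem hne0 b0
    have h0 := bdd_res F0 hF0
    have hKV := P1 (mem_edgeIdeal hW) F0 hF0
    have hKV2 := main_sym hG _ W r le_rfl hr _ hKV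
    have := P2 (Sym_upper G W r) (mem_sym hW) hfg (by omega) hKV2
    have h2 := csInf_le b1 this
    omega
  · rw [Set.not_nonempty_iff_eq_empty] at hne
    rw [hne, Int.csInf_empty]
    have : 0 ≤ sInf S0 := by
      by_cases h : S0.Nonempty
      · obtain ⟨F0, hF0⟩ := Int.csInf_mem h b0
        exact bdd_res F0 hF0
      · rw [Set.not_nonempty_iff_eq_empty] at h
        rw [h, Int.csInf_empty]
    omega
end KZ
end

open EdgeIdealReg in
/-- If `H` is bipartite and `G = H_T` is obtained by attaching unions of complete graphs at
the vertices of `T ⊆ V(H)`, then `reg(S/I(G)^{(r)}) ≤ 2r + reg(S/I(G)) - 2` for all `r ≥ 1`. -/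
theorem reg_symbolic_bipartite_attached_bound {V K : Type} [Field K]
    (G : SimpleGraph V) (Hset T : Set V) (hbip : (G.induce Hset).Colorable 2)
    (hatt : Nonempty (CliqueAttachment G Hset T)) (r : ℕ) (hr : 1 ≤ r) :
    regQuot (symbolicPower (edgeIdeal K G) r) ≤
      ((2 * (r : ℤ) - 2 : ℤ) : WithBot ℤ) + regQuot (edgeIdeal K G) := by
  exact KZ.final_bound G Hset T hbip hatt r hr
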